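/- There exist an infinite-dimensional separable real Banach space B which is an L∞-space, and a family (Y_ξ)_{ξ<ω₁} of infinite-dimensional separable real Banach spaces indexed by the first uncountable ordinal, such that: (i) each Y_ξ is an L∞-space, is hereditarily indecomposable, is reflexively saturated (every infinite-dimensional closed subspace of Y_ξ contains an infinite-dimensional reflexive closed subspace), and has the scalar-plus-compact property; (ii) each Y_ξ is a quotient of B, i.e. there is a surjective bounded linear operator from B onto Y_ξ; (iii) for all ξ ≠ ζ, Y_ξ and Y_ζ are totally incomparable: no infinite-dimensional closed subspace of Y_ξ is isomorphic to a closed subspace of Y_ζ; (iv) for all ξ ≠ ζ, every bounded linear operator T : Y_ξ → Y_ζ is compact. -/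

import Mathlib

noncomputable section

/-- A Banach space is an `L∞`-space with constant `C` if it admits an increasing sequence
of finite-dimensional subspaces with dense union, each of which is `C`-isomorphic to
`ℝ^n` (of the corresponding dimension `n`) with the supremum norm. -/
def IsLinftySpaceWith (C : ℝ) (X : Type*) [SeminormedAddCommGroup X] [NormedSpace ℝ X] :
    Prop :=
  ∃ F : ℕ → Submodule ℝ X, Monotone F ∧ (∀ n, FiniteDimensional ℝ ↥(F n)) ∧
    Dense (⋃ n, (F n : Set X)) ∧
    ∀ n, ∃ T : ↥(F n) ≃L[ℝ] (Fin (Module.finrank ℝ ↥(F n)) → ℝ),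
      ‖(T : ↥(F n) →L[ℝ] (Fin (Module.finrank ℝ ↥(F n)) → ℝ))‖ *
        ‖(T.symm : (Fin (Module.finrank ℝ ↥(F n)) → ℝ) →L[ℝ] ↥(F n))‖ ≤ C

/-- An `L∞`-space: an `L∞,C`-space for some constant `C ≥ 1`. -/
def IsLinftySpace (X : Type*) [SeminormedAddCommGroup X] [NormedSpace ℝ X] : Prop :=
  ∃ C : ℝ, 1 ≤ C ∧ IsLinftySpaceWith C X

/-- A space is hereditarily indecomposable if no infinite-dimensional closed subspace is
the topological direct sum of two infinite-dimensional closed subspaces. -/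
def HereditarilyIndecomposable (X : Type*) [SeminormedAddCommGroup X] [NormedSpace ℝ X] :
    Prop :=
  ∀ Z U V : Submodule ℝ X, IsClosed (Z : Set X) → ¬FiniteDimensional ℝ ↥Z →
    IsClosed (U : Set X) → IsClosed (V : Set X) →
    ¬FiniteDimensional ℝ ↥U → ¬FiniteDimensional ℝ ↥V → U ⊓ V = ⊥ → U ⊔ V ≠ Z

/-- The scalar-plus-compact property: every bounded linear operator on `X` is a scalar
multiple of the identity plus a compact operator. -/
def ScalarPlusCompact (X : Type*) [SeminormedAddCommGroup X] [NormedSpace ℝ X] : Prop :=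
  ∀ T : X →L[ℝ] X, ∃ (c : ℝ) (K : X →L[ℝ] X),
    IsCompactOperator K ∧ T = c • ContinuousLinearMap.id ℝ X + K

/-- A Banach space is reflexive if the canonical inclusion into its double dual is
surjective. -/
def IsReflexiveSpace (X : Type*) [SeminormedAddCommGroup X] [NormedSpace ℝ X] : Prop :=
  Function.Surjective (NormedSpace.inclusionInDoubleDual ℝ X)

/-- `X` contains no infinite-dimensional reflexive closed subspace. -/
def NoReflexiveSubspace (X : Type*) [NormedAddCommGroup X] [NormedSpace ℝ X] : Prop :=
  ∀ Y : Submodule ℝ X, IsClosed (Y : Set X) → ¬FiniteDimensional ℝ ↥Y →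
    ¬IsReflexiveSpace ↥Y

/-- `X` is reflexively saturated: every infinite-dimensional closed subspace contains an
infinite-dimensional reflexive closed subspace. -/
def ReflexivelySaturated (X : Type*) [NormedAddCommGroup X] [NormedSpace ℝ X] : Prop :=
  ∀ Y : Submodule ℝ X, IsClosed (Y : Set X) → ¬FiniteDimensional ℝ ↥Y →
    ∃ Z : Submodule ℝ X, Z ≤ Y ∧ IsClosed (Z : Set X) ∧ ¬FiniteDimensional ℝ ↥Z ∧
      IsReflexiveSpace ↥Z

/-- The space `ℓ₁` of absolutely summable real sequences. -/
abbrev EllOne : Type := lp (fun _ : ℕ => ℝ) 1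

/-- The space `c₀` of real null sequences with the supremum norm. -/
abbrev CZero : Type := ZeroAtInftyContinuousMap ℕ ℝ

/-- A bundled (real) Banach space. -/
structure BanachPkg where
  carrier : Type
  [nacg : NormedAddCommGroup carrier]
  [nsp : NormedSpace ℝ carrier]
  [complete : CompleteSpace carrier]

attribute [instance] BanachPkg.nacg BanachPkg.nsp BanachPkg.complete

namespace AH

def prq : ℕ → ℕ × ℕ
  | 0 => (3, 3)
  | j + 1 => (2 * (4 ^ (prq j).1 * (prq j).2 ^ (2 * (prq j).1 + 1)),
      4 ^ (prq j).1 * (prq j).2 ^ (2 * (prq j).1 + 1) + 2)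

def ee (j : ℕ) : ℕ := (prq j).1
def DD (j : ℕ) : ℕ := (prq j).2
def nn (j : ℕ) : ℕ := 4 ^ ee j * DD j ^ (2 * ee j + 1)
def mm (j : ℕ) : ℝ := 2 ^ ee j

lemma ee_succ (j : ℕ) : ee (j + 1) = 2 * nn j := rfl
lemma DD_succ (j : ℕ) : DD (j + 1) = nn j + 2 := rfl

lemma ee_DD (j : ℕ) : 3 ≤ ee j ∧ 3 ≤ DD j := by
  induction j with
  | zero => exact ⟨le_refl 3, le_refl 3⟩
  | succ j ih =>
    have h : 3 ≤ nn j := by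
      unfold nn
      calc 3 ≤ DD j := ih.2
        _ ≤ DD j ^ (2 * ee j + 1) := Nat.le_self_pow (by omega) _
        _ ≤ _ := Nat.le_mul_of_pos_left _ (by positivity)
    rw [ee_succ, DD_succ]; omega

lemma DD_le_nn (j : ℕ) : DD j ≤ nn j := by
  unfold nn
  exact le_trans (Nat.le_self_pow (by omega) _) (Nat.le_mul_of_pos_left _ (by positivity))

lemma nn_pos (j : ℕ) : 3 ≤ nn j := le_trans (ee_DD j).2 (DD_le_nn j)

lemma nn_mono : StrictMono nn := strictMono_nat_of_lt_succ fun j => by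
  have := DD_le_nn (j + 1); rw [DD_succ] at this; omega

lemma nn_DD {i j : ℕ} (h : i < j) : nn i + 2 ≤ DD j := by
  obtain ⟨k, rfl⟩ : ∃ k, j = k + 1 := ⟨j - 1, by omega⟩
  rw [DD_succ]; have := nn_mono.monotone (show i ≤ k by omega); omega

lemma mm_sq_DD (j : ℕ) : mm j ^ 2 * (DD j : ℝ) ^ (2 * ee j + 1) = nn j := by
  unfold mm nn; push_cast
  rw [← pow_mul, mul_comm (ee j) 2, pow_mul]; norm_num

lemma mm_ge (j : ℕ) : 8 ≤ mm j := by
  unfold mm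
  calc (8 : ℝ) = 2 ^ 3 := by norm_num
    _ ≤ 2 ^ ee j := pow_le_pow_right₀ (by norm_num) (ee_DD j).1

lemma mm_pos (j : ℕ) : 0 < mm j := lt_of_lt_of_le (by norm_num) (mm_ge j)

lemma DD_ge (j : ℕ) : (3 : ℝ) ≤ DD j := by exact_mod_cast (ee_DD j).2

lemma mm_sq_nn (j : ℕ) : mm j ^ 2 ≤ nn j := by
  rw [← mm_sq_DD]
  have : (1 : ℝ) ≤ (DD j : ℝ) ^ (2 * ee j + 1) := one_le_pow₀ (by linarith [DD_ge j])
  nlinarith [mm_pos j, sq_nonneg (mm j)]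

lemma nn_sq_mm {i j : ℕ} (h : i < j) : (nn i : ℝ) ^ 2 ≤ mm j := by
  obtain ⟨k, rfl⟩ : ∃ k, j = k + 1 := ⟨j - 1, by omega⟩
  unfold mm
  rw [ee_succ]
  have h1 : (nn i : ℝ) ≤ nn k := by exact_mod_cast nn_mono.monotone (show i ≤ k by omega)
  have h2 : (nn k : ℝ) ≤ 2 ^ nn k := by exact_mod_cast Nat.lt_two_pow_self.le
  rw [mul_comm, pow_mul]
  gcongr; linarith

lemma mm_sq_mm {i j : ℕ} (h : i < j) : mm i ^ 2 ≤ mm j := by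
  have h1 := nn_sq_mm h
  have h2 := mm_sq_nn i
  have : (3 : ℝ) ≤ nn i := by exact_mod_cast nn_pos i
  nlinarith

lemma mm_mono : StrictMono mm := fun i j h => by
  have := mm_sq_mm h; have := mm_ge i; nlinarith

lemma le_mm (j : ℕ) : (j : ℝ) + 1 ≤ mm j := by
  induction j with
  | zero => have := mm_ge 0; norm_num; linarith
  | succ j ih => have := mm_sq_mm (Nat.lt_succ_self j); have := mm_ge j; push_cast; nlinarith

lemma exists_mm (c : ℝ) : ∃ N, ∀ j ≥ N, c < mm j := by
  obtain ⟨N, hN⟩ := exists_nat_gt c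
  refine ⟨N, fun j hj => ?_⟩
  have := le_mm j
  have : (N : ℝ) ≤ j := by exact_mod_cast hj
  linarith

lemma james_nn {N j : ℕ} (h : N ≤ DD j) : N ^ (ee j + 3) ≤ nn j := by
  unfold nn
  have h3 := ee_DD j
  calc N ^ (ee j + 3) ≤ DD j ^ (ee j + 3) := Nat.pow_le_pow_left h _
    _ ≤ DD j ^ (2 * ee j + 1) := Nat.pow_le_pow_right (by omega) (by omega)
    _ ≤ _ := Nat.le_mul_of_pos_left _ (by positivity)

/-! data -/
abbrev Dat := ℕ × ℕ × ℕ × ℕ × ℕ × ℚ × ℚ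

def nd (n : ℕ) : Dat := (exists_surjective_nat Dat).choose (Nat.unpair n).1

lemma exists_nd (d : Dat) (N : ℕ) : ∃ n ≥ N, nd n = d := by
  obtain ⟨a, ha⟩ := (exists_surjective_nat Dat).choose_spec d
  exact ⟨Nat.pair a N, Nat.right_le_pair a N, by simp [nd, ha]⟩

def W (n : ℕ) : ℕ := (nd n).1
def AG (n : ℕ) : ℕ := (nd n).2.1
def Pp (n : ℕ) : ℕ := (nd n).2.2.1
def E1 (n : ℕ) : ℕ := (nd n).2.2.2.1
def E0 (n : ℕ) : ℕ := (nd n).2.2.2.2.1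
def R1 (n : ℕ) : ℝ := (nd n).2.2.2.2.2.1
def R0 (n : ℕ) : ℝ := (nd n).2.2.2.2.2.2

def kap (j : ℕ) : ℕ := (Nat.unpair (j / 2)).1

inductive Act (L : Set ℕ) : ℕ → Prop
  | mk (n : ℕ) : W n ∈ L → W n ≤ n → 1 ≤ AG n → AG n ≤ nn (W n) → |R1 n| ≤ 1 → |R0 n| ≤ 1 →
    (R1 n ≠ 0 → Pp n ≤ E1 n) → (R1 n ≠ 0 → E1 n < n) → (R1 n ≠ 0 → Act L (E1 n)) →
    (R0 n ≠ 0 → Pp n ≤ E0 n) → (R0 n ≠ 0 → E0 n < n) → (R0 n ≠ 0 → Act L (E0 n)) →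
    Pp n ≤ n → (Pp n ≠ 0 → Act L (Pp n - 1)) →
    (Pp n ≠ 0 → W (Pp n - 1) = W n ∧ AG (Pp n - 1) < AG n) →
    (Odd (W n) → E1 n = E0 n ∧ R1 n = 1 ∧ R0 n = 1 ∧ W n < W (E1 n) ∧ kap (W (E1 n)) = Pp n
      ∧ Even (W (E1 n))) →
    Act L n

def bb (γ : ℕ) (f : ℕ → ℝ) : ℝ := (R1 γ * f (E1 γ) + R0 γ * f (E0 γ)) / 2
def pv (γ : ℕ) (f : ℕ → ℝ) : ℝ := if Pp γ = 0 then 0 else f (Pp γ - 1)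

open Classical in
def ext (L : Set ℕ) (u : ℕ → ℝ) (γ n : ℕ) : ℝ :=
  if ¬ Act L γ then 0 else if γ < n then u γ else
    (if h : Pp γ ≠ 0 ∧ Pp γ - 1 < γ then ext L u (Pp γ - 1) n else 0) +
    (if n ≤ Pp γ then 0 else (mm (W γ))⁻¹ *
      ((R1 γ * (if h : E1 γ < γ then ext L u (E1 γ) n - ext L u (E1 γ) (Pp γ) else 0) +
        R0 γ * (if h : E0 γ < γ then ext L u (E0 γ) n - ext L u (E0 γ) (Pp γ) else 0)) / 2))
termination_by γ
decreasing_by all_goals first | exact h | exact h.2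

def Pr (L : Set ℕ) (n : ℕ) (u : ℕ → ℝ) : ℕ → ℝ := fun γ => ext L u γ n

variable {L : Set ℕ} {γ n m : ℕ} {u v f g x : ℕ → ℝ}

lemma Act.pp (h : Act L γ) (hp : Pp γ ≠ 0) :
    Act L (Pp γ - 1) ∧ Pp γ - 1 < γ ∧ W (Pp γ - 1) = W γ ∧ AG (Pp γ - 1) < AG γ := by
  cases h with
  | mk _ a1 a2 a3 a4 a5 a6 a7 a8 a9 a10 a11 a12 a13 a14 a15 =>
    exact ⟨a14 hp, by omega, (a15 hp).1, (a15 hp).2⟩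

lemma Act.ple (h : Act L γ) : Pp γ ≤ γ := by cases h; assumption
lemma Act.wL (h : Act L γ) : W γ ∈ L := by cases h; assumption
lemma Act.wle (h : Act L γ) : W γ ≤ γ := by cases h; assumption
lemma Act.ag1 (h : Act L γ) : 1 ≤ AG γ := by cases h; assumption
lemma Act.ag (h : Act L γ) : AG γ ≤ nn (W γ) := by cases h; assumption
lemma Act.odd (h : Act L γ) (ho : Odd (W γ)) : E1 γ = E0 γ ∧ R1 γ = 1 ∧ R0 γ = 1 ∧
    W γ < W (E1 γ) ∧ kap (W (E1 γ)) = Pp γ ∧ Act L (E1 γ) ∧ Even (W (E1 γ)) := by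
  cases h with
  | mk _ a1 a2 a3 a4 a5 a6 a7 a8 a9 a10 a11 a12 a13 a14 a15 a16 =>
    obtain ⟨b1, b2, b3, b4, b5, b6⟩ := a16 ho
    exact ⟨b1, b2, b3, b4, b5, a9 (by rw [b2]; norm_num), b6⟩

lemma Pr_lt (h : Act L γ) (hn : γ < n) : Pr L n u γ = u γ := by
  unfold Pr; rw [ext]; simp [h, hn]

lemma Pr_nact (h : ¬ Act L γ) : Pr L n u γ = 0 := by
  unfold Pr; rw [ext]; simp [h]

lemma bb_congr (h : Act L γ) (hfg : ∀ η, Pp γ ≤ η → η < γ → Act L η → f η = g η) :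
    bb γ f = bb γ g := by
  unfold bb
  cases h with
  | mk _ a1 a2 a3 a4 a5 a6 a7 a8 a9 a10 a11 a12 =>
    congr 1; congr 1
    · by_cases hr : R1 γ = 0
      · simp [hr]
      · rw [hfg _ (a7 hr) (a8 hr) (a9 hr)]
    · by_cases hr : R0 γ = 0
      · simp [hr]
      · rw [hfg _ (a10 hr) (a11 hr) (a12 hr)]

lemma bb_bound (h : Act L γ) {c : ℝ} (hc : 0 ≤ c)
    (hf : ∀ η, Pp γ ≤ η → η < γ → Act L η → |f η| ≤ c) : |bb γ f| ≤ c := by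
  unfold bb
  cases h with
  | mk _ a1 a2 a3 a4 a5 a6 a7 a8 a9 a10 a11 a12 =>
    have h1 : |R1 γ * f (E1 γ)| ≤ c := by
      by_cases hr : R1 γ = 0
      · simpa [hr] using hc
      · rw [abs_mul]; have := hf _ (a7 hr) (a8 hr) (a9 hr)
        nlinarith [abs_nonneg (R1 γ), abs_nonneg (f (E1 γ))]
    have h0 : |R0 γ * f (E0 γ)| ≤ c := by
      by_cases hr : R0 γ = 0
      · simpa [hr] using hc
      · rw [abs_mul]; have := hf _ (a10 hr) (a11 hr) (a12 hr)
        nlinarith [abs_nonneg (R0 γ), abs_nonneg (f (E0 γ))]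
    rw [abs_le] at *
    constructor <;> linarith [h1.1, h1.2, h0.1, h0.2]

lemma Pr_ge (h : Act L γ) (hn : n ≤ γ) : Pr L n u γ = pv γ (Pr L n u) +
    if n ≤ Pp γ then 0 else (mm (W γ))⁻¹ * bb γ (fun η => Pr L n u η - Pr L (Pp γ) u η) := by
  have e1 : Pr L n u γ = (if h : Pp γ ≠ 0 ∧ Pp γ - 1 < γ then Pr L n u (Pp γ - 1) else 0) +
    (if n ≤ Pp γ then 0 else (mm (W γ))⁻¹ * bb γ (fun η => if η < γ then
      Pr L n u η - Pr L (Pp γ) u η else 0)) := by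
    conv_lhs => unfold Pr; rw [ext]
    simp only [h, not_true_eq_false, if_false, not_lt.mpr hn, bb, Pr]
    simp only [dite_eq_ite]
  rw [e1]
  congr 1
  · unfold pv
    by_cases hp : Pp γ = 0
    · simp [hp]
    · simp [hp, (h.pp hp).2.1]
  · split_ifs
    · rfl
    · congr 1
      exact bb_congr h fun η _ h2 _ => by simp [h2]

lemma pv_congr (h : Act L γ) (hfg : ∀ η, η < γ → η < Pp γ → Act L η → f η = g η) :
    pv γ f = pv γ g := by
  unfold pv; split_ifs with hp
  · rfl
  · exact hfg _ (h.pp hp).2.1 (by omega) (h.pp hp).1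

lemma Pr_congr (huv : ∀ γ, γ < n → Act L γ → u γ = v γ) : Pr L n u = Pr L n v := by
  suffices H : ∀ γ, ∀ n, (∀ γ, γ < n → Act L γ → u γ = v γ) → Pr L n u γ = Pr L n v γ from
    funext fun γ => H γ n huv
  intro γ
  induction γ using Nat.strong_induction_on with
  | _ γ ih =>
    intro n huv
    by_cases h : Act L γ
    · by_cases hn : γ < n
      · rw [Pr_lt h hn, Pr_lt h hn, huv γ hn h]
      · push Not at hn
        rw [Pr_ge h hn, Pr_ge h hn]
        congr 1
        · exact pv_congr h fun η hη _ _ => ih η hη n huv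
        · split_ifs with hp
          · rfl
          · congr 1
            refine bb_congr h fun η _ hη _ => ?_
            rw [ih η hη n huv, ih η hη _ fun γ' h' => huv γ' (by omega)]
    · rw [Pr_nact h, Pr_nact h]

lemma bb_lin (γ : ℕ) (a b : ℝ) (f g : ℕ → ℝ) :
    bb γ (fun η => a * f η + b * g η) = a * bb γ f + b * bb γ g := by
  unfold bb; ring

lemma pv_lin (γ : ℕ) (a b : ℝ) (f g : ℕ → ℝ) :
    pv γ (fun η => a * f η + b * g η) = a * pv γ f + b * pv γ g := by
  unfold pv; split_ifs <;> ring

lemma Pr_lin (n : ℕ) (a b : ℝ) (u v : ℕ → ℝ) :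
    Pr L n (fun η => a * u η + b * v η) = fun η => a * Pr L n u η + b * Pr L n v η := by
  suffices H : ∀ γ, ∀ n, Pr L n (fun η => a * u η + b * v η) γ = a * Pr L n u γ + b * Pr L n v γ
    from funext fun γ => H γ n
  intro γ
  induction γ using Nat.strong_induction_on with
  | _ γ ih =>
    intro n
    by_cases h : Act L γ
    · by_cases hn : γ < n
      · rw [Pr_lt h hn, Pr_lt h hn, Pr_lt h hn]
      · push Not at hn
        rw [Pr_ge h hn, Pr_ge h hn, Pr_ge h hn]
        rw [pv_congr (g := fun η => a * Pr L n u η + b * Pr L n v η) h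
          fun η hη _ _ => ih η hη n, pv_lin]
        split_ifs with hp
        · ring
        · rw [bb_congr (g := fun η => a * (Pr L n u η - Pr L (Pp γ) u η) +
            b * (Pr L n v η - Pr L (Pp γ) v η)) h
            fun η _ hη _ => by rw [ih η hη, ih η hη]; ring, bb_lin]
          ring
    · rw [Pr_nact h, Pr_nact h, Pr_nact h]; ring

lemma Pr_Pr_le (hmn : m ≤ n) : Pr L m (Pr L n u) = Pr L m u :=
  Pr_congr fun γ h ha => Pr_lt ha (by omega)

lemma Pr_Pr_ge (hmn : n ≤ m) : Pr L m (Pr L n u) = Pr L n u := by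
  suffices H : ∀ γ, ∀ m, n ≤ m → Pr L m (Pr L n u) γ = Pr L n u γ from
    funext fun γ => H γ m hmn
  intro γ
  induction γ using Nat.strong_induction_on with
  | _ γ ih =>
    intro m hmn
    by_cases h : Act L γ
    · by_cases hn : γ < m
      · rw [Pr_lt h hn]
      · push Not at hn
        rw [Pr_ge h hn, Pr_ge h (by omega : n ≤ γ)]
        rw [pv_congr h fun η hη _ _ => ih η hη m hmn]
        congr 1
        by_cases h1 : m ≤ Pp γ
        · rw [if_pos h1, if_pos (by omega)]
        · rw [if_neg h1]
          by_cases h2 : n ≤ Pp γ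
          · rw [if_pos h2, bb_congr (g := fun η => 0) h fun η _ hη _ => by
              rw [ih η hη m hmn, ih η hη _ h2]; ring]
            simp [bb]
          · rw [if_neg h2, bb_congr h fun η _ hη _ => ?_]
            rw [ih η hη m hmn, Pr_Pr_le (by omega)]
    · rw [Pr_nact h, Pr_nact h]

lemma Pr_bound {c : ℝ} (hu : ∀ γ, γ < n → Act L γ → |u γ| ≤ c) (hc : 0 ≤ c) (γ : ℕ) :
    |Pr L n u γ| ≤ 2 * c := by
  induction γ using Nat.strong_induction_on generalizing n with
  | _ γ ih =>
    by_cases h : Act L γ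
    · by_cases hn : γ < n
      · rw [Pr_lt h hn]; linarith [hu γ hn h]
      · push Not at hn
        rw [Pr_ge h hn]
        split_ifs with hp
        · rw [add_zero]; unfold pv
          split_ifs with h0
          · simp; linarith
          · exact ih _ (h.pp h0).2.1 hu
        · have h1 : |pv γ (Pr L n u)| ≤ c := by
            unfold pv; split_ifs with h0
            · simpa using hc
            · rw [Pr_lt (h.pp h0).1 (by omega)]; exact hu _ (by omega) (h.pp h0).1
          have h2 : |bb γ (fun η => Pr L n u η - Pr L (Pp γ) u η)| ≤ 4 * c := by
            refine bb_bound h (by linarith) fun η _ hη _ => ?_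
            have a1 := ih η hη hu
            have a2 := ih η hη (n := Pp γ) fun γ' h' => hu γ' (by omega)
            rw [abs_le] at *; constructor <;> linarith [a1.1, a1.2, a2.1, a2.2]
          have h3 : |(mm (W γ))⁻¹ * bb γ (fun η => Pr L n u η - Pr L (Pp γ) u η)| ≤ c := by
            rw [abs_mul, abs_inv, abs_of_pos (mm_pos _), inv_mul_le_iff₀ (mm_pos _)]
            nlinarith [mm_ge (W γ)]
          rw [abs_le] at *; constructor <;> linarith [h1.1, h1.2, h3.1, h3.2]
    · rw [Pr_nact h]; simp; linarith

lemma Pr_zero : Pr L 0 u = 0 := by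
  funext γ
  have := Pr_bound (L := L) (n := 0) (u := u) (c := 0) (by intro γ h; omega) le_rfl γ
  simpa using this

end AH

namespace AH
open Finset
variable {L : Set ℕ} {γ n m : ℕ} {u v f g : ℕ → ℝ}

def Blk (L : Set ℕ) (s t : ℕ) (x : ℕ → ℝ) : Prop := Pr L t x = x ∧ ∀ γ < s, x γ = 0

lemma bb_zero : bb γ (fun _ => 0) = 0 := by simp [bb]
lemma pv_bound {c : ℝ} (hc : 0 ≤ c) (h : ∀ η, |f η| ≤ c) : |pv γ f| ≤ c := by
  unfold pv; split_ifs
  · simpa using hc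
  · exact h _

namespace Blk
variable {s t p : ℕ} {x y : ℕ → ℝ}

lemma nact (h : Blk L s t x) (ha : ¬ Act L γ) : x γ = 0 := by rw [← h.1, Pr_nact ha]

lemma Pr_le (h : Blk L s t x) (hp : p ≤ s) : Pr L p x = 0 := by
  funext γ
  have := Pr_bound (L := L) (n := p) (u := x) (c := 0)
    (by intro γ hγ _; rw [h.2 γ (by omega)]; simp) le_rfl γ
  simpa using this

lemma Pr_ge' (h : Blk L s t x) (hp : t ≤ p) : Pr L p x = x := by
  rw [← h.1, Pr_Pr_ge hp]

lemma rec' (h : Blk L s t x) (ha : Act L γ) (ht : t ≤ γ) : x γ = pv γ x +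
    if t ≤ Pp γ then 0 else (mm (W γ))⁻¹ * bb γ (fun η => x η - Pr L (Pp γ) x η) := by
  have := Pr_ge (u := x) ha ht
  rwa [h.1] at this

lemma early (h : Blk L s t x) (ha : Act L γ) (ht : t ≤ Pp γ) : x γ = pv γ x := by
  rw [h.rec' ha (ht.trans ha.ple), if_pos ht, add_zero]

lemma pv0 (h : Blk L s t x) (hs : Pp γ ≤ s) : pv γ x = 0 := by
  unfold pv; split_ifs
  · rfl
  · exact h.2 _ (by omega)

lemma late (h : Blk L s t x) (hst : s ≤ t) (ha : Act L γ) (hs : Pp γ ≤ s) (ht : t ≤ γ) :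
    x γ = (mm (W γ))⁻¹ * bb γ x := by
  rw [h.rec' ha ht, h.pv0 hs, h.Pr_le hs, zero_add]
  split_ifs with h1
  · have : s = t := by omega
    rw [bb_congr (g := fun _ => 0) ha, bb_zero, mul_zero]
    intro η _ _ _
    subst this
    have := h.Pr_le le_rfl
    rw [h.1] at this; rw [this]; rfl
  · simp

lemma zero' : Blk L s t (fun _ => 0) :=
  ⟨by funext γ; simpa using Pr_bound (L := L) (n := t) (u := fun _ => 0) (c := 0) (by simp) le_rfl γ,
   by simp⟩

lemma lin (hx : Blk L s t x) (hy : Blk L s t y) (a b : ℝ) :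
    Blk L s t (fun η => a * x η + b * y η) :=
  ⟨by rw [Pr_lin, hx.1, hy.1], fun γ h => by simp [hx.2 γ h, hy.2 γ h]⟩

lemma mono {s' t' : ℕ} (h : Blk L s t x) (hs : s' ≤ s) (ht : t ≤ t') : Blk L s' t' x :=
  ⟨h.Pr_ge' ht, fun γ hγ => h.2 γ (by omega)⟩

lemma sum {ι : Type*} {I : Finset ι} {x : ι → ℕ → ℝ} (a : ι → ℝ) (h : ∀ k ∈ I, Blk L s t (x k)) :
    Blk L s t (fun γ => ∑ k ∈ I, a k * x k γ) := by
  classical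
  induction I using Finset.induction_on with
  | empty => simpa using zero'
  | insert i I hi ih =>
    have := (h i (by simp)).lin (ih fun k hk => h k (by simp [hk])) (a i) 1
    simpa [Finset.sum_insert hi] using this

/-- small at nodes of high weight -/
lemma high (h : Blk L s t x) {C : ℝ} (hC : ∀ γ, |x γ| ≤ C) (ha : Act L γ) (ht : t ≤ W γ) :
    |x γ| ≤ 4 * C / mm (W γ) := by
  have hC0 : 0 ≤ C := (abs_nonneg _).trans (hC 0)
  have key : ∀ γ, Act L γ → t ≤ W γ → t ≤ Pp γ ∨ |x γ| ≤ 4 * C / mm (W γ) := by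
    intro γ ha ht
    by_cases h1 : t ≤ Pp γ
    · exact Or.inl h1
    · right
      rw [h.rec' ha (ht.trans ha.wle), if_neg h1]
      have : pv γ x = 0 := by
        unfold pv; split_ifs with h0
        · rfl
        · have := (ha.pp h0).2.2.1; have := (ha.pp h0).1.wle; omega
      rw [this, zero_add, abs_mul, abs_inv, abs_of_pos (mm_pos _), inv_mul_eq_div]
      refine div_le_div_of_nonneg_right (bb_bound ha (by linarith) fun η _ _ _ => ?_) (mm_pos _).le
      have := Pr_bound (L := L) (n := Pp γ) (u := x) (fun γ _ _ => hC γ) hC0 η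
      have := hC η
      rw [abs_le] at *; constructor <;> linarith
  induction γ using Nat.strong_induction_on with
  | _ γ ih =>
    rcases key γ ha ht with h1 | h1
    · rw [h.early ha h1]
      unfold pv; split_ifs with h0
      · simp; have := mm_pos (W γ); positivity
      · obtain ⟨b1, b2, b3, b4⟩ := ha.pp h0
        have := ih _ b2 b1 (by omega)
        rwa [b3] at this
    · exact h1
end Blk

structure BS (L : Set ℕ) (x : ℕ → ℕ → ℝ) (s t : ℕ → ℕ) (N : ℕ) : Prop where
  blk : ∀ k < N, Blk L (s k) (t k) (x k)
  st : ∀ k < N, s k ≤ t k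
  ts : ∀ k l, k < l → l < N → t k ≤ s l

def S (x : ℕ → ℕ → ℝ) (a b : ℕ) : ℕ → ℝ := fun γ => ∑ k ∈ Ico a b, x k γ

lemma bb_S (x : ℕ → ℕ → ℝ) (a b : ℕ) : bb γ (S x a b) = ∑ k ∈ Ico a b, bb γ (x k) := by
  simp only [bb, S, ← Finset.sum_div, Finset.sum_add_distrib, Finset.mul_sum]

lemma pv_S (x : ℕ → ℕ → ℝ) (a b : ℕ) : pv γ (S x a b) = ∑ k ∈ Ico a b, pv γ (x k) := by
  unfold pv S; split_ifs <;> simp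

lemma S_add (x : ℕ → ℕ → ℝ) {a b c : ℕ} (h : a ≤ b) (h' : b ≤ c) :
    S x a c γ = S x a b γ + S x b c γ := by
  simp [S, Finset.sum_Ico_consecutive _ h h']

lemma S_one (x : ℕ → ℕ → ℝ) {a b : ℕ} (h : b ≤ a + 1) {σ : ℝ} (h' : a ≤ b)
    (hs : a < b → |x a γ| ≤ σ) : |S x a b γ| ≤ ((b : ℝ) - a) * σ := by
  rcases Nat.lt_or_ge a b with h1 | h1
  · have : b = a + 1 := by omega
    subst this; simpa [S] using hs h1
  · have : b = a := by omega
    subst this; simp [S]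

lemma cut (a b : ℕ) (hab : a ≤ b) (P : ℕ → Prop)
    (hP : ∀ k l, a ≤ k → k < l → l < b → P l → P k) :
    ∃ c, a ≤ c ∧ c ≤ b ∧ (∀ k, a ≤ k → k < c → P k) ∧ ∀ k, c ≤ k → k < b → ¬ P k := by
  induction b, hab using Nat.le_induction with
  | base => exact ⟨a, le_rfl, le_rfl, by intros; omega, by intros; omega⟩
  | succ b hab ih =>
    obtain ⟨c, h1, h2, h3, h4⟩ := ih fun k l hk hl hb => hP k l hk hl (by omega)
    by_cases hb : P b
    · refine ⟨b + 1, by omega, le_rfl, fun k hk hk' => ?_, by intros; omega⟩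
      rcases Nat.lt_or_ge k b with h | h
      · exact hP k b hk h (by omega) hb
      · rwa [show k = b by omega]
    · refine ⟨c, h1, by omega, h3, fun k hk hk' => ?_⟩
      rcases Nat.lt_or_ge k b with h | h
      · exact h4 k hk h
      · rwa [show k = b by omega]

section
variable {x : ℕ → ℕ → ℝ} {s t : ℕ → ℕ} {N a b : ℕ}

lemma BS.step (h : BS L x s t N) (hab : a ≤ b) (hb : b ≤ N) (ha : Act L γ) :
    ∃ c1 c2 c3 c4, a ≤ c1 ∧ c1 ≤ c2 ∧ c2 ≤ c3 ∧ c3 ≤ c4 ∧ c4 ≤ b ∧ c2 ≤ c1 + 1 ∧ c4 ≤ c3 + 1 ∧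
      S x a b γ = pv γ (S x a c1) + S x c1 c2 γ + (mm (W γ))⁻¹ * bb γ (S x c2 c3) + S x c3 c4 γ ∧
      pv γ (S x a b) = pv γ (S x a c1) + pv γ (S x c1 c2) := by
  have tm : ∀ k l, a ≤ k → k < l → l < b → t k ≤ t l := fun k l _ h1 h2 =>
    (h.ts k l h1 (by omega)).trans (h.st l (by omega))
  obtain ⟨c1, A1, A2, A3, A4⟩ := cut a b hab (fun k => t k ≤ Pp γ)
    fun k l h1 h2 h3 h4 => (tm k l h1 h2 h3).trans h4
  obtain ⟨c, B1, B2, B3, B4⟩ := cut a b hab (fun k => t k ≤ γ)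
    fun k l h1 h2 h3 h4 => (tm k l h1 h2 h3).trans h4
  have hpl := ha.ple
  have hc1c : c1 ≤ c := by
    by_contra hcc
    exact B4 c le_rfl (by omega) ((A3 c B1 (by omega)).trans hpl)
  obtain ⟨c2, C1, C2, C3, C4⟩ : ∃ c2, c1 ≤ c2 ∧ c2 ≤ c1 + 1 ∧ c2 ≤ b ∧
      ∀ k, c2 ≤ k → k < b → Pp γ ≤ s k := by
    by_cases hc : c1 < b ∧ s c1 < Pp γ
    · refine ⟨c1 + 1, by omega, le_rfl, by omega, fun k hk hkb => ?_⟩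
      have := h.ts c1 k (by omega) (by omega)
      have := A4 c1 le_rfl hc.1
      omega
    · refine ⟨c1, le_rfl, by omega, by omega, fun k hk hkb => ?_⟩
      rcases Nat.eq_or_lt_of_le hk with h1 | h1
      · subst h1; omega
      · have := h.ts c1 k (by omega) (by omega)
        have := A4 c1 le_rfl (by omega)
        omega
  obtain ⟨c3, D1, D2, D3, D4, D5⟩ : ∃ c3, c2 ≤ c3 ∧ c ≤ c3 ∧ c3 ≤ b ∧
      (∀ k, c2 ≤ k → k < c3 → t k ≤ γ) ∧ (∀ k, c3 ≤ k → k < b → ¬ t k ≤ γ) :=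
    ⟨max c c2, by omega, by omega, by omega, fun k h1 h2 => B3 k (by omega) (by omega),
      fun k h1 h2 => B4 k (by omega) h2⟩
  obtain ⟨c4, E1, E2, E3, E4⟩ : ∃ c4, c3 ≤ c4 ∧ c4 ≤ c3 + 1 ∧ c4 ≤ b ∧
      ∀ k, c4 ≤ k → k < b → x k γ = 0 := by
    refine ⟨min b (c3 + 1), by omega, by omega, by omega, fun k h1 h2 => ?_⟩
    refine (h.blk k (by omega)).2 γ ?_
    have := h.ts c3 k (by omega) (by omega)
    have := D5 c3 le_rfl (by omega)
    omega
  refine ⟨c1, c2, c3, c4, A1, C1, D1, E1, E3, C2, E2, ?_, ?_⟩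
  · rw [S_add x (show a ≤ c1 by omega) (show c1 ≤ b by omega),
      S_add x (show c1 ≤ c2 by omega) (show c2 ≤ b by omega),
      S_add x (show c2 ≤ c3 by omega) (show c3 ≤ b by omega),
      S_add x (show c3 ≤ c4 by omega) (show c4 ≤ b by omega)]
    have e1 : S x a c1 γ = pv γ (S x a c1) := by
      rw [pv_S, S]
      refine Finset.sum_congr rfl fun k hk => ?_
      rw [Finset.mem_Ico] at hk
      exact (h.blk k (by omega)).early ha (A3 k hk.1 hk.2)
    have e2 : S x c2 c3 γ = (mm (W γ))⁻¹ * bb γ (S x c2 c3) := by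
      rw [bb_S, S, Finset.mul_sum]
      refine Finset.sum_congr rfl fun k hk => ?_
      rw [Finset.mem_Ico] at hk
      exact (h.blk k (by omega)).late (h.st k (by omega)) ha (C4 k hk.1 (by omega)) (D4 k hk.1 hk.2)
    have e3 : S x c4 b γ = 0 := by
      refine Finset.sum_eq_zero fun k hk => ?_
      rw [Finset.mem_Ico] at hk
      exact E4 k hk.1 hk.2
    rw [← e1, ← e2, e3]; ring
  · have e : pv γ (S x c2 b) = 0 := by
      rw [pv_S]
      refine Finset.sum_eq_zero fun k hk => ?_
      rw [Finset.mem_Ico] at hk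
      exact (h.blk k (by omega)).pv0 (C4 k hk.1 hk.2)
    rw [pv_S, ← Finset.sum_Ico_consecutive _ A1 A2, ← Finset.sum_Ico_consecutive _ C1 C3,
      ← pv_S, ← pv_S, ← pv_S, e, add_zero]

lemma BS.Sna (h : BS L x s t N) (hb : b ≤ N) (ha : ¬ Act L γ) : S x a b γ = 0 := by
  refine Finset.sum_eq_zero fun k hk => ?_
  rw [Finset.mem_Ico] at hk
  exact (h.blk k (by omega)).nact ha

lemma S_triv {c : ℝ} (h : ∀ k, a ≤ k → k < b → |x k γ| ≤ c) (hab : a ≤ b) :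
    |S x a b γ| ≤ ((b : ℝ) - a) * c := by
  calc |S x a b γ| ≤ ∑ k ∈ Ico a b, |x k γ| := Finset.abs_sum_le_sum_abs _ _
    _ ≤ ∑ k ∈ Ico a b, c := Finset.sum_le_sum fun k hk => by
        rw [Finset.mem_Ico] at hk; exact h k hk.1 hk.2
    _ = _ := by simp [Nat.cast_sub hab]

lemma BS.chain (h : BS L x s t N) {A B i : ℕ} (hB : B ≤ N) {α c e : ℝ} (hα : 0 ≤ α) (hc : 0 ≤ c)
    (he : 0 ≤ e)
    (H : ∀ a b η, A ≤ a → a ≤ b → b ≤ B → |S x a b η| ≤ α * ((b : ℝ) - a) + c)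
    (Hx : ∀ k γ, A ≤ k → k < B → Act L γ → W γ = i → |x k γ| ≤ α / mm i + e) :
    ∀ γ a b, Act L γ → W γ = i → A ≤ a → a ≤ b → b ≤ B →
      |S x a b γ| ≤ (α * ((b : ℝ) - a) + AG γ * c) / mm i + 2 * AG γ * e := by
  intro γ
  induction γ using Nat.strong_induction_on with
  | _ γ ih =>
    intro a b ha hi hA hab hbB
    obtain ⟨c1, c2, c3, c4, h1, h2, h3, h4, h5, h6, h7, h8, -⟩ := h.step hab (by omega) ha
    have hag : (1 : ℝ) ≤ AG γ := by exact_mod_cast ha.ag1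
    have hm := mm_pos i
    have q1 : |pv γ (S x a c1)| ≤ (α * ((c1 : ℝ) - a) + (AG γ - 1) * c) / mm i
        + 2 * (AG γ - 1) * e := by
      unfold pv; split_ifs with h0
      · have : (a : ℝ) ≤ c1 := by exact_mod_cast h1
        simp only [abs_zero]
        have := mul_nonneg hα (sub_nonneg.2 this)
        have := mul_nonneg (sub_nonneg.2 hag) hc
        have := mul_nonneg (sub_nonneg.2 hag) he
        have : 0 ≤ (α * ((c1 : ℝ) - a) + (AG γ - 1) * c) / mm i := by positivity
        linarith
      · obtain ⟨b1, b2, b3, b4⟩ := ha.pp h0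
        have := ih _ b2 a c1 b1 (by omega) hA h1 (by omega)
        have b5 : ((AG (Pp γ - 1) : ℕ) : ℝ) ≤ AG γ - 1 := by
          have : AG (Pp γ - 1) + 1 ≤ AG γ := b4
          have : ((AG (Pp γ - 1) : ℕ) : ℝ) + 1 ≤ AG γ := by exact_mod_cast this
          linarith
        refine this.trans ?_
        gcongr
    have q2 : |S x c1 c2 γ| ≤ ((c2 : ℝ) - c1) * (α / mm i + e) :=
      S_one x h6 h2 fun hh => Hx _ _ (by omega) (by omega) ha hi
    have q4 : |S x c3 c4 γ| ≤ ((c4 : ℝ) - c3) * (α / mm i + e) :=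
      S_one x h7 h4 fun hh => Hx _ _ (by omega) (by omega) ha hi
    have q3 : |(mm (W γ))⁻¹ * bb γ (S x c2 c3)| ≤ (α * ((c3 : ℝ) - c2) + c) / mm i := by
      rw [abs_mul, abs_inv, abs_of_pos (mm_pos _), inv_mul_eq_div, hi]
      refine div_le_div_of_nonneg_right (bb_bound ha ?_ fun η _ _ _ => H _ _ η (by omega) h3 (by omega)) hm.le
      have : (c2 : ℝ) ≤ c3 := by exact_mod_cast h3
      have := mul_nonneg hα (sub_nonneg.2 this); linarith
    have r1 : ((c2 : ℝ) - c1) ≤ 1 := by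
      have : (c2 : ℝ) ≤ c1 + 1 := by exact_mod_cast h6
      linarith
    have r2 : ((c4 : ℝ) - c3) ≤ 1 := by
      have : (c4 : ℝ) ≤ c3 + 1 := by exact_mod_cast h7
      linarith
    have r3 : (c4 : ℝ) ≤ b := by exact_mod_cast h5
    rw [h8]
    have e2 : ((c2 : ℝ) - c1) * e ≤ e := by nlinarith
    have e4 : ((c4 : ℝ) - c3) * e ≤ e := by nlinarith
    have e5 : α / mm i * c4 ≤ α / mm i * b := by gcongr
    have E : (α * ((b : ℝ) - a) + AG γ * c) / mm i + 2 * AG γ * e =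
      ((α * ((c1 : ℝ) - a) + (AG γ - 1) * c) / mm i + 2 * (AG γ - 1) * e) +
      (c2 - c1) * (α / mm i + e) + (α * ((c3 : ℝ) - c2) + c) / mm i + (c4 - c3) * (α / mm i + e)
      + (α / mm i * b - α / mm i * c4) + (e - (c2 - c1) * e) + (e - (c4 - c3) * e) := by ring
    rw [E, abs_le]
    rw [abs_le] at q1 q2 q3 q4
    constructor <;> linarith [q1.1, q1.2, q2.1, q2.2, q3.1, q3.2, q4.1, q4.2]
end
end AH

namespace AH
open Finset
variable {L : Set ℕ} {γ : ℕ}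

structure RIS (L : Set ℕ) (C : ℝ) (x : ℕ → ℕ → ℝ) (s t j : ℕ → ℕ) (N : ℕ) : Prop where
  bs : BS L x s t N
  jj : ∀ k l, k < l → l < N → t k < j l ∧ j k < j l
  nm : ∀ k < N, ∀ γ, |x k γ| ≤ C
  lo : ∀ k < N, ∀ γ, Act L γ → W γ < j k → |x k γ| ≤ C / mm (W γ)

section
variable {x : ℕ → ℕ → ℝ} {s t j : ℕ → ℕ} {N a b : ℕ} {C : ℝ}

lemma RIS.split (h : RIS L C x s t j N) (hC : 0 ≤ C) (ha : Act L γ) (hab : a ≤ b) (hb : b ≤ N) :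
    ∃ c, a ≤ c ∧ c ≤ b ∧ |S x a b γ| ≤ 5 * C + |S x c b γ| ∧ ∀ k, c ≤ k → k < b → W γ < j k := by
  have jle : ∀ k l, k < l → l < N → j k < j l := fun k l h1 h2 => (h.jj k l h1 h2).2
  obtain ⟨c, A1, A2, A3, A4⟩ := cut a b hab (fun k => j k ≤ W γ)
    fun k l _ h2 h3 h4 => (jle k l h2 (by omega)).le.trans h4
  refine ⟨c, A1, A2, ?_, fun k h1 h2 => by have := A4 k h1 h2; omega⟩
  rw [S_add x A1 A2]
  suffices H : |S x a c γ| ≤ 5 * C from (abs_add_le _ _).trans (by linarith)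
  rcases Nat.eq_or_lt_of_le A1 with h1 | h1
  · subst h1; simp [S]; exact hC
  · have hj : ∀ k, k < c → k ≤ j k := by
      intro k hk
      induction k with
      | zero => omega
      | succ k ih => have := ih (by omega); have := jle k (k+1) (by omega) (by omega); omega
    rw [S_add x (show a ≤ c - 1 by omega) (show c - 1 ≤ c by omega)]
    have h2 : |S x (c-1) c γ| ≤ C := by
      have := S_one (γ := γ) x (show c ≤ (c - 1) + 1 by omega) (by omega)
        (fun _ => h.nm (c-1) (by omega) γ)
      have e : (c : ℝ) - ((c - 1 : ℕ) : ℝ) = 1 := by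
        rw [Nat.cast_sub (by omega)]; simp
      rwa [e, one_mul] at this
    have h3 : |S x a (c-1) γ| ≤ (((c - 1 : ℕ) : ℝ) - a) * (4 * C / mm (W γ)) := by
      refine S_triv (fun k k1 k2 => ?_) (by omega)
      refine (h.bs.blk k (by omega)).high (h.nm k (by omega)) ha ?_
      have := (h.jj k (c-1) k2 (by omega)).1
      have := A3 (c-1) (by omega) (by omega)
      omega
    have h4 : (((c - 1 : ℕ) : ℝ) - a) ≤ mm (W γ) := by
      have := hj (c-1) (by omega)
      have h5 := A3 (c-1) (by omega) (by omega)
      have h6 : ((c - 1 : ℕ) : ℝ) ≤ W γ := by exact_mod_cast this.trans h5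
      have := le_mm (W γ)
      have : (0 : ℝ) ≤ a := by positivity
      linarith
    have h5 : (((c - 1 : ℕ) : ℝ) - a) * (4 * C / mm (W γ)) ≤ 4 * C := by
      have hm := mm_pos (W γ)
      rw [mul_div_assoc', div_le_iff₀ hm]
      nlinarith
    exact (abs_add_le _ _).trans (by linarith)

lemma RIS.U0 (h : RIS L C x s t j N) (hC : 0 ≤ C) (ha : Act L γ) (hab : a ≤ b) (hb : b ≤ N) :
    |S x a b γ| ≤ 5 * C + C * ((b : ℝ) - a) / mm (W γ) := by
  obtain ⟨c, h1, h2, h3, h4⟩ := h.split hC ha hab hb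
  have := h.bs.chain (A := c) (B := b) (i := W γ) hb (α := C) (c := 0) (e := 0) hC le_rfl le_rfl
    (fun a' b' η r1 r2 r3 => by
      have := S_triv (x := x) (γ := η) (c := C) (fun k _ _ => h.nm k (by omega) η) r2
      linarith)
    (fun k γ' r1 r2 r3 r4 => by
      have := h.lo k (by omega) γ' r3 (by rw [r4]; exact h4 k r1 r2)
      rw [r4] at this; linarith) γ c b ha rfl le_rfl h2 le_rfl
  have q : C * ((b : ℝ) - c) / mm (W γ) ≤ C * ((b : ℝ) - a) / mm (W γ) := by
    have := mm_pos (W γ)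
    have : (a : ℝ) ≤ c := by exact_mod_cast h1
    gcongr
  simp only [mul_zero, add_zero] at this
  linarith

lemma RIS.U1 (h : RIS L C x s t j N) (hC : 0 ≤ C) {K τ : ℝ} {J : ℕ} (hK : 5 * C ≤ K) (hτ : 0 ≤ τ)
    (H : ∀ γ a b, Act L γ → J ≤ W γ → a ≤ b → b ≤ N → |S x a b γ| ≤ K * (τ * ((b : ℝ) - a) + 1))
    (r : ℕ) :
    (∀ γ a b, a ≤ b → b ≤ N → |S x a b γ| ≤
      K * (τ * ((b : ℝ) - a) + ((b : ℝ) - a) / 2 ^ r + (DD J : ℝ) ^ r)) ∧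
    (∀ γ a b, Act L γ → W γ < J → a ≤ b → b ≤ N → |S x a b γ| ≤ K +
      (K * (τ + 1 / 2 ^ r) * ((b : ℝ) - a) + nn (W γ) * (K * (DD J : ℝ) ^ r + K)) / mm (W γ)) := by
  have hK0 : 0 ≤ K := by linarith
  have hD := DD_ge J
  have conv : ∀ r, (∀ γ a b, a ≤ b → b ≤ N → |S x a b γ| ≤
      K * (τ * ((b : ℝ) - a) + ((b : ℝ) - a) / 2 ^ r + (DD J : ℝ) ^ r)) →
    (∀ γ a b, Act L γ → W γ < J → a ≤ b → b ≤ N → |S x a b γ| ≤ K +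
      (K * (τ + 1 / 2 ^ r) * ((b : ℝ) - a) + nn (W γ) * (K * (DD J : ℝ) ^ r + K)) / mm (W γ)) := by
    intro r hr γ a b ha hJ hab hb
    obtain ⟨c, h1, h2, h3, h4⟩ := h.split hC ha hab hb
    have hm := mm_pos (W γ)
    have := h.bs.chain (A := c) (B := b) (i := W γ) hb (α := K * (τ + 1 / 2 ^ r))
      (c := K * (DD J : ℝ) ^ r) (e := C / mm (W γ)) (by positivity) (by positivity) (by positivity)
      (fun a' b' η r1 r2 r3 => by
        have := hr η a' b' r2 (by omega)
        refine this.trans (le_of_eq ?_); ring)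
      (fun k γ' r1 r2 r3 r4 => by
        have := h.lo k (by omega) γ' r3 (by rw [r4]; exact h4 k r1 r2)
        rw [r4] at this
        have : 0 ≤ K * (τ + 1 / 2 ^ r) / mm (W γ) := by positivity
        linarith) γ c b ha rfl le_rfl h2 le_rfl
    have hag : (AG γ : ℝ) ≤ nn (W γ) := by exact_mod_cast ha.ag
    have hca : (a : ℝ) ≤ c := by exact_mod_cast h1
    have q : (K * (τ + 1 / 2 ^ r) * ((b : ℝ) - c) + AG γ * (K * (DD J : ℝ) ^ r)) / mm (W γ)
      + 2 * AG γ * (C / mm (W γ)) ≤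
      (K * (τ + 1 / 2 ^ r) * ((b : ℝ) - a) + nn (W γ) * (K * (DD J : ℝ) ^ r + K)) / mm (W γ) := by
      have e : 2 * AG γ * (C / mm (W γ)) = (AG γ * (2 * C)) / mm (W γ) := by ring
      rw [e, ← add_div]
      refine div_le_div_of_nonneg_right ?_ hm.le
      have q1 : K * (τ + 1 / 2 ^ r) * ((b : ℝ) - c) ≤ K * (τ + 1 / 2 ^ r) * ((b : ℝ) - a) := by
        gcongr
      have q2 : AG γ * (K * (DD J : ℝ) ^ r) ≤ nn (W γ) * (K * (DD J : ℝ) ^ r) := by gcongr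
      have q3 : AG γ * (2 * C) ≤ nn (W γ) * K := by gcongr; linarith
      linarith
    linarith
  suffices Q : ∀ r, ∀ γ a b, a ≤ b → b ≤ N → |S x a b γ| ≤
      K * (τ * ((b : ℝ) - a) + ((b : ℝ) - a) / 2 ^ r + (DD J : ℝ) ^ r) from ⟨Q r, conv r (Q r)⟩
  intro r
  induction r with
  | zero =>
    intro γ a b hab hb
    have := S_triv (x := x) (γ := γ) (c := C) (fun k _ _ => h.nm k (by omega) γ) hab
    have hl : (0 : ℝ) ≤ b - a := by
      have : (a : ℝ) ≤ b := by exact_mod_cast hab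
      linarith
    have : 0 ≤ K * (τ * ((b : ℝ) - a)) := by positivity
    simp only [pow_zero, div_one]
    nlinarith
  | succ r ih =>
    intro γ a b hab hb
    have hl : (0 : ℝ) ≤ b - a := by
      have : (a : ℝ) ≤ b := by exact_mod_cast hab
      linarith
    by_cases ha : Act L γ
    · by_cases hJ : J ≤ W γ
      · refine (H γ a b ha hJ hab hb).trans ?_
        have : (1 : ℝ) ≤ (DD J : ℝ) ^ (r + 1) := one_le_pow₀ (by linarith)
        have : (0 : ℝ) ≤ ((b : ℝ) - a) / 2 ^ (r+1) := by positivity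
        gcongr ?_ * ?_
        linarith
      · push Not at hJ
        refine (conv r ih γ a b ha hJ hab hb).trans ?_
        have hm := mm_ge (W γ)
        have hn : (nn (W γ) : ℝ) + 2 ≤ DD J := by exact_mod_cast nn_DD hJ
        have hn0 : (0 : ℝ) ≤ nn (W γ) := by positivity
        have hp : (1 : ℝ) ≤ (DD J : ℝ) ^ r := one_le_pow₀ (by linarith)
        have e1 : (K * (τ + 1 / 2 ^ r) * ((b : ℝ) - a) + nn (W γ) * (K * (DD J : ℝ) ^ r + K)) / mm (W γ)
          ≤ (K * (τ + 1 / 2 ^ r) * ((b : ℝ) - a) + nn (W γ) * (K * (DD J : ℝ) ^ r + K)) / 2 := by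
          gcongr; linarith
        have e2 : K * (τ * ((b : ℝ) - a)) ≥ 0 := by positivity
        have e3 : K * (DD J : ℝ) ^ (r + 1) ≥ K * ((nn (W γ) + 2) * (DD J : ℝ) ^ r) := by
          rw [pow_succ, mul_comm ((DD J : ℝ)^r)]; gcongr
        have e4 : nn (W γ) * K ≤ nn (W γ) * (K * (DD J : ℝ) ^ r) := by
          gcongr; nlinarith
        have e5 : K ≤ K * (DD J : ℝ) ^ r := by nlinarith
        have e6 : K * (τ + 1 / 2 ^ r) * ((b : ℝ) - a) / 2 = K * (τ * ((b : ℝ) - a)) / 2 +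
          K * (((b : ℝ) - a) / 2 ^ (r+1)) := by rw [pow_succ]; field_simp
        nlinarith
    · rw [h.bs.Sna hb ha, abs_zero]; positivity

/-- general upper estimate with `ℓ ≤ n_J` -/
lemma RIS.U2 (h : RIS L C x s t j N) (hC : 0 ≤ C) {K τ : ℝ} {J : ℕ} (hK : 5 * C ≤ K) (hτ : 0 ≤ τ)
    (H : ∀ γ a b, Act L γ → J ≤ W γ → a ≤ b → b ≤ N → |S x a b γ| ≤ K * (τ * ((b : ℝ) - a) + 1))
    (hN : N ≤ nn J) :
    (∀ γ a b, a ≤ b → b ≤ N → |S x a b γ| ≤ K * nn J * (τ + 2 / mm J ^ 2)) ∧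
    (∀ γ a b, Act L γ → W γ < J → a ≤ b → b ≤ N → |S x a b γ| ≤ K +
      K * nn J * (τ + 3 / mm J ^ 2) / mm (W γ)) := by
  have hK0 : 0 ≤ K := by linarith
  obtain ⟨h1, h2⟩ := h.U1 hC hK hτ H (2 * ee J)
  have hm := mm_pos J
  have hD := DD_ge J
  have e1 : (2 : ℝ) ^ (2 * ee J) = mm J ^ 2 := by rw [mm, ← pow_mul, mul_comm]
  have e2 : (DD J : ℝ) ^ (2 * ee J) * DD J = nn J / mm J ^ 2 := by
    rw [← mm_sq_DD, ← pow_succ]; field_simp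
  set D : ℝ := (DD J : ℝ) ^ (2 * ee J) with hDD
  have hD1 : 1 ≤ D := one_le_pow₀ (by linarith)
  rw [e1] at h1 h2
  have hl : ∀ a b : ℕ, b ≤ N → (b : ℝ) - a ≤ nn J := fun a b hb => by
    have : (b : ℝ) ≤ nn J := by exact_mod_cast hb.trans hN
    have : (0 : ℝ) ≤ a := by positivity
    linarith
  have hdiv : (0 : ℝ) ≤ nn J / mm J ^ 2 := by positivity
  constructor
  · intro γ a b hab hb
    refine (h1 γ a b hab hb).trans ?_
    have := hl a b hb
    rw [mul_assoc]
    refine mul_le_mul_of_nonneg_left ?_ hK0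
    have e3 : D ≤ nn J / mm J ^ 2 := by rw [← e2]; nlinarith
    have e4 : ((b : ℝ) - a) / mm J ^ 2 ≤ nn J / mm J ^ 2 := by gcongr
    have e5 : τ * ((b : ℝ) - a) ≤ τ * nn J := by gcongr
    have : (nn J : ℝ) * (τ + 2 / mm J ^ 2) = τ * nn J + 2 * (nn J / mm J ^ 2) := by ring
    linarith
  · intro γ a b ha hJ hab hb
    refine (h2 γ a b ha hJ hab hb).trans ?_
    have := hl a b hb
    have hmi := mm_pos (W γ)
    have hn : (nn (W γ) : ℝ) + 2 ≤ DD J := by exact_mod_cast nn_DD hJ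
    have hn0 : (0 : ℝ) ≤ nn (W γ) := by positivity
    have e3 : nn (W γ) * D ≤ nn J / mm J ^ 2 := by rw [← e2]; nlinarith
    have e4 : nn (W γ) * (K * D + K) ≤ K * (2 * (nn J / mm J ^ 2)) := by
      have : nn (W γ) * (K * D + K) = K * (nn (W γ) * D + nn (W γ)) := by ring
      rw [this]; gcongr; nlinarith
    have e5 : K * (τ + 1 / mm J ^ 2) * ((b : ℝ) - a) ≤ K * (τ + 1 / mm J ^ 2) * nn J := by gcongr
    have e6 : K * nn J * (τ + 3 / mm J ^ 2) = K * (τ + 1 / mm J ^ 2) * nn J +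
      K * (2 * (nn J / mm J ^ 2)) := by ring
    rw [e6]; gcongr

lemma RIS.avg (h : RIS L C x s t j N) (hC : 0 ≤ C) {J : ℕ} (hN : N ≤ nn J) (hab : a ≤ b) (hb : b ≤ N) :
    |S x a b γ| ≤ 10 * C * (nn J / mm J) ∧
    (Act L γ → W γ < J → |S x a b γ| ≤ 15 * C * (nn J / mm J) / mm (W γ)) ∧
    (Act L γ → J < W γ → |S x a b γ| ≤ 6 * C * (nn J / mm J) / mm J) := by
  have hm := mm_ge J
  have hm0 := mm_pos J
  have hl : (b : ℝ) - a ≤ nn J := by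
    have : (b : ℝ) ≤ nn J := by exact_mod_cast hb.trans hN
    have : (0 : ℝ) ≤ a := by positivity
    linarith
  have hsq := mm_sq_nn J
  have hab' : (0 : ℝ) ≤ b - a := by
    have : (a : ℝ) ≤ b := by exact_mod_cast hab
    linarith
  obtain ⟨h1, h2⟩ := h.U2 hC (K := 5 * C) (τ := 1 / mm J) (J := J) le_rfl (by positivity)
    (fun γ a b ha hJ hab hb => by
      have := h.U0 hC ha hab hb
      have hab' : (0 : ℝ) ≤ b - a := by
        have : (a : ℝ) ≤ b := by exact_mod_cast hab
        linarith
      have hmm : mm J ≤ mm (W γ) := mm_mono.monotone hJ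
      have e : C * ((b : ℝ) - a) / mm (W γ) ≤ C * ((b : ℝ) - a) / mm J := by gcongr
      have e2 : 0 ≤ C * ((b : ℝ) - a) / mm J := by positivity
      have e3 : 5 * C * (1 / mm J * ((b : ℝ) - a) + 1) = 5 * (C * ((b : ℝ) - a) / mm J) + 5 * C := by ring
      linarith) hN
  have h3 : 3 / mm J ^ 2 ≤ 1 / mm J := by
    rw [div_le_div_iff₀ (by positivity) hm0]; nlinarith
  have h4 : 2 / mm J ^ 2 ≤ 1 / mm J := by
    rw [div_le_div_iff₀ (by positivity) hm0]; nlinarith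
  have h5 : 1 ≤ nn J / mm J / mm J := by
    rw [div_div, le_div_iff₀ (by positivity)]; nlinarith
  refine ⟨(h1 γ a b hab hb).trans ?_, fun ha hJ => (h2 γ a b ha hJ hab hb).trans ?_, fun ha hJ => ?_⟩
  · have : 5 * C * nn J * (1 / mm J + 2 / mm J ^ 2) ≤ 5 * C * nn J * (1 / mm J + 1 / mm J) := by gcongr
    refine this.trans (le_of_eq ?_); ring
  · have hmi := mm_pos (W γ)
    have : 5 * C * nn J * (1 / mm J + 3 / mm J ^ 2) / mm (W γ) ≤ 5 * C * nn J * (1 / mm J + 1 / mm J) / mm (W γ) := by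
      gcongr
    have h6 : mm (W γ) ≤ mm J := mm_mono.monotone hJ.le
    have h7 : 5 * C ≤ 5 * C * (nn J / mm J) / mm (W γ) := by
      have : 1 ≤ nn J / mm J / mm (W γ) := h5.trans (by gcongr)
      have : 5 * C * 1 ≤ 5 * C * (nn J / mm J / mm (W γ)) := by gcongr
      rw [mul_div_assoc]; linarith
    have e : 5 * C * nn J * (1 / mm J + 1 / mm J) / mm (W γ) = 10 * C * (nn J / mm J) / mm (W γ) := by ring
    have e2 : 15 * C * (nn J / mm J) / mm (W γ) = 5 * C * (nn J / mm J) / mm (W γ) + 10 * C * (nn J / mm J) / mm (W γ) := by ring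
    linarith
  · have := h.U0 hC ha hab hb
    have hmm : mm J ≤ mm (W γ) := (mm_mono hJ).le
    have e1 : C * ((b : ℝ) - a) / mm (W γ) ≤ C * (nn J / mm J) / mm J := by
      have := mm_sq_mm hJ
      rw [mul_div_assoc', div_div, ← pow_two]
      gcongr
    have e2 : 5 * C ≤ 5 * C * (nn J / mm J / mm J) := by nlinarith
    have e3 : 6 * C * (nn J / mm J) / mm J = 5 * C * (nn J / mm J / mm J) + C * (nn J / mm J) / mm J := by ring
    linarith

lemma RIS.avg_ex (h : RIS L C x s t j N) (hC : 0 ≤ C) {J : ℕ} (hN : N ≤ nn J) {K : ℝ}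
    (hK : 5 * C ≤ K) (HJ : ∀ γ a b, Act L γ → W γ = J → a ≤ b → b ≤ N → |S x a b γ| ≤ K)
    (hab : a ≤ b) (hb : b ≤ N) : |S x a b γ| ≤ 3 * K * nn J / mm J ^ 2 := by
  have hm0 := mm_pos J
  have hm1 := mm_pos (J+1)
  have hK0 : 0 ≤ K := by linarith
  obtain ⟨h1, -⟩ := h.U2 hC (K := K) (τ := 1 / mm (J+1)) (J := J) hK (by positivity)
    (fun γ a b ha hJ hab hb => by
      have hab' : (0 : ℝ) ≤ b - a := by
        have : (a : ℝ) ≤ b := by exact_mod_cast hab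
        linarith
      have e0 : K * (1 / mm (J+1) * ((b : ℝ) - a) + 1) = K * ((b : ℝ) - a) / mm (J+1) + K := by ring
      rw [e0]
      rcases Nat.eq_or_lt_of_le hJ with h2 | h2
      · have := HJ γ a b ha h2.symm hab hb
        have : 0 ≤ K * ((b : ℝ) - a) / mm (J+1) := by positivity
        linarith
      · have := h.U0 hC ha hab hb
        have hmm : mm (J+1) ≤ mm (W γ) := mm_mono.monotone h2
        have e : C * ((b : ℝ) - a) / mm (W γ) ≤ K * ((b : ℝ) - a) / mm (J+1) := by
          gcongr; linarith
        linarith) hN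
  refine (h1 γ a b hab hb).trans ?_
  have : 1 / mm (J+1) ≤ 1 / mm J ^ 2 := one_div_le_one_div_of_le (by positivity) (mm_sq_mm (by omega))
  calc K * nn J * (1 / mm (J+1) + 2 / mm J ^ 2) ≤ K * nn J * (1 / mm J^2 + 2 / mm J ^ 2) := by gcongr
    _ = _ := by ring
end
end AH

namespace AH
open Finset
variable {L : Set ℕ} {γ : ℕ}

lemma act_of_nd {i r p e1 e0 : ℕ} {q1 q0 : ℚ} (hn : nd γ = (i, r, p, e1, e0, q1, q0))
    (hi : i ∈ L) (hr : 1 ≤ r) (hr' : r ≤ nn i) (hq1 : |q1| ≤ 1) (hq0 : |q0| ≤ 1)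
    (h1 : q1 ≠ 0 → p ≤ e1 ∧ Act L e1) (h0 : q0 ≠ 0 → p ≤ e0 ∧ Act L e0)
    (hp : p ≠ 0 → Act L (p - 1) ∧ W (p - 1) = i ∧ AG (p - 1) < r)
    (ho : Odd i → e1 = e0 ∧ q1 = 1 ∧ q0 = 1 ∧ i < W e1 ∧ kap (W e1) = p ∧ Even (W e1))
    (hγ : i + p + e1 + e0 < γ) : Act L γ := by
  have a1 : W γ = i := by simp [W, hn]
  have a2 : AG γ = r := by simp [AG, hn]
  have a3 : Pp γ = p := by simp [Pp, hn]
  have a4 : E1 γ = e1 := by simp [E1, hn]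
  have a5 : E0 γ = e0 := by simp [E0, hn]
  have a6 : R1 γ = q1 := by simp [R1, hn]
  have a7 : R0 γ = q0 := by simp [R0, hn]
  have hq1' : |(q1 : ℝ)| ≤ 1 := by exact_mod_cast hq1
  have hq0' : |(q0 : ℝ)| ≤ 1 := by exact_mod_cast hq0
  refine Act.mk γ ?_ ?_ ?_ ?_ ?_ ?_ ?_ ?_ ?_ ?_ ?_ ?_ ?_ ?_ ?_ ?_ <;>
    simp only [a1, a2, a3, a4, a5, a6, a7, ne_eq, Rat.cast_eq_zero]
  · exact hi
  · omega
  · exact hr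
  · exact hr'
  · exact hq1'
  · exact hq0'
  · exact fun h => (h1 h).1
  · intro; omega
  · exact fun h => (h1 h).2
  · exact fun h => (h0 h).1
  · intro; omega
  · exact fun h => (h0 h).2
  · omega
  · exact fun h => (hp h).1
  · exact fun h => (hp h).2
  · intro h
    obtain ⟨b1, b2, b3, b4⟩ := ho h
    exact ⟨b1, by simp [b2], by simp [b3], b4⟩

/-- data for two-point functionals -/
def b2 (d : ℕ × ℕ × ℚ × ℚ) (f : ℕ → ℝ) : ℝ := (d.2.2.1 * f d.1 + d.2.2.2 * f d.2.1) / 2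

def okd (L : Set ℕ) (s t : ℕ) (d : ℕ × ℕ × ℚ × ℚ) : Prop :=
  |d.2.2.1| ≤ 1 ∧ |d.2.2.2| ≤ 1 ∧ (d.2.2.1 ≠ 0 → s ≤ d.1 ∧ d.1 < t ∧ Act L d.1) ∧
    (d.2.2.2 ≠ 0 → s ≤ d.2.1 ∧ d.2.1 < t ∧ Act L d.2.1)

lemma strictMono_ext (κ : ℕ → ℕ) (hκ : StrictMono κ) (r k : ℕ) (hk : ∀ q < r, κ q < k) :
    ∃ κ' : ℕ → ℕ, StrictMono κ' ∧ (∀ q < r, κ' q = κ q) ∧ κ' r = k ∧ ∀ q, κ 0 ≤ k → κ 0 ≤ κ' q := by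
  refine ⟨fun q => if q < r then κ q else k + (q - r), ?_, ?_, ?_, ?_⟩
  · intro a b hab
    have := hκ hab
    dsimp only
    split_ifs with h1 h2 h2
    · exact this
    · have := hk a h1; omega
    · omega
    · omega
  · intro q hq; simp [hq]
  · simp
  · intro q h; dsimp only
    split_ifs
    · exact hκ.monotone (Nat.zero_le _)
    · omega

lemma build {i : ℕ} (hi : i ∈ L) (he : Even i) (s t : ℕ → ℕ) (hst : ∀ k, s k ≤ t k)
    (hs : ∀ k, k ≤ s k) (d : ℕ → ℕ × ℕ × ℚ × ℚ) (hd : ∀ k, okd L (s k) (t k) (d k)) (k0 r : ℕ)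
    (hr : r ≤ nn i) :
    ∃ κ : ℕ → ℕ, ∃ p : ℕ, StrictMono κ ∧ (∀ q, k0 ≤ κ q) ∧
      (r = 0 ∧ p = 0 ∨ p ≠ 0 ∧ Act L (p - 1) ∧ W (p - 1) = i ∧ AG (p - 1) = r) ∧
      (∀ q < r, t (κ q) < p) ∧
      ∀ y : ℕ → ℕ → ℝ, (∀ q < r, Blk L (s (κ q)) (t (κ q)) (y (κ q))) → p ≠ 0 →
        ∑ q ∈ range r, y (κ q) (p - 1) = (mm i)⁻¹ * ∑ q ∈ range r, b2 (d (κ q)) (y (κ q)) := by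
  induction r with
  | zero => exact ⟨fun q => k0 + q, 0, fun a b h => by dsimp; omega, fun q => Nat.le_add_right _ _, Or.inl ⟨rfl, rfl⟩,
      by intros; omega, by simp⟩
  | succ r ih =>
    obtain ⟨κ, p, h1, h2, h3, h4, h5⟩ := ih (by omega)
    obtain ⟨k, hk⟩ : ∃ k, k = κ r + p + k0 := ⟨_, rfl⟩
    obtain ⟨κ', g1, g2, g3, g4⟩ := strictMono_ext κ h1 r k fun q hq => by have := h1 hq; omega
    obtain ⟨o1, o2, o3, o4⟩ := hd k
    obtain ⟨γ, hγ, hnd⟩ := exists_nd (i, r + 1, p, (d k).1, (d k).2.1, (d k).2.2.1, (d k).2.2.2)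
      (i + p + (d k).1 + (d k).2.1 + t k + 1)
    have hsk := hs k
    have ha : Act L γ := by
      refine act_of_nd hnd hi (by omega) hr o1 o2 (fun h => ?_) (fun h => ?_) (fun h => ?_)
        (fun h => absurd he (Nat.not_even_iff_odd.2 h)) (by omega)
      · obtain ⟨b1, b2, b3⟩ := o3 h; exact ⟨by omega, b3⟩
      · obtain ⟨b1, b2, b3⟩ := o4 h; exact ⟨by omega, b3⟩
      · rcases h3 with h3 | h3
        · omega
        · exact ⟨h3.2.1, h3.2.2.1, by omega⟩
    have a1 : W γ = i := by simp [W, hnd]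
    have a2 : AG γ = r + 1 := by simp [AG, hnd]
    have a3 : Pp γ = p := by simp [Pp, hnd]
    have hk0 : k0 ≤ κ' 0 := by
      rcases Nat.eq_zero_or_pos r with h | h
      · subst h; omega
      · rw [g2 0 h]; exact h2 0
    refine ⟨κ', γ + 1, g1, fun q => hk0.trans (g1.monotone (Nat.zero_le q)), Or.inr ⟨by omega, ?_⟩, ?_, ?_⟩
    · simp only [Nat.add_sub_cancel]; exact ⟨ha, a1, a2⟩
    · intro q hq
      rcases Nat.lt_or_ge q r with h | h
      · rw [g2 q h]; have := h4 q h; omega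
      · rw [show q = r by omega, g3]; omega
    · intro y hy _
      simp only [Nat.add_sub_cancel]
      rw [sum_range_succ, sum_range_succ, g3]
      have hyk := hy r (by omega)
      rw [g3] at hyk
      have e1 : y k γ = (mm i)⁻¹ * b2 (d k) (y k) := by
        rw [hyk.late (hst k) ha (by omega) (by omega), a1]
        simp [bb, b2, E1, E0, R1, R0, hnd]
      rw [e1, mul_add]
      congr 1
      rcases h3 with h3 | h3
      · rw [h3.1]; simp
      · rw [Finset.sum_congr rfl (fun q hq => ?_ : ∀ q ∈ range r, y (κ' q) γ = y (κ q) (p - 1)),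
          h5 y (fun q hq => by have := hy q (by omega); rwa [g2 q hq] at this) h3.1]
        · congr 1
          exact Finset.sum_congr rfl fun q hq => by rw [g2 q (mem_range.1 hq)]
        · have hq := mem_range.1 hq
          have := hy q (by omega)
          rw [g2 q hq] at this ⊢
          rw [this.early ha (by have := h4 q hq; omega)]
          unfold pv; rw [a3, if_neg h3.1]

lemma Blk.exists_lt {s t : ℕ} {y : ℕ → ℝ} {c : ℝ} (h : Blk L s t y) (hc : 0 < c)
    (hy : ∃ γ, c ≤ |y γ|) : ∃ η, s ≤ η ∧ η < t ∧ Act L η ∧ c / 4 < |y η| := by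
  by_contra hcon
  push Not at hcon
  obtain ⟨γ, hγ⟩ := hy
  have := Pr_bound (L := L) (n := t) (u := y) (c := c / 4) (fun η h1 h2 => by
    rcases Nat.lt_or_ge η s with h3 | h3
    · rw [h.2 η h3]; simp; linarith
    · exact hcon η h3 h1 h2) (by linarith) γ
  rw [h.1] at this
  linarith

lemma rat_near {ρ ε : ℝ} (h : |ρ| ≤ 1) (hε : 0 < ε) : ∃ q : ℚ, |q| ≤ 1 ∧ |ρ - q| ≤ ε := by
  rw [abs_le] at h
  rcases eq_or_lt_of_le h.1 with h1 | h1
  · exact ⟨-1, by simp, by simp [← h1]; exact hε.le⟩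
  · obtain ⟨q, hq1, hq2⟩ := exists_rat_btwn (max_lt h1 (by linarith : ρ - ε < ρ))
    have g1 := (le_max_left _ _).trans_lt hq1
    have g2 := (le_max_right _ _).trans_lt hq1
    refine ⟨q, ?_, ?_⟩
    · have : |(q : ℝ)| ≤ 1 := by rw [abs_le]; constructor <;> linarith [h.2]
      exact_mod_cast this
    · rw [abs_le]; constructor <;> linarith

lemma one_pt {s t : ℕ} {y : ℕ → ℝ} {δ : ℝ} (hy : Blk L s t y)
    (hδ : 0 < δ) (h : ∃ γ, δ ≤ |y γ|) :
    ∃ d, okd L s t d ∧ δ / 4 ≤ b2 d y := by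
  obtain ⟨η, g1, g2, g3, g4⟩ := hy.exists_lt hδ h
  rcases le_total 0 (y η) with h0 | h0
  · refine ⟨(η, η, 1, 1), ⟨by simp, by simp, fun _ => ⟨g1, g2, g3⟩, fun _ => ⟨g1, g2, g3⟩⟩, ?_⟩
    rw [abs_of_nonneg h0] at g4
    simp [b2]; linarith
  · refine ⟨(η, η, -1, -1), ⟨by simp, by simp, fun _ => ⟨g1, g2, g3⟩, fun _ => ⟨g1, g2, g3⟩⟩, ?_⟩
    rw [abs_of_nonpos h0] at g4
    simp [b2]; linarith

lemma two_pt {s t : ℕ} {x y : ℕ → ℝ} {δ tol : ℝ} (hx : Blk L s t x) (hy : Blk L s t y)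
    (hδ : 0 < δ) (htol : 0 < tol) (h : ∀ l : ℝ, ∃ γ, δ ≤ |y γ - l * x γ|) :
    ∃ d, okd L s t d ∧ |b2 d x| ≤ tol ∧ δ / 16 ≤ b2 d y := by
  have ht : (range t).Nonempty := by
    obtain ⟨η, _, g, _⟩ := hy.exists_lt hδ (by simpa using h 0)
    exact ⟨η, by simpa using g⟩
  obtain ⟨η0, h0, hmax⟩ := Finset.exists_max_image (range t) (fun η => |x η|) ht
  by_cases hx0 : x η0 = 0
  · have hz : ∀ η < t, x η = 0 := fun η hη => by
      have := hmax η (by simpa using hη); simpa [hx0] using this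
    obtain ⟨d, hd, hd'⟩ := one_pt hy hδ (by simpa using h 0)
    refine ⟨d, hd, ?_, by linarith⟩
    have e1 : (d.2.2.1 : ℝ) * x d.1 = 0 := by
      by_cases hq : d.2.2.1 = 0
      · simp [hq]
      · rw [hz _ (hd.2.2.1 hq).2.1, mul_zero]
    have e2 : (d.2.2.2 : ℝ) * x d.2.1 = 0 := by
      by_cases hq : d.2.2.2 = 0
      · simp [hq]
      · rw [hz _ (hd.2.2.2 hq).2.1, mul_zero]
    simp [b2, e1, e2]; exact htol.le
  · set l := y η0 / x η0 with hl
    have hb : Blk L s t (fun γ => 1 * y γ + (-l) * x γ) := hy.lin hx 1 (-l)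
    obtain ⟨η1, g1, g2, g3, g4⟩ := hb.exists_lt hδ (by
      obtain ⟨γ, hγ⟩ := h l
      exact ⟨γ, by convert hγ using 2; ring⟩)
    have hρ : |x η1 / x η0| ≤ 1 := by
      rw [abs_div, div_le_one (abs_pos.2 hx0)]; exact hmax η1 (by simpa using g2)
    set M := |x η0| + |y η0| + 1 with hM
    have hMp : 0 < M := by positivity
    obtain ⟨ρ, hr1, hr2⟩ := rat_near hρ (show 0 < min tol (δ / 8) / M by positivity)
    have r1 : |x η0 * (x η1 / x η0 - ρ)| ≤ min tol (δ / 8) := by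
      rw [abs_mul]
      calc |x η0| * |x η1 / x η0 - ρ| ≤ M * (min tol (δ / 8) / M) := by
            gcongr; have := abs_nonneg (y η0); linarith
        _ = _ := by field_simp
    have r2 : |y η0 * (x η1 / x η0 - ρ)| ≤ min tol (δ / 8) := by
      rw [abs_mul]
      calc |y η0| * |x η1 / x η0 - ρ| ≤ M * (min tol (δ / 8) / M) := by
            gcongr; have := abs_nonneg (x η0); linarith
        _ = _ := by field_simp
    have e1 : x η1 - ρ * x η0 = x η0 * (x η1 / x η0 - ρ) := by field_simp
    have e2 : y η1 - ρ * y η0 = (1 * y η1 + (-l) * x η1) + y η0 * (x η1 / x η0 - ρ) := by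
      rw [hl]; field_simp; ring
    have m1 := min_le_left tol (δ / 8)
    have m2 := min_le_right tol (δ / 8)
    have hs0 : s ≤ η0 := by
      by_contra hc; exact hx0 (hx.2 _ (by omega))
    have ha0 : Act L η0 := by
      by_contra hc; exact hx0 (hx.nact hc)
    have ht0 : η0 < t := by simpa using h0
    rcases le_total 0 (1 * y η1 + (-l) * x η1) with hh | hh
    · refine ⟨(η1, η0, 1, -ρ), ⟨by simp, by simpa using hr1, fun _ => ⟨g1, g2, g3⟩,
        fun _ => ⟨hs0, ht0, ha0⟩⟩, ?_, ?_⟩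
      · have : b2 (η1, η0, 1, -ρ) x = (x η1 - ρ * x η0) / 2 := by simp [b2]; ring
        rw [this, e1, abs_div, abs_two]; linarith
      · have : b2 (η1, η0, 1, -ρ) y = (y η1 - ρ * y η0) / 2 := by simp [b2]; ring
        rw [this, e2]
        rw [abs_of_nonneg hh] at g4
        rw [abs_le] at r2
        linarith [r2.1]
    · refine ⟨(η1, η0, -1, ρ), ⟨by simp, by simpa using hr1, fun _ => ⟨g1, g2, g3⟩,
        fun _ => ⟨hs0, ht0, ha0⟩⟩, ?_, ?_⟩
      · have : b2 (η1, η0, -1, ρ) x = -(x η1 - ρ * x η0) / 2 := by simp [b2]; ring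
        rw [this, e1, abs_div, abs_two, abs_neg]; linarith
      · have : b2 (η1, η0, -1, ρ) y = -(y η1 - ρ * y η0) / 2 := by simp [b2]; ring
        rw [this, e2]
        rw [abs_of_nonpos hh] at g4
        rw [abs_le] at r2
        linarith [r2.2]
end AH

namespace AH
open Finset
variable {L L' : Set ℕ} {γ : ℕ} {x y : ℕ → ℕ → ℝ} {s t j : ℕ → ℕ} {C : ℝ}

structure IRIS (L : Set ℕ) (C : ℝ) (x : ℕ → ℕ → ℝ) (s t j : ℕ → ℕ) : Prop where
  ris : ∀ N, RIS L C x s t j N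
  ks : ∀ k, k ≤ s k
  C1 : 1 ≤ C

lemma IRIS.sub (h : IRIS L C x s t j) {κ : ℕ → ℕ} (hκ : StrictMono κ) :
    IRIS L C (fun k => x (κ k)) (fun k => s (κ k)) (fun k => t (κ k)) (fun k => j (κ k)) := by
  refine ⟨fun N => ⟨⟨fun k _ => ?_, fun k _ => ?_, fun k l h1 _ => ?_⟩, fun k l h1 _ => ?_,
    fun k _ => ?_, fun k _ => ?_⟩, fun k => ?_, h.C1⟩
  · exact (h.ris (κ k + 1)).bs.blk _ (by omega)
  · exact (h.ris (κ k + 1)).bs.st _ (by omega)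
  · exact (h.ris (κ l + 1)).bs.ts _ _ (hκ h1) (by omega)
  · exact (h.ris (κ l + 1)).jj _ _ (hκ h1) (by omega)
  · exact (h.ris (κ k + 1)).nm _ (by omega)
  · exact (h.ris (κ k + 1)).lo _ (by omega)
  · exact hκ.le_apply.trans (h.ks _)

lemma IRIS.blk (h : IRIS L C x s t j) (k : ℕ) : Blk L (s k) (t k) (x k) :=
  (h.ris (k + 1)).bs.blk _ (by omega)
lemma IRIS.st (h : IRIS L C x s t j) (k : ℕ) : s k ≤ t k := (h.ris (k + 1)).bs.st _ (by omega)
lemma IRIS.ts (h : IRIS L C x s t j) {k l : ℕ} (hk : k < l) : t k ≤ s l :=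
  (h.ris (l + 1)).bs.ts _ _ hk (by omega)
lemma IRIS.jj (h : IRIS L C x s t j) {k l : ℕ} (hk : k < l) : t k < j l ∧ j k < j l :=
  (h.ris (l + 1)).jj _ _ hk (by omega)
lemma IRIS.nm (h : IRIS L C x s t j) (k γ : ℕ) : |x k γ| ≤ C := (h.ris (k + 1)).nm _ (by omega) γ
lemma IRIS.lo (h : IRIS L C x s t j) (k : ℕ) (ha : Act L γ) (hk : W γ < j k) :
    |x k γ| ≤ C / mm (W γ) := (h.ris (k + 1)).lo _ (by omega) γ ha hk

def Sp (x y : ℕ → ℕ → ℝ) : Submodule ℝ ((ℕ → ℝ) × (ℕ → ℝ)) :=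
  Submodule.span ℝ (Set.range fun k => (x k, y k))

def Dom (Kc : ℝ) (x y : ℕ → ℕ → ℝ) : Prop :=
  ∀ p ∈ Sp x y, ∀ B, (∀ γ, |p.1 γ| ≤ B) → ∀ γ, |p.2 γ| ≤ Kc * B

lemma Sp_sum {ι : Type*} (I : Finset ι) (a : ι → ℝ) (z v : ι → ℕ → ℝ)
    (h : ∀ k ∈ I, (z k, v k) ∈ Sp x y) :
    (fun γ => ∑ k ∈ I, a k * z k γ, fun γ => ∑ k ∈ I, a k * v k γ) ∈ Sp x y := by
  have : (fun γ => ∑ k ∈ I, a k * z k γ, fun γ => ∑ k ∈ I, a k * v k γ) =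
      ∑ k ∈ I, a k • (z k, v k) := by
    ext γ
    · simp [Prod.fst_sum, Finset.sum_apply]
    · simp [Prod.snd_sum, Finset.sum_apply]
  rw [this]
  exact Submodule.sum_mem _ fun k hk => Submodule.smul_mem _ _ (h k hk)

lemma Sp_self (k : ℕ) : (x k, y k) ∈ Sp x y := Submodule.subset_span ⟨k, rfl⟩

lemma S_range (κ : ℕ → ℕ) (N : ℕ) : S (fun k => x (κ k)) 0 N γ = ∑ q ∈ range N, x (κ q) γ := by
  simp [S]

lemma step_one (h : IRIS L C x s t j) (hy : ∀ k, Blk L (s k) (t k) (y k)) {δ tol : ℝ} (hδ : 0 < δ)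
    (htol : 0 < tol) (hsep : ∀ k (l : ℝ), ∃ γ, δ ≤ |y k γ - l * x k γ|) {i : ℕ} (hi : i ∈ L)
    (he : Even i) (k0 : ℕ) :
    ∃ z v s' t' η, (z, v) ∈ Sp x y ∧ Blk L s' t' z ∧ Blk L s' t' v ∧ k0 ≤ s' ∧ s' ≤ t' ∧ t' ≤ η ∧
      Act L η ∧ W η = i ∧ |z η| ≤ tol ∧ δ / 16 ≤ v η ∧ (∀ γ, |z γ| ≤ 15 * C) ∧
      (∀ γ, Act L γ → W γ < i → |z γ| ≤ 15 * C / mm (W γ)) ∧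
      (∀ γ, Act L γ → Odd (W γ) → W γ < i → W (E1 γ) ≠ i →
        |z γ - pv γ z| ≤ 18 * C / mm (W γ + 1)) := by
  have hC : 0 ≤ C := by linarith [h.C1]
  choose d hd hdx hdy using fun k => two_pt (h.blk k) (hy k) hδ htol (hsep k)
  obtain ⟨κ, p, h1, h2, h3, h4, h5⟩ := build hi he s t h.st h.ks d hd k0 (nn i) le_rfl
  have hnn := nn_pos i
  obtain ⟨hp, ha, hW, hAG⟩ : p ≠ 0 ∧ Act L (p - 1) ∧ W (p - 1) = i ∧ AG (p - 1) = nn i := by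
    rcases h3 with h3 | h3
    · omega
    · exact h3
  have hn0 : (0 : ℝ) < nn i := by exact_mod_cast (by omega : 0 < nn i)
  have hm0 := mm_pos i
  set c : ℝ := mm i / nn i with hc
  have hc0 : 0 < c := by positivity
  have hR := (h.sub h1).ris (nn i)
  have cm : c * (nn i / mm i) = 1 := by rw [hc]; field_simp
  have cle : c ≤ 1 / mm i := by
    rw [hc, div_le_div_iff₀ hn0 hm0]; have := mm_sq_nn i; nlinarith
  have hz : ∀ γ, c * S (fun k => x (κ k)) 0 (nn i) γ = ∑ q ∈ range (nn i), c * x (κ q) γ := by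
    intro γ; rw [S_range, Finset.mul_sum]
  have hzs : ∀ w : ℕ → ℕ → ℝ, (∀ k, Blk L (s k) (t k) (w k)) →
      Blk L (s (κ 0)) (t (κ (nn i - 1))) (fun γ => ∑ q ∈ range (nn i), c * w (κ q) γ) := by
    intro w hw
    refine Blk.sum _ fun q hq => (hw (κ q)).mono ?_ ?_
    · rcases Nat.eq_zero_or_pos q with h0 | h0
      · rw [h0]
      · exact (h.st _).trans (h.ts (h1 h0))
    · rw [mem_range] at hq
      rcases Nat.eq_or_lt_of_le (show q ≤ nn i - 1 by omega) with h0 | h0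
      · rw [h0]
      · exact (h.ts (h1 h0)).trans (h.st _)
  have val : ∀ w : ℕ → ℕ → ℝ, (∀ k, Blk L (s k) (t k) (w k)) →
      ∑ q ∈ range (nn i), c * w (κ q) (p - 1) = (∑ q ∈ range (nn i), b2 (d (κ q)) (w (κ q))) / nn i := by
    intro w hw
    rw [← Finset.mul_sum, h5 w (fun q _ => hw _) hp, hc]; field_simp
  refine ⟨fun γ => ∑ q ∈ range (nn i), c * x (κ q) γ, fun γ => ∑ q ∈ range (nn i), c * y (κ q) γ,
    s (κ 0), t (κ (nn i - 1)), p - 1, Sp_sum _ (fun _ => c) (fun q => x (κ q)) (fun q => y (κ q))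
      fun k _ => Sp_self _, hzs x h.blk, hzs y hy, (h2 0).trans (h.ks _), ?_, ?_, ha, hW, ?_, ?_, ?_, ?_, ?_⟩
  · exact (h.st _).trans ((h.ts (h1 (show 0 < nn i - 1 by omega))).trans (h.st _))
  · have := h4 (nn i - 1) (by omega); omega
  · dsimp only
    rw [val x h.blk, abs_div, abs_of_pos hn0, div_le_iff₀ hn0]
    refine (Finset.abs_sum_le_sum_abs _ _).trans ((Finset.sum_le_sum fun q _ => hdx (κ q)).trans ?_)
    simp [mul_comm]
  · dsimp only
    rw [val y hy, le_div_iff₀ hn0]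
    refine le_trans ?_ (Finset.sum_le_sum fun q _ => hdy (κ q))
    simp [mul_comm]
  · intro γ; dsimp only
    rw [← hz, abs_mul, abs_of_pos hc0]
    have := (hR.avg (γ := γ) hC le_rfl (Nat.zero_le _) le_rfl).1
    calc _ ≤ c * (10 * C * (nn i / mm i)) := by gcongr
      _ = 10 * C * (c * (nn i / mm i)) := by ring
      _ ≤ 15 * C := by rw [cm]; linarith
  · intro γ ha' hw; dsimp only
    rw [← hz, abs_mul, abs_of_pos hc0]
    have := (hR.avg (γ := γ) hC le_rfl (Nat.zero_le _) le_rfl).2.1 ha' hw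
    calc _ ≤ c * (15 * C * (nn i / mm i) / mm (W γ)) := by gcongr
      _ = 15 * C * (c * (nn i / mm i)) / mm (W γ) := by ring
      _ = _ := by rw [cm, mul_one]
  · intro γ ha' hodd hw hne; dsimp only
    obtain ⟨c1, c2, c3, c4, g1, g2, g3, g4, g5, g6, g7, g8, g9⟩ :=
      hR.bs.step (Nat.zero_le _) le_rfl ha'
    obtain ⟨o1, o2, o3, o4, o5, o6, o7⟩ := ha'.odd hodd
    have e1 : (fun γ => ∑ q ∈ range (nn i), c * x (κ q) γ) =
        fun γ => c * S (fun k => x (κ k)) 0 (nn i) γ + 0 * 0 := by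
      funext γ; rw [hz]; ring
    have e2 : pv γ (fun γ => ∑ q ∈ range (nn i), c * x (κ q) γ) =
        c * pv γ (S (fun k => x (κ k)) 0 (nn i)) := by
      rw [e1, pv_lin γ c 0 _ (fun _ => 0)]; ring
    rw [e2, ← hz, ← mul_sub, abs_mul, abs_of_pos hc0, g8, g9]
    have q1 : ∀ η, |S (fun k => x (κ k)) c1 c2 η| ≤ C := fun η => by
      refine (S_one (fun k => x (κ k)) g6 g2 fun _ => h.nm (κ c1) η).trans ?_
      have : (c2 : ℝ) ≤ c1 + 1 := by exact_mod_cast g6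
      nlinarith
    have q4 : ∀ η, |S (fun k => x (κ k)) c3 c4 η| ≤ C := fun η => by
      refine (S_one (fun k => x (κ k)) g7 g4 fun _ => h.nm (κ c3) η).trans ?_
      have : (c4 : ℝ) ≤ c3 + 1 := by exact_mod_cast g7
      nlinarith
    have q2 := pv_bound (γ := γ) hC q1
    have q3 : c * |(mm (W γ))⁻¹ * bb γ (S (fun k => x (κ k)) c2 c3)| ≤ 15 * C / mm (W γ + 1) := by
      have eb : bb γ (S (fun k => x (κ k)) c2 c3) = S (fun k => x (κ k)) c2 c3 (E1 γ) := by
        unfold bb; rw [o2, o3, ← o1]; ring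
      have e3 : c * |S (fun k => x (κ k)) c2 c3 (E1 γ)| ≤ 15 * C / mm (W γ + 1) := by
        have hav := hR.avg (γ := E1 γ) (J := i) hC le_rfl g3 (by omega)
        have mp := mm_pos (W γ + 1)
        rcases lt_or_gt_of_ne hne with hlt | hgt
        · have := hav.2.1 o6 hlt
          have mp' : mm (W γ + 1) ≤ mm (W (E1 γ)) := mm_mono.monotone o4
          calc _ ≤ c * (15 * C * (nn i / mm i) / mm (W (E1 γ))) := by gcongr
            _ = 15 * C * (c * (nn i / mm i)) / mm (W (E1 γ)) := by ring
            _ ≤ _ := by rw [cm, mul_one]; gcongr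
        · have := hav.2.2 o6 hgt
          have mp' : mm (W γ + 1) ≤ mm i := mm_mono.monotone hw
          calc _ ≤ c * (6 * C * (nn i / mm i) / mm i) := by gcongr
            _ = 6 * C * (c * (nn i / mm i)) / mm i := by ring
            _ ≤ _ := by rw [cm, mul_one]; gcongr; norm_num
      rw [eb, abs_mul, abs_inv, abs_of_pos (mm_pos _)]
      refine le_trans ?_ e3
      refine mul_le_mul_of_nonneg_left ?_ hc0.le
      have : (mm (W γ))⁻¹ ≤ 1 := inv_le_one_of_one_le₀ (by linarith [mm_ge (W γ)])
      have := abs_nonneg (S (fun k => x (κ k)) c2 c3 (E1 γ))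
      nlinarith
    have q5 : c * (3 * C) ≤ 3 * C / mm (W γ + 1) := by
      have mp' : mm (W γ + 1) ≤ mm i := mm_mono.monotone hw
      have mp := mm_pos (W γ + 1)
      have : c ≤ 1 / mm (W γ + 1) := cle.trans (one_div_le_one_div_of_le mp mp')
      calc c * (3 * C) ≤ (1 / mm (W γ + 1)) * (3 * C) := by gcongr
        _ = _ := by ring
    have q6 := q1 γ
    have q7 := q4 γ
    set T1 := S (fun k => x (κ k)) c1 c2 γ
    set T2 := pv γ (S (fun k => x (κ k)) c1 c2)
    set T3 := (mm (W γ))⁻¹ * bb γ (S (fun k => x (κ k)) c2 c3)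
    set T4 := S (fun k => x (κ k)) c3 c4 γ
    have e4 : |pv γ (S (fun k => x (κ k)) 0 c1) + T1 + T3 + T4 - (pv γ (S (fun k => x (κ k)) 0 c1) + T2)|
        ≤ 3 * C + |T3| := by
      have := le_abs_self T3
      have := neg_abs_le T3
      rw [abs_le] at q2 q6 q7 ⊢
      constructor <;> linarith [q2.1, q2.2, q6.1, q6.2, q7.1, q7.2]
    calc _ ≤ c * (3 * C + |T3|) := by gcongr
      _ = c * (3 * C) + c * |T3| := by ring
      _ ≤ 3 * C / mm (W γ + 1) + 15 * C / mm (W γ + 1) := add_le_add q5 q3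
      _ = _ := by ring

lemma op_cross (h : IRIS L C x s t j) (hy : ∀ k, Blk L' (s k) (t k) (y k)) {δ Kc : ℝ} (hδ : 0 < δ)
    (hD : Dom Kc x y) (hbig : ∀ k, ∃ γ, δ ≤ |y k γ|)
    (hL : ∀ M, ∃ i ≥ M, i ∈ L' ∧ i ∉ L ∧ Even i) : False := by
  have hC : 0 ≤ C := by linarith [h.C1]
  choose d hd hdy using fun k => one_pt (hy k) hδ (hbig k)
  obtain ⟨M, hM⟩ := exists_mm (60 * C * Kc / δ)
  obtain ⟨i, hiM, hi, hi', he⟩ := hL M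
  obtain ⟨κ, p, h1, h2, h3, h4, h5⟩ := build hi he s t h.st h.ks d hd 0 (nn i) le_rfl
  have hnn := nn_pos i
  obtain ⟨hp, ha, hW, hAG⟩ : p ≠ 0 ∧ Act L' (p - 1) ∧ W (p - 1) = i ∧ AG (p - 1) = nn i := by
    rcases h3 with h3 | h3
    · omega
    · exact h3
  have hn0 : (0 : ℝ) < nn i := by exact_mod_cast (by omega : 0 < nn i)
  have hm0 := mm_pos i
  have hR := (h.sub h1).ris (nn i)
  have up : ∀ γ, |∑ q ∈ range (nn i), 1 * x (κ q) γ| ≤ 3 * (5 * C) * nn i / mm i ^ 2 := by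
    intro γ
    have := hR.avg_ex (γ := γ) hC le_rfl (K := 5 * C) le_rfl
      (fun γ a b ha hw => absurd (hw ▸ ha.wL) hi') (Nat.zero_le _) le_rfl
    rw [S_range] at this
    simpa using this
  have := hD _ (Sp_sum (range (nn i)) (fun _ => 1) (fun q => x (κ q)) (fun q => y (κ q))
    fun k _ => Sp_self _) _ up (p - 1)
  simp only [one_mul] at this
  rw [h5 y (fun q _ => hy _) hp] at this
  have lo : nn i * (δ / 4) ≤ ∑ q ∈ range (nn i), b2 (d (κ q)) (y (κ q)) := by
    refine le_trans ?_ (Finset.sum_le_sum fun q _ => hdy (κ q))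
    simp
  have h6 := (le_abs_self _).trans this
  have h7 : (mm i)⁻¹ * (nn i * (δ / 4)) ≤ Kc * (3 * (5 * C) * nn i / mm i ^ 2) :=
    le_trans (by gcongr) h6
  have h8 := hM i hiM
  rw [div_lt_iff₀ hδ] at h8
  have h9 : nn i * δ * mm i ≤ nn i * (60 * C * Kc) := by
    have := mul_le_mul_of_nonneg_right h7 (by positivity : 0 ≤ 4 * mm i ^ 2)
    have e1 : (mm i)⁻¹ * (nn i * (δ / 4)) * (4 * mm i ^ 2) = nn i * δ * mm i := by field_simp
    have e2 : Kc * (3 * (5 * C) * nn i / mm i ^ 2) * (4 * mm i ^ 2) = nn i * (60 * C * Kc) := by field_simp; ring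
    linarith
  nlinarith
end AH

namespace AH
open Finset
variable {L L' : Set ℕ} {γ : ℕ} {x y : ℕ → ℕ → ℝ} {s t j : ℕ → ℕ} {C : ℝ}

structure Good (L : Set ℕ) : Prop where
  ev : ∀ k M, ∃ i ≥ M, i ∈ L ∧ Even i ∧ kap i = k
  od : ∀ M, ∃ i ≥ M, i ∈ L ∧ Odd i

structure St where
  z : ℕ → ℝ
  v : ℕ → ℝ
  s : ℕ
  t : ℕ
  i : ℕ
  η : ℕ
  ξ : ℕ

instance : Nonempty St := ⟨⟨0, 0, 0, 0, 0, 0, 0⟩⟩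

def gst (L : Set ℕ) (J p k : ℕ) : Prop :=
  k = 0 ∧ p = 0 ∨ p ≠ 0 ∧ Act L (p - 1) ∧ W (p - 1) = J ∧ AG (p - 1) = k

structure Stp (L : Set ℕ) (x y : ℕ → ℕ → ℝ) (C δ tol : ℝ) (J p k : ℕ) (D : St) : Prop where
  sp : (D.z, D.v) ∈ Sp x y
  bz : Blk L D.s D.t D.z
  bv : Blk L D.s D.t D.v
  ps : p ≤ D.s
  st : D.s ≤ D.t
  te : D.t ≤ D.η
  eW : W D.η = D.i
  ieta : D.i ≤ D.η
  ze : |D.z D.η| ≤ tol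
  ve : δ / 16 ≤ D.v D.η
  nm : ∀ γ, |D.z γ| ≤ 15 * C
  lo : ∀ γ, Act L γ → W γ < D.i → |D.z γ| ≤ 15 * C / mm (W γ)
  dif : ∀ γ, Act L γ → Odd (W γ) → W γ < D.i → W (E1 γ) ≠ D.i →
        |D.z γ - pv γ D.z| ≤ 18 * C / mm (W γ + 1)
  iJ : J < D.i
  ip : p < D.i
  ki : kap D.i = p
  ex : D.η < D.ξ
  ax : Act L D.ξ
  wx : W D.ξ = J
  px : Pp D.ξ = p
  agx : AG D.ξ = k + 1
  bx : ∀ f, bb D.ξ f = f D.η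

lemma exists_stp (hL : Good L) (h : IRIS L C x s t j) (hy : ∀ k, Blk L (s k) (t k) (y k)) {δ tol : ℝ}
    (hδ : 0 < δ) (htol : 0 < tol) (hsep : ∀ k (l : ℝ), ∃ γ, δ ≤ |y k γ - l * x k γ|) {J : ℕ}
    (hJ : J ∈ L) (p k : ℕ) (hg : gst L J p k) (hk : k < nn J) :
    ∃ D, Stp L x y C δ tol J p k D := by
  obtain ⟨i, hi1, hi2, hi3, hi4⟩ := hL.ev p (J + p + 1)
  obtain ⟨z, v, s', t', η, q1, q2, q3, q4, q5, q6, q7, q8, q9, q10, q11, q12, q13⟩ :=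
    step_one h hy hδ htol hsep hi2 hi3 p
  obtain ⟨ξ, hξ, hnd⟩ := exists_nd (J, k + 1, p, η, η, 1, 1) (J + p + η + η + 1)
  have ha : Act L ξ := act_of_nd hnd hJ (by omega) (by omega) (by simp) (by simp)
    (fun _ => ⟨by omega, q7⟩) (fun _ => ⟨by omega, q7⟩) (fun hp => by
      rcases hg with hg | hg
      · omega
      · exact ⟨hg.2.1, hg.2.2.1, by omega⟩)
    (fun _ => ⟨rfl, rfl, rfl, by omega, by rw [q8, hi4], by rw [q8]; exact hi3⟩) (by omega)
  exact ⟨⟨z, v, s', t', i, η, ξ⟩, ⟨q1, q2, q3, q4, q5, q6, q8, q8 ▸ q7.wle, q9, q10, q11, q12, q13,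
    by dsimp; omega, by dsimp; omega, hi4, by dsimp; omega, ha, by simp [W, hnd], by simp [Pp, hnd],
    by simp [AG, hnd], fun f => by simp [bb, E1, E0, R1, R0, hnd]⟩⟩

lemma op_same (hL : Good L) (h : IRIS L C x s t j) (hy : ∀ k, Blk L (s k) (t k) (y k)) {δ Kc : ℝ}
    (hδ : 0 < δ) (hsep : ∀ k (l : ℝ), ∃ γ, δ ≤ |y k γ - l * x k γ|) (hD : Dom Kc x y) : False := by
  have hC1 := h.C1
  have hC : 0 ≤ C := by linarith
  obtain ⟨M, hM⟩ := exists_mm (3600 * C * Kc / δ)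
  obtain ⟨J, hJM, hJ, hodd⟩ := hL.od M
  have hnn := nn_pos J
  have hn0 : (0 : ℝ) < nn J := by exact_mod_cast (by omega : 0 < nn J)
  have hm0 := mm_pos J
  set tol : ℝ := C / nn J ^ 2 with htoldef
  have htol : 0 < tol := by positivity
  have step := fun p k hg hk => exists_stp hL h hy hδ htol hsep hJ p k hg hk
  choose! F hF using step
  set p : ℕ → ℕ := fun k => Nat.rec 0 (fun k q => (F q k).ξ + 1) k with hp
  have p0 : p 0 = 0 := rfl
  have ps : ∀ k, p (k + 1) = (F (p k) k).ξ + 1 := fun k => rfl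
  have hg : ∀ k ≤ nn J, gst L J (p k) k := by
    intro k
    induction k with
    | zero => intro _; exact Or.inl ⟨rfl, rfl⟩
    | succ k ih =>
      intro hk
      have := hF (p k) k (ih (by omega)) (by omega)
      right
      rw [ps, Nat.add_sub_cancel]
      exact ⟨by omega, this.ax, this.wx, this.agx⟩
  have hE : ∀ k < nn J, Stp L x y C δ tol J (p k) k (F (p k) k) := fun k hk =>
    hF (p k) k (hg k hk.le) hk
  clear_value p
  set D : ℕ → St := fun k => F (p k) k with hDdef
  have hE : ∀ k < nn J, Stp L x y C δ tol J (p k) k (D k) := hE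
  have ps : ∀ k, p (k + 1) = (D k).ξ + 1 := ps
  clear_value D
  clear hDdef hF
  have plt : ∀ k l, k < l → l ≤ nn J → (D k).ξ + 1 ≤ p l := by
    intro k l hkl
    induction l, hkl using Nat.le_induction with
    | base => intro _; rw [ps]
    | succ l hl ih =>
      intro hh
      have := ih (by omega)
      have e := hE l (by omega)
      have := e.ps; have := e.st; have := e.te; have := e.ex
      rw [ps]; omega
  have pinj : ∀ k l, k < l → l ≤ nn J → p k < p l := by
    intro k l h1 h2
    have := plt k l h1 h2
    have e := hE k (by omega)
    have := e.ps; have := e.st; have := e.te; have := e.ex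
    omega
  -- values at ξ
  have vx : ∀ f k l, k ≤ l → l < nn J → Blk L (D k).s (D k).t f →
      f (D l).ξ = (mm J)⁻¹ * f (D k).η := by
    intro f k l hkl
    induction l, hkl using Nat.le_induction with
    | base =>
      intro hk hf
      have e := hE k hk
      rw [hf.late e.st e.ax (by rw [e.px]; exact e.ps) (e.te.trans e.ex.le), e.wx, e.bx]
    | succ l hl ih =>
      intro hk hf
      have e := hE (l+1) hk
      have e' := hE k (by omega)
      have h1 := plt k (l+1) (by omega) hk.le
      rw [hf.early e.ax (by rw [e.px]; have := e'.te; have := e'.ex; omega), ← ih (by omega) hf]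
      unfold pv
      rw [e.px, ps, if_neg (by omega), Nat.add_sub_cancel]
  have hRIS : RIS L (15 * C) (fun k => (D k).z) (fun k => (D k).s) (fun k => (D k).t)
      (fun k => (D k).i) (nn J) := by
    refine ⟨⟨fun k hk => (hE k hk).bz, fun k hk => (hE k hk).st, fun k l h1 h2 => ?_⟩,
      fun k l h1 h2 => ?_, fun k hk => (hE k hk).nm, fun k hk => (hE k hk).lo⟩
    · have := plt k l h1 h2.le; have e := hE k (by omega); have e' := hE l h2
      have := e.te; have := e.ex; have := e'.ps; omega
    · have := plt k l h1 h2.le; have e := hE k (by omega); have e' := hE l h2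
      have := e.te; have := e.ex; have := e'.ip; have := e.ieta; omega
  set ε : ℝ := 19 * C / nn J ^ 2 with hε
  have hmJ : 18 * C / mm (J + 1) ≤ 18 * C / nn J ^ 2 := by
    have := nn_sq_mm (show J < J + 1 by omega)
    gcongr
  have hε' : tol + 18 * C / mm (J + 1) ≤ ε := by
    have : ε = tol + 18 * C / nn J ^ 2 := by rw [hε, htoldef]; ring
    linarith
  have hε0 : 0 ≤ ε := by positivity
  have key : ∀ γ, Act L γ → W γ = J → ∃ K0, ∀ k < nn J, k ≠ K0 → |(D k).z γ| ≤ AG γ * ε := by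
    intro γ
    induction γ using Nat.strong_induction_on with
    | _ γ ih =>
      intro ha hW
      have ho : Odd (W γ) := by rw [hW]; exact hodd
      have hag : (1 : ℝ) ≤ AG γ := by exact_mod_cast ha.ag1
      obtain ⟨o1, o2, o3, o4, o5, o6, o7⟩ := ha.odd ho
      by_cases hc : ∃ k0 ≤ nn J, Pp γ = p k0
      · obtain ⟨k0, hk0, hpk⟩ := hc
        refine ⟨k0, fun k hk hkk => ?_⟩
        have e := hE k hk
        have hne : W (E1 γ) ≠ (D k).i := by
          intro he
          have := e.ki
          rw [← he, o5, hpk] at this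
          rcases lt_or_gt_of_ne hkk with h1 | h1
          · have := pinj k k0 h1 hk0; omega
          · have := pinj k0 k h1 hk.le; omega
        have d1 := e.dif γ ha ho (by rw [hW]; exact e.iJ) hne
        rw [hW] at d1
        have d2 : |pv γ (D k).z| ≤ tol := by
          unfold pv; split_ifs with h0
          · simpa using htol.le
          · rw [hpk] at h0 ⊢
            rcases Nat.eq_zero_or_pos k0 with h2 | h2
            · rw [h2, p0] at h0; exact absurd rfl h0
            · obtain ⟨l, rfl⟩ : ∃ l, k0 = l + 1 := ⟨k0 - 1, by omega⟩
              rw [ps, Nat.add_sub_cancel]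
              rcases Nat.lt_or_ge l k with h3 | h3
              · have := plt l k h3 hk.le
                rw [e.bz.2 _ (by have := e.ps; omega)]
                simpa using htol.le
              · rw [vx _ k l h3 (by omega) e.bz, abs_mul, abs_inv, abs_of_pos hm0]
                have := e.ze
                have h4 : (mm J)⁻¹ ≤ 1 := inv_le_one_of_one_le₀ (by linarith [mm_ge J])
                have := abs_nonneg ((D k).z (D k).η)
                nlinarith
        have d3 : |(D k).z γ| ≤ ε := by
          have : (D k).z γ = ((D k).z γ - pv γ (D k).z) + pv γ (D k).z := by ring
          rw [this]; exact (abs_add_le _ _).trans (by linarith)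
        nlinarith
      · push Not at hc
        have h0 : Pp γ ≠ 0 := by rw [← p0]; exact hc 0 (Nat.zero_le _)
        obtain ⟨b1, b2, b3, b4⟩ := ha.pp h0
        obtain ⟨K0, hK0⟩ := ih _ b2 b1 (by omega)
        refine ⟨K0, fun k hk hkk => ?_⟩
        have e := hE k hk
        have hne : W (E1 γ) ≠ (D k).i := by
          intro he
          have := e.ki
          rw [← he, o5] at this
          exact hc k hk.le this
        have d1 := e.dif γ ha ho (by rw [hW]; exact e.iJ) hne
        rw [hW] at d1
        have d2 := hK0 k hk hkk
        have d3 : pv γ (D k).z = (D k).z (Pp γ - 1) := by unfold pv; rw [if_neg h0]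
        rw [← d3] at d2
        have b5 : ((AG (Pp γ - 1) : ℕ) : ℝ) + 1 ≤ AG γ := by exact_mod_cast b4
        have : (D k).z γ = ((D k).z γ - pv γ (D k).z) + pv γ (D k).z := by ring
        rw [this]
        refine (abs_add_le _ _).trans ?_
        nlinarith
  have HJ : ∀ γ a b, Act L γ → W γ = J → a ≤ b → b ≤ nn J →
      |S (fun k => (D k).z) a b γ| ≤ 75 * C := by
    intro γ a b ha hW hab hb
    obtain ⟨K0, hK0⟩ := key γ ha hW
    have hag : (AG γ : ℝ) ≤ nn J := by rw [← hW]; exact_mod_cast ha.ag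
    have hAe : 0 ≤ AG γ * ε := by positivity
    have bd : ∀ k ∈ Ico a b, |(D k).z γ| ≤ AG γ * ε + if k = K0 then 15 * C else 0 := by
      intro k hk
      rw [mem_Ico] at hk
      split_ifs with h1
      · have := (hE k (by omega)).nm γ; linarith
      · have := hK0 k (by omega) h1; linarith
    refine (Finset.abs_sum_le_sum_abs _ _).trans ((Finset.sum_le_sum bd).trans ?_)
    rw [Finset.sum_add_distrib, Finset.sum_ite_eq']
    have h1 : (∑ k ∈ Ico a b, (AG γ : ℝ) * ε) ≤ 19 * C := by
      rw [Finset.sum_const, Nat.card_Ico, nsmul_eq_mul]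
      have : ((b - a : ℕ) : ℝ) ≤ nn J := by exact_mod_cast (by omega : b - a ≤ nn J)
      calc ((b - a : ℕ) : ℝ) * (AG γ * ε) ≤ nn J * (nn J * ε) := by gcongr
        _ = 19 * C := by rw [hε]; field_simp
    split_ifs <;> linarith
  have up : ∀ γ, |∑ k ∈ range (nn J), 1 * (D k).z γ| ≤ 3 * (75 * C) * nn J / mm J ^ 2 := by
    intro γ
    have := hRIS.avg_ex (γ := γ) (by linarith) le_rfl (K := 75 * C) (by linarith) HJ
      (Nat.zero_le _) le_rfl
    have e := S_range (x := fun k => (D k).z) (γ := γ) id (nn J)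
    simp only [id] at e
    rw [e] at this
    simpa using this
  have := hD _ (Sp_sum (range (nn J)) (fun _ => 1) (fun k => (D k).z) (fun k => (D k).v)
    fun k hk => (hE k (mem_range.1 hk)).sp) _ up (D (nn J - 1)).ξ
  simp only [one_mul] at this
  have lo : (mm J)⁻¹ * (nn J * (δ / 16)) ≤ ∑ k ∈ range (nn J), (D k).v (D (nn J - 1)).ξ := by
    have : ∑ k ∈ range (nn J), (mm J)⁻¹ * (δ / 16) ≤ ∑ k ∈ range (nn J), (D k).v (D (nn J - 1)).ξ := by
      refine Finset.sum_le_sum fun k hk => ?_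
      rw [mem_range] at hk
      rw [vx _ k (nn J - 1) (by omega) (by omega) (hE k hk).bv]
      have := (hE k hk).ve
      gcongr
    refine le_trans (le_of_eq ?_) this
    rw [Finset.sum_const, card_range, nsmul_eq_mul]; ring
  have h7 := lo.trans ((le_abs_self _).trans this)
  have h8 := hM J hJM
  rw [div_lt_iff₀ hδ] at h8
  have h9 : nn J * δ * mm J ≤ nn J * (3600 * C * Kc) := by
    have := mul_le_mul_of_nonneg_right h7 (by positivity : 0 ≤ 16 * mm J ^ 2)
    have e1 : (mm J)⁻¹ * (nn J * (δ / 16)) * (16 * mm J ^ 2) = nn J * δ * mm J := by field_simp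
    have e2 : Kc * (3 * (75 * C) * nn J / mm J ^ 2) * (16 * mm J ^ 2) = nn J * (3600 * C * Kc) := by field_simp; ring
    linarith
  nlinarith
end AH

namespace AH
open Finset BoundedContinuousFunction
variable {L : Set ℕ} {γ n m : ℕ} {f g : ℕ → ℝ}

def XS (L : Set ℕ) : Submodule ℝ (ℕ →ᵇ ℝ) where
  carrier := {x | ∀ ε > 0, ∃ N, ∀ n ≥ N, ∀ γ, |x γ - Pr L n x γ| ≤ ε}
  zero_mem' := fun ε hε => ⟨0, fun n _ γ => by
    have := congrFun (Pr_lin (L := L) n 0 0 (fun _ => 0) (fun _ => 0)) γ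
    simp only [zero_mul, add_zero] at this
    have e : ⇑(0 : ℕ →ᵇ ℝ) = fun _ => 0 := rfl
    rw [e, this]; simpa using hε.le⟩
  add_mem' := fun {x y} hx hy ε hε => by
    obtain ⟨N1, h1⟩ := hx (ε / 2) (by linarith)
    obtain ⟨N2, h2⟩ := hy (ε / 2) (by linarith)
    refine ⟨max N1 N2, fun n hn γ => ?_⟩
    have a1 := h1 n (le_of_max_le_left hn) γ
    have a2 := h2 n (le_of_max_le_right hn) γ
    have := congrFun (Pr_lin (L := L) n 1 1 x y) γ
    simp only [one_mul] at this
    have e : ⇑(x + y) = fun η => x η + y η := rfl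
    rw [e, this]
    rw [abs_le] at *; constructor <;> linarith [a1.1, a1.2, a2.1, a2.2]
  smul_mem' := fun c x hx ε hε => by
    obtain ⟨N1, h1⟩ := hx (ε / (|c| + 1)) (by positivity)
    refine ⟨N1, fun n hn γ => ?_⟩
    have a1 := h1 n hn γ
    have := congrFun (Pr_lin (L := L) n c 0 x x) γ
    simp only [zero_mul, add_zero] at this
    have e : ⇑(c • x) = fun η => c * x η := rfl
    rw [e, this, ← mul_sub, abs_mul]
    calc |c| * |x γ - Pr L n x γ| ≤ |c| * (ε / (|c| + 1)) := by gcongr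
      _ = (|c| / (|c| + 1)) * ε := by ring
      _ ≤ 1 * ε := by gcongr; rw [div_le_one (by positivity)]; linarith
      _ = ε := one_mul _

def X (L : Set ℕ) : Type := ↥(XS L)
instance : NormedAddCommGroup (X L) := inferInstanceAs (NormedAddCommGroup ↥(XS L))
instance : NormedSpace ℝ (X L) := inferInstanceAs (NormedSpace ℝ ↥(XS L))

def X.fn (x : X L) : ℕ → ℝ := fun γ => (Subtype.val x : ℕ →ᵇ ℝ) γ
instance : CoeFun (X L) (fun _ => ℕ → ℝ) := ⟨X.fn⟩
lemma X.prop (x : X L) : ∀ ε > 0, ∃ N, ∀ n ≥ N, ∀ γ, |x γ - Pr L n x γ| ≤ ε := Subtype.property x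

@[simp] lemma X.add_ap (x y : X L) (γ : ℕ) : (x + y) γ = x γ + y γ := rfl
@[simp] lemma X.sub_ap (x y : X L) (γ : ℕ) : (x - y) γ = x γ - y γ := rfl
@[simp] lemma X.neg_ap (x : X L) (γ : ℕ) : (-x) γ = -x γ := rfl
@[simp] lemma X.smul_ap (c : ℝ) (x : X L) (γ : ℕ) : (c • x) γ = c * x γ := rfl
@[simp] lemma X.zero_ap (γ : ℕ) : (0 : X L) γ = 0 := rfl
lemma X.sum_ap {ι : Type*} (I : Finset ι) (x : ι → X L) (γ : ℕ) : (∑ k ∈ I, x k) γ = ∑ k ∈ I, x k γ := by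
  classical
  induction I using Finset.induction_on with
  | empty => simp
  | insert i I hi ih => rw [Finset.sum_insert hi, Finset.sum_insert hi, X.add_ap, ih]
lemma X.ext' {x y : X L} (h : ∀ γ, x γ = y γ) : x = y := Subtype.ext (BoundedContinuousFunction.ext h)
lemma X.ap_le (x : X L) (γ : ℕ) : |x γ| ≤ ‖x‖ := (Subtype.val x : ℕ →ᵇ ℝ).norm_coe_le_norm γ
lemma X.norm_le {x : X L} {c : ℝ} (hc : 0 ≤ c) : ‖x‖ ≤ c ↔ ∀ γ, |x γ| ≤ c :=
  BoundedContinuousFunction.norm_le hc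
lemma X.exists_big {x : X L} {c : ℝ} (hc : 0 ≤ c) (h : c < ‖x‖) : ∃ γ, c < |x γ| := by
  by_contra hh; push Not at hh
  exact absurd ((X.norm_le hc).2 hh) (not_le.2 h)

lemma X.nact (x : X L) (h : ¬ Act L γ) : x γ = 0 := by
  by_contra hc
  obtain ⟨N, hN⟩ := x.prop (|x γ| / 2) (by positivity)
  have := hN N le_rfl γ
  rw [Pr_nact h, sub_zero] at this
  have := abs_pos.2 hc
  linarith

def X.mk (f : ℕ → ℝ) (hb : ∃ c, ∀ γ, |f γ| ≤ c)
    (ht : ∀ ε > 0, ∃ N, ∀ n ≥ N, ∀ γ, |f γ - Pr L n f γ| ≤ ε) : X L :=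
  ⟨BoundedContinuousFunction.ofNormedAddCommGroup f (by fun_prop) hb.choose
    (fun γ => hb.choose_spec γ), ht⟩

@[simp] lemma X.mk_ap (f : ℕ → ℝ) (hb ht) (γ : ℕ) : (X.mk (L := L) f hb ht) γ = f γ := rfl

lemma Pr_bdd (n : ℕ) (f : ℕ → ℝ) : ∃ c, ∀ γ, |Pr L n f γ| ≤ c := by
  have h0 : ∀ γ < n, |f γ| ≤ ∑ η ∈ range n, |f η| := fun γ hγ =>
    Finset.single_le_sum (f := fun η => |f η|) (fun _ _ => abs_nonneg _) (by simpa using hγ)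
  exact ⟨_, Pr_bound (fun γ h _ => h0 γ h) (Finset.sum_nonneg fun _ _ => abs_nonneg _)⟩

/-- element of `X L` from coordinates below `n` -/
def ofPr (L : Set ℕ) (n : ℕ) (f : ℕ → ℝ) : X L :=
  X.mk (Pr L n f) (Pr_bdd n f) fun ε hε => ⟨n, fun m hm γ => by
    rw [Pr_Pr_ge hm]; simpa using hε.le⟩
@[simp] lemma ofPr_ap : ofPr L n f γ = Pr L n f γ := rfl
lemma ofPr_coe : (ofPr L n f : ℕ → ℝ) = Pr L n f := rfl

lemma ofPr_norm {c : ℝ} (hc : 0 ≤ c) (h : ∀ γ, γ < n → Act L γ → |f γ| ≤ c) : ‖ofPr L n f‖ ≤ 2 * c :=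
  (X.norm_le (by linarith)).2 fun γ => Pr_bound h hc γ

def PXl (L : Set ℕ) (n : ℕ) : X L →ₗ[ℝ] X L where
  toFun := fun x : X L => ofPr L n x
  map_add' := fun x y => X.ext' fun γ => by
    have := congrFun (Pr_lin (L := L) n 1 1 x y) γ
    simp only [one_mul] at this
    exact this
  map_smul' := fun c x => X.ext' fun γ => by
    have := congrFun (Pr_lin (L := L) n c 0 x x) γ
    simp only [zero_mul, add_zero] at this
    exact this

def PX (L : Set ℕ) (n : ℕ) : X L →L[ℝ] X L :=
  (PXl L n).mkContinuous 2 fun x => ofPr_norm (norm_nonneg _) fun γ _ _ => x.ap_le γ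

lemma PX_coe (x : X L) : (PX L n x : ℕ → ℝ) = Pr L n x := rfl
lemma PX_ap (x : X L) : PX L n x γ = Pr L n x γ := rfl
lemma PX_norm (x : X L) : ‖PX L n x‖ ≤ 2 * ‖x‖ :=
  ofPr_norm (norm_nonneg _) fun γ _ _ => x.ap_le γ

lemma PX_tend (x : X L) {ε : ℝ} (hε : 0 < ε) : ∃ N, ∀ n ≥ N, ‖x - PX L n x‖ ≤ ε := by
  obtain ⟨N, hN⟩ := x.prop ε hε
  exact ⟨N, fun n hn => (X.norm_le hε.le).2 (hN n hn)⟩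

lemma PX_PX_ge (h : n ≤ m) (x : X L) : PX L m (PX L n x) = PX L n x :=
  X.ext' fun γ => congrFun (Pr_Pr_ge h) γ
lemma PX_PX_le (h : m ≤ n) (x : X L) : PX L m (PX L n x) = PX L m x :=
  X.ext' fun γ => congrFun (Pr_Pr_le h) γ

lemma PX_eq_zero {x : X L} (h : ∀ γ < n, x γ = 0) : PX L n x = 0 :=
  X.ext' fun γ => by
    have := Pr_bound (L := L) (n := n) (u := x) (c := 0) (fun γ h1 _ => by rw [h γ h1]; simp) le_rfl γ
    rw [mul_zero, abs_nonpos_iff] at this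
    exact this
lemma PX_lt (x : X L) (h : γ < n) : PX L n x γ = x γ := by
  by_cases ha : Act L γ
  · exact Pr_lt ha h
  · rw [x.nact ha, X.nact _ ha]
lemma PX_eq_zero_iff {x : X L} : PX L n x = 0 ↔ ∀ γ < n, x γ = 0 :=
  ⟨fun h γ hγ => by rw [← PX_lt x hγ, h]; rfl, PX_eq_zero⟩

lemma XS_closed : IsClosed (XS L : Set (ℕ →ᵇ ℝ)) := by
  rw [← isSeqClosed_iff_isClosed]
  intro u x hu hx ε hε
  rw [Metric.tendsto_atTop] at hx
  obtain ⟨k, hk⟩ := hx (ε / 6) (by linarith)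
  have hk := hk k le_rfl
  obtain ⟨N, hN⟩ := hu k (ε / 2) (by linarith)
  refine ⟨N, fun n hn γ => ?_⟩
  have a0 : ∀ γ, |u k γ - x γ| ≤ ε / 6 := fun γ => by
    have := BoundedContinuousFunction.dist_coe_le_dist (f := u k) (g := x) γ
    rw [Real.dist_eq] at this; linarith
  have a1 := hN n hn γ
  have a2 := congrFun (Pr_lin (L := L) n 1 (-1) (u k) x) γ
  have a3 := Pr_bound (L := L) (n := n) (u := fun η => 1 * u k η + -1 * x η) (c := ε / 6)
    (fun γ _ _ => by have := a0 γ; convert this using 2; ring) (by linarith) γ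
  rw [a2] at a3
  have a4 := a0 γ
  rw [abs_le] at *; constructor <;> linarith [a1.1, a1.2, a3.1, a3.2, a4.1, a4.2]

instance : CompleteSpace (X L) := (XS_closed (L := L)).completeSpace_coe

lemma Blk.lift {s t : ℕ} {f : ℕ → ℝ} (h : Blk L s t f) : (ofPr L t f : ℕ → ℝ) = f := by
  rw [ofPr_coe, h.1]

lemma blk_of {s t : ℕ} {x : X L} (h1 : PX L t x = x) (h2 : PX L s x = 0) : Blk L s t x :=
  ⟨by rw [← PX_coe, h1], fun γ h => PX_eq_zero_iff.1 h2 γ h⟩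

/-! finite-dimensional pieces -/
def FF (L : Set ℕ) (n : ℕ) : Submodule ℝ (X L) where
  carrier := {x | PX L n x = x}
  zero_mem' := map_zero _
  add_mem' := fun {x y} hx hy => by
    exact (map_add _ x y).trans (congrArg₂ _ hx hy)
  smul_mem' := fun c x hx => by
    exact (map_smul _ c x).trans (congrArg _ hx)

lemma mem_FF {x : X L} : x ∈ FF L n ↔ PX L n x = x := by
  exact Iff.rfl

open Classical in
def FFe (L : Set ℕ) (n : ℕ) : ↥(FF L n) ≃ₗ[ℝ] ({γ : Fin n // Act L γ} → ℝ) where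
  toFun x γ := x.1 γ.1
  map_add' _ _ := rfl
  map_smul' _ _ := rfl
  invFun u := ⟨ofPr L n (fun γ => if h : ∃ h1 : γ < n, Act L γ then u ⟨⟨γ, h.1⟩, h.2⟩ else 0),
    mem_FF.2 (X.ext' fun γ => congrFun (Pr_Pr_ge le_rfl) γ)⟩
  left_inv x := by
    apply Subtype.ext
    have h := mem_FF.1 x.2
    refine Eq.trans (X.ext' fun γ => ?_) h
    refine congrFun (Pr_congr fun η h1 h2 => ?_) γ
    simp [h1, h2]
  right_inv u := by
    funext γ
    have : Pr L n (fun γ => if h : ∃ h1 : γ < n, Act L γ then u ⟨⟨γ, h.1⟩, h.2⟩ else 0) γ.1 = u γ := by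
      rw [Pr_lt γ.2 γ.1.2]
      simp [γ.2]
    exact this

instance : FiniteDimensional ℝ ↥(FF L n) := (FFe L n).symm.finiteDimensional

lemma FF_mono : Monotone (FF L) := fun n m h x hx => by
  rw [mem_FF] at *
  rw [← hx, PX_PX_ge h]

lemma FF_dense : Dense (⋃ n, (FF L n : Set (X L))) := by
  intro x
  rw [Metric.mem_closure_iff]
  intro ε hε
  obtain ⟨N, hN⟩ := PX_tend x (half_pos hε)
  refine ⟨PX L N x, Set.mem_iUnion.2 ⟨N, mem_FF.2 (PX_PX_ge le_rfl x)⟩, ?_⟩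
  rw [dist_eq_norm]; linarith [hN N le_rfl]

lemma X_sep : TopologicalSpace.SeparableSpace (X L) := by
  have h : TopologicalSpace.IsSeparable (⋃ n, (FF L n : Set (X L))) :=
    TopologicalSpace.IsSeparable.iUnion fun n => by
      have : TopologicalSpace.SeparableSpace ↥(FF L n) := inferInstance
      exact TopologicalSpace.IsSeparable.of_subtype _
  have := h.closure
  rw [FF_dense.closure_eq] at this
  exact TopologicalSpace.isSeparable_univ_iff.1 this

lemma X_linfty : IsLinftySpace (X L) := by
  classical
  refine ⟨2, by norm_num, FF L, FF_mono, fun n => inferInstance, FF_dense, fun n => ?_⟩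
  have hc : Fintype.card {γ : Fin n // Act L γ} = Module.finrank ℝ ↥(FF L n) := by
    rw [(FFe L n).finrank_eq]; simp
  let σ := Fintype.equivFinOfCardEq hc
  let T0 : ↥(FF L n) ≃ₗ[ℝ] (Fin (Module.finrank ℝ ↥(FF L n)) → ℝ) :=
    (FFe L n).trans (LinearEquiv.funCongrLeft ℝ ℝ σ.symm)
  refine ⟨T0.toContinuousLinearEquiv, ?_⟩
  have h1 : ‖(T0.toContinuousLinearEquiv : ↥(FF L n) →L[ℝ] (Fin (Module.finrank ℝ ↥(FF L n)) → ℝ))‖ ≤ 1 := by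
    refine ContinuousLinearMap.opNorm_le_bound _ (by norm_num) fun x => ?_
    rw [one_mul, pi_norm_le_iff_of_nonneg (norm_nonneg _)]
    exact fun k => x.1.ap_le _
  have h2 : ‖(T0.toContinuousLinearEquiv.symm : (Fin (Module.finrank ℝ ↥(FF L n)) → ℝ) →L[ℝ] ↥(FF L n))‖ ≤ 2 := by
    refine ContinuousLinearMap.opNorm_le_bound _ (by norm_num) fun u => ?_
    refine ofPr_norm (norm_nonneg _) fun γ h1 h2 => ?_
    simp only [h1, h2, exists_prop, and_self, dite_true]
    exact norm_le_pi_norm u _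
  calc _ ≤ 1 * (2 : ℝ) := mul_le_mul h1 h2 (ContinuousLinearMap.opNorm_nonneg _) (by norm_num)
    _ = 2 := by norm_num

lemma act_inf {i : ℕ} (hi : i ∈ L) (he : Even i) (N : ℕ) : ∃ γ ≥ N, Act L γ := by
  obtain ⟨γ, h1, h2⟩ := exists_nd (i, 1, 0, 0, 0, 0, 0) (N + i + 1)
  exact ⟨γ, by omega, act_of_nd h2 hi le_rfl (by have := nn_pos i; omega) (by simp) (by simp) (by simp)
    (by simp) (by simp) (fun h => absurd he (Nat.not_even_iff_odd.2 h)) (by omega)⟩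

lemma X_infdim {i : ℕ} (hi : i ∈ L) (he : Even i) : ¬ FiniteDimensional ℝ (X L) := by
  classical
  intro hfd
  have key : ∀ k, ∃ n, k ≤ Fintype.card {γ : Fin n // Act L γ} := by
    intro k
    induction k with
    | zero => exact ⟨0, Nat.zero_le _⟩
    | succ k ih =>
      obtain ⟨n, hn⟩ := ih
      obtain ⟨γ, h1, h2⟩ := act_inf hi he n
      refine ⟨γ + 1, Nat.succ_le_of_lt (lt_of_le_of_lt hn ?_)⟩
      refine Fintype.card_lt_of_injective_of_notMem
        (fun η : {γ : Fin n // Act L γ} => (⟨⟨η.1.1, by have := η.1.2; omega⟩, η.2⟩ : {η : Fin (γ+1) // Act L η})) (fun a b h => ?_)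
        (b := ⟨⟨γ, by omega⟩, h2⟩) ?_
      · simp only [Subtype.mk.injEq, Fin.mk.injEq] at h
        exact Subtype.ext (Fin.ext h)
      · rintro ⟨η, h⟩
        simp only [Subtype.mk.injEq, Fin.mk.injEq] at h
        have := η.1.2; omega
  obtain ⟨n, hn⟩ := key (Module.finrank ℝ (X L) + 1)
  have hc : Fintype.card {γ : Fin n // Act L γ} = Module.finrank ℝ ↥(FF L n) := by
    rw [(FFe L n).finrank_eq]; simp
  have := Submodule.finrank_le (FF L n)
  omega
end AH

namespace AH
open Finset
variable {L M : Set ℕ} {γ n m : ℕ} {u v : ℕ → ℝ}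

lemma Act.mono (hLM : L ⊆ M) (h : Act L γ) : Act M γ := by
  induction h with
  | mk n a1 a2 a3 a4 a5 a6 a7 a8 a9 a10 a11 a12 a13 a14 a15 a16 b1 b2 b3 =>
    exact Act.mk n (hLM a1) a2 a3 a4 a5 a6 a7 a8 b1 a10 a11 b2 a13 b3 a15 a16

lemma Pr_restrict (hLM : L ⊆ M) (huv : ∀ γ, γ < n → Act L γ → u γ = v γ) :
    Act L γ → Pr L n u γ = Pr M n v γ := by
  suffices H : ∀ γ, ∀ n, (∀ γ, γ < n → Act L γ → u γ = v γ) → Act L γ → Pr L n u γ = Pr M n v γ from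
    H γ n huv
  intro γ
  induction γ using Nat.strong_induction_on with
  | _ γ ih =>
    intro n huv h
    have h' := h.mono hLM
    by_cases hn : γ < n
    · rw [Pr_lt h hn, Pr_lt h' hn, huv γ hn h]
    · push Not at hn
      rw [Pr_ge h hn, Pr_ge h' hn]
      congr 1
      · exact pv_congr h fun η hη _ ha => ih η hη n huv ha
      · split_ifs with hp
        · rfl
        · congr 1
          refine bb_congr h fun η _ hη ha => ?_
          rw [ih η hη n huv ha, ih η hη _ (fun γ' h' => huv γ' (by omega)) ha]

open Classical in
def rst (L : Set ℕ) (f : ℕ → ℝ) : ℕ → ℝ := fun γ => if Act L γ then f γ else 0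

lemma Pr_rst (γ : ℕ) : Pr L n (rst L u) γ = rst L (Pr Set.univ n u) γ := by
  by_cases h : Act L γ
  · rw [Pr_restrict (Set.subset_univ L) (v := u) (fun γ _ h => by simp [rst, h]) h]
    simp [rst, h]
  · rw [Pr_nact h]; simp [rst, h]

lemma rst_le (γ : ℕ) : |rst L u γ| ≤ |u γ| := by
  unfold rst; split_ifs <;> simp

def QXl (L : Set ℕ) : X Set.univ →ₗ[ℝ] X L where
  toFun := fun x => X.mk (rst L x) ⟨‖x‖, fun γ => (rst_le γ).trans (x.ap_le γ)⟩ fun ε hε => by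
    obtain ⟨N, hN⟩ := x.prop ε hε
    refine ⟨N, fun n hn γ => le_trans ?_ (hN n hn γ)⟩
    rw [Pr_rst]; unfold rst; split_ifs <;> simp
  map_add' := fun x y => X.ext' fun γ => by
    rw [X.mk_ap, X.add_ap, X.mk_ap, X.mk_ap]; unfold rst; split_ifs <;> simp
  map_smul' := fun c x => X.ext' fun γ => by
    rw [X.mk_ap, RingHom.id_apply, X.smul_ap, X.mk_ap]; unfold rst; split_ifs <;> simp

lemma QXl_ap (x : X Set.univ) : QXl L x γ = rst L x γ := rfl

def QX (L : Set ℕ) : X Set.univ →L[ℝ] X L :=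
  (QXl L).mkContinuous 1 fun x => by
    rw [one_mul, X.norm_le (norm_nonneg _)]
    exact fun γ => (rst_le γ).trans (x.ap_le γ)

lemma QX_surj (L : Set ℕ) : Function.Surjective (QX L) := by
  let f : NormedAddGroupHom (X Set.univ) (X L) := AddMonoidHom.mkNormedAddGroupHom (QXl L).toAddMonoidHom 1 fun x => by
    rw [one_mul, X.norm_le (norm_nonneg _)]
    exact fun γ => (rst_le γ).trans (x.ap_le γ)
  let K : AddSubgroup (X L) :=
    { carrier := ⋃ n, (FF L n : Set (X L))
      zero_mem' := Set.mem_iUnion.2 ⟨0, zero_mem _⟩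
      add_mem' := fun {x y} hx hy => by
        obtain ⟨n, hn⟩ := Set.mem_iUnion.1 hx
        obtain ⟨m, hm⟩ := Set.mem_iUnion.1 hy
        exact Set.mem_iUnion.2 ⟨max n m, add_mem (FF_mono (le_max_left n m) hn) (FF_mono (le_max_right n m) hm)⟩
      neg_mem' := fun {x} hx => by
        obtain ⟨n, hn⟩ := Set.mem_iUnion.1 hx
        exact Set.mem_iUnion.2 ⟨n, neg_mem hn⟩ }
  have hK : f.SurjectiveOnWith K 2 := by
    intro y hy
    obtain ⟨n, hn⟩ := Set.mem_iUnion.1 hy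
    refine ⟨ofPr Set.univ n y, X.ext' fun γ => ?_, ofPr_norm (norm_nonneg _) fun γ _ _ => y.ap_le γ⟩
    have e : PX L n y = y := mem_FF.1 hn
    show rst L (Pr Set.univ n y) γ = y γ
    rw [← Pr_rst]
    conv_rhs => rw [← e]
    refine congrFun (Pr_congr fun η _ ha => ?_) γ
    simp [rst, ha]
  have hh := controlled_closure_of_complete (f := f) (K := K) (C := 2) (ε := 1) (by norm_num) (by norm_num) hK
  intro y
  obtain ⟨x, hx, -⟩ := hh y (FF_dense y)
  exact ⟨x, hx⟩
end AH

namespace AH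
open Finset
variable {L : Set ℕ} {γ n m : ℕ} {u v : ℕ → ℝ}

lemma sel {α : Type*} (P : ℕ → ℕ → ℕ → α → Prop) (h : ∀ k n, ∃ t x, n ≤ t ∧ P k n t x) :
    ∃ s t : ℕ → ℕ, ∃ x : ℕ → α, (∀ k, P k (s k) (t k) (x k)) ∧ (∀ k, k ≤ s k) ∧ (∀ k, s k ≤ t k) ∧
      ∀ k l, k < l → t k < s l := by
  choose T A hT hP using h
  let s : ℕ → ℕ := fun k => Nat.rec 0 (fun k n => T k n + 1) k
  have hs : ∀ k, s (k + 1) = T k (s k) + 1 := fun k => rfl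
  have hlt : ∀ k, s k < s (k + 1) := fun k => by rw [hs]; have := hT k (s k); omega
  have hm : StrictMono s := strictMono_nat_of_lt_succ hlt
  refine ⟨s, fun k => T k (s k), fun k => A k (s k), fun k => hP _ _, fun k => hm.le_apply, fun k => hT _ _,
    fun k l hkl => ?_⟩
  have : s (k + 1) ≤ s l := hm.monotone hkl
  rw [hs] at this; exact this

lemma IRIS.of {C : ℝ} {x : ℕ → ℕ → ℝ} {s t : ℕ → ℕ} (hC : 1 ≤ C) (blk : ∀ k, Blk L (s k) (t k) (x k))
    (ks : ∀ k, k ≤ s k) (st : ∀ k, s k ≤ t k) (ts : ∀ k l, k < l → t k < s l)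
    (nm : ∀ k γ, |x k γ| ≤ C) (lo : ∀ k γ, Act L γ → W γ < s k → |x k γ| ≤ C / mm (W γ)) :
    IRIS L C x s t s :=
  ⟨fun N => ⟨⟨fun k _ => blk k, fun k _ => st k, fun k l h _ => (ts k l h).le⟩,
    fun k l h _ => ⟨ts k l h, (st k).trans_lt (ts k l h)⟩, fun k _ => nm k, fun k _ => lo k⟩, ks, hC⟩

lemma wt_zero {i t : ℕ} {c : ℝ} (hc : 0 ≤ c) (hu : ∀ γ < t, Act L γ → |u γ| ≤ c)
    (h0 : ∀ γ < t, Act L γ → W γ = i → u γ = 0) (ha : Act L γ) (hi : W γ = i) :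
    |Pr L t u γ| ≤ 4 * c / mm i := by
  have hm := mm_pos i
  induction γ using Nat.strong_induction_on with
  | _ γ ih =>
    by_cases hn : γ < t
    · rw [Pr_lt ha hn, h0 γ hn ha hi, abs_zero]; positivity
    · push Not at hn
      rw [Pr_ge ha hn]
      by_cases hp : t ≤ Pp γ
      · rw [if_pos hp, add_zero]
        unfold pv
        split_ifs with h1
        · rw [abs_zero]; positivity
        · obtain ⟨b1, b2, b3, b4⟩ := ha.pp h1
          exact ih _ b2 b1 (b3.trans hi)
      · have e : pv γ (Pr L t u) = 0 := by
          unfold pv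
          split_ifs with h1
          · rfl
          · obtain ⟨b1, b2, b3, b4⟩ := ha.pp h1
            rw [Pr_lt b1 (by omega)]; exact h0 _ (by omega) b1 (b3.trans hi)
        rw [if_neg hp, e, zero_add, abs_mul, abs_of_pos (inv_pos.2 (mm_pos _)), hi, div_eq_inv_mul]
        gcongr
        refine bb_bound ha (by linarith) fun η _ _ _ => ?_
        have g1 := Pr_bound (L := L) (n := t) hu hc η
        have g2 := Pr_bound (L := L) (n := Pp γ) (u := u) (c := c) (fun γ h1 h2 => hu γ (by omega) h2) hc η
        rw [abs_le] at *; constructor <;> linarith [g1.1, g1.2, g2.1, g2.2]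

lemma ofPr_blk {s t : ℕ} (h : ∀ γ < s, u γ = 0) (hst : s ≤ t) : Blk L s t (ofPr L t u) :=
  ⟨Pr_Pr_ge le_rfl, fun γ hγ => by
    by_cases ha : Act L γ
    · exact (Pr_lt ha (by omega)).trans (h γ hγ)
    · exact Pr_nact ha⟩

def vp (L : Set ℕ) (N t : ℕ) (x : ℕ → ℝ) : X L := ofPr L t fun γ => if W γ ≤ N then x γ else 0
def wp (L : Set ℕ) (N t : ℕ) (x : ℕ → ℝ) : X L := ofPr L t fun γ => if W γ ≤ N then 0 else x γ

lemma vw {s t N : ℕ} {x : X L} (hx : Blk L s t x) : x = vp L N t x + wp L N t x :=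
  X.ext' fun γ => by
    have h := congrFun (Pr_lin (L := L) t 1 1 (fun γ => if W γ ≤ N then x γ else 0)
      (fun γ => if W γ ≤ N then 0 else x γ)) γ
    have e : (fun η => 1 * (if W η ≤ N then x η else 0) + 1 * (if W η ≤ N then 0 else x η)) = x := by
      funext η; split_ifs <;> simp
    rw [e, hx.1] at h
    rw [X.add_ap, h]; simp [vp, wp]

section
variable {s t N : ℕ} {x : ℕ → ℝ} {c : ℝ}
lemma vp_blk (h : ∀ γ < s, x γ = 0) (hst : s ≤ t) : Blk L s t (vp L N t x) :=
  ofPr_blk (fun γ hγ => by simp [h γ hγ]) hst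
lemma wp_blk (h : ∀ γ < s, x γ = 0) (hst : s ≤ t) : Blk L s t (wp L N t x) :=
  ofPr_blk (fun γ hγ => by simp [h γ hγ]) hst
lemma vp_bd (hc : 0 ≤ c) (h : ∀ γ, |x γ| ≤ c) (γ : ℕ) : |vp L N t x γ| ≤ 2 * c :=
  Pr_bound (fun γ _ _ => by split_ifs <;> simp [h, hc]) hc γ
lemma wp_bd (hc : 0 ≤ c) (h : ∀ γ, |x γ| ≤ c) (γ : ℕ) : |wp L N t x γ| ≤ 2 * c :=
  Pr_bound (fun γ _ _ => by split_ifs <;> simp [h, hc]) hc γ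
lemma vp_lo (hc : 0 ≤ c) (h : ∀ γ, |x γ| ≤ c) (ha : Act L γ) : |vp L N t x γ| ≤ 4 * c * mm N / mm (W γ) := by
  have hm := mm_ge N
  have hm0 := mm_pos (W γ)
  rcases Nat.lt_or_ge N (W γ) with h1 | h1
  · refine (wt_zero (i := W γ) hc (fun γ _ _ => by split_ifs <;> simp [h, hc])
      (fun η _ _ h2 => if_neg (by omega)) ha rfl).trans ?_
    exact div_le_div_of_nonneg_right (by nlinarith) hm0.le
  · refine (vp_bd hc h γ).trans ?_
    rw [le_div_iff₀ hm0]
    have := mm_mono.monotone h1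
    nlinarith
lemma wp_lo (hc : 0 ≤ c) (h : ∀ γ, |x γ| ≤ c) (ha : Act L γ) (hN : W γ ≤ N) :
    |wp L N t x γ| ≤ 4 * c / mm (W γ) :=
  wt_zero (i := W γ) hc (fun γ _ _ => by split_ifs <;> simp [h, hc])
      (fun η _ _ h2 => if_pos (by omega)) ha rfl
end

variable {E : Type*} [NormedAddCommGroup E] [NormedSpace ℝ E]

def NullRIS (T : X L →L[ℝ] E) : Prop := ∀ (C : ℝ) (x : ℕ → X L) (s t j : ℕ → ℕ),
  IRIS L C (fun k => x k) s t j → ∀ δ > 0, ∃ k, ‖T (x k)‖ < δ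

lemma tail {T : X L →L[ℝ] E} (hT : NullRIS T) {δ : ℝ} (hδ : 0 < δ) :
    ∃ n, ∀ x, PX L n x = 0 → ‖T x‖ ≤ δ * ‖x‖ := by
  by_contra hcon
  push Not at hcon
  have H0 : ∀ n, ∃ t, ∃ x : X L, n ≤ t ∧ Blk L n t x ∧ ‖x‖ ≤ 2 ∧ δ / 2 ≤ ‖T x‖ := by
    intro n
    obtain ⟨x, h1, h2⟩ := hcon n
    have hx0 : x ≠ 0 := by rintro rfl; simp at h2
    have hx : 0 < ‖x‖ := norm_pos_iff.2 hx0
    obtain ⟨N, hN⟩ := PX_tend x (ε := δ * ‖x‖ / 2 / (‖T‖ + 1)) (by positivity)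
    have hN := hN (max n N) (le_max_right _ _)
    have e1 : ‖T x - T (PX L (max n N) x)‖ ≤ δ * ‖x‖ / 2 := by
      rw [← map_sub]
      refine (T.le_opNorm _).trans ?_
      calc ‖T‖ * ‖x - PX L (max n N) x‖ ≤ (‖T‖ + 1) * (δ * ‖x‖ / 2 / (‖T‖ + 1)) := by gcongr; linarith
        _ = _ := by field_simp
    refine ⟨max n N, ‖x‖⁻¹ • PX L (max n N) x, le_max_left _ _, blk_of ?_ ?_, ?_, ?_⟩
    · rw [map_smul, PX_PX_ge le_rfl]
    · rw [map_smul, PX_PX_le (le_max_left _ _), h1, smul_zero]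
    · rw [norm_smul, norm_inv, norm_norm, inv_mul_le_iff₀ hx]
      linarith [PX_norm (L := L) (n := max n N) x]
    · rw [map_smul, norm_smul, norm_inv, norm_norm, le_inv_mul_iff₀ hx]
      have := norm_sub_norm_le (T x) (T (PX L (max n N) x))
      nlinarith
  have bd : ∀ x : X L, ‖x‖ ≤ 2 → ∀ γ, |x γ| ≤ 2 := fun x h γ => (x.ap_le γ).trans h
  have H1 : ∀ N n, ∃ t, ∃ x : X L, n ≤ t ∧ Blk L n t x ∧ ‖x‖ ≤ 2 ∧ δ / 2 ≤ ‖T x‖ ∧ ‖T (vp L N t x)‖ < δ / 4 := by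
    intro N n0
    by_contra hc
    push Not at hc
    obtain ⟨s, t, x, hP, ks, st, ts⟩ := sel (fun _ n t (x : X L) => Blk L n t x ∧ ‖x‖ ≤ 2 ∧ δ / 4 ≤ ‖T (vp L N t x)‖)
      (fun _ n => by
        obtain ⟨t, x, h1, h2, h3, h4⟩ := H0 (max n n0)
        exact ⟨t, x, (le_max_left _ _).trans h1, h2.mono (le_max_left _ _) le_rfl, h3,
          hc t x ((le_max_right _ _).trans h1) (h2.mono (le_max_right _ _) le_rfl) h3 h4⟩)
    have hm := mm_ge N
    have hI : IRIS L (8 * mm N) (fun k => vp L N (t k) (x k)) s t s := by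
      refine IRIS.of (by linarith) (fun k => vp_blk (hP k).1.2 (st k)) ks st ts (fun k γ => ?_) (fun k γ ha _ => ?_)
      · have := vp_bd (L := L) (N := N) (t := t k) (by norm_num) (bd _ (hP k).2.1) γ
        linarith
      · have := vp_lo (L := L) (N := N) (t := t k) (by norm_num) (bd _ (hP k).2.1) ha
        refine this.trans (le_of_eq (by ring))
    obtain ⟨k, hk⟩ := hT _ (fun k => vp L N (t k) (x k)) s t s hI (δ / 4) (by linarith)
    linarith [(hP k).2.2]
  obtain ⟨s, t, x, hP, ks, st, ts⟩ := sel (fun _ n t (x : X L) => Blk L n t x ∧ ‖x‖ ≤ 2 ∧ δ / 4 ≤ ‖T (wp L n t x)‖)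
    (fun _ n => by
      obtain ⟨t, x, h1, h2, h3, h4, h5⟩ := H1 n n
      refine ⟨t, x, h1, h2, h3, ?_⟩
      have e := vw (N := n) h2
      have : T x = T (vp L n t x) + T (wp L n t x) := by rw [← map_add, ← e]
      have h6 := norm_add_le (T (vp L n t x)) (T (wp L n t x))
      rw [← this] at h6
      linarith)
  have hI : IRIS L 8 (fun k => wp L (s k) (t k) (x k)) s t s := by
    refine IRIS.of (by norm_num) (fun k => wp_blk (hP k).1.2 (st k)) ks st ts (fun k γ => ?_) (fun k γ ha hw => ?_)
    · have := wp_bd (L := L) (N := s k) (t := t k) (by norm_num) (bd _ (hP k).2.1) γ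
      linarith
    · have := wp_lo (L := L) (N := s k) (t := t k) (by norm_num) (bd _ (hP k).2.1) ha hw.le
      refine this.trans (le_of_eq (by ring))
  obtain ⟨k, hk⟩ := hT _ (fun k => wp L (s k) (t k) (x k)) s t s hI (δ / 4) (by linarith)
  linarith [(hP k).2.2]

lemma tail' {T : X L →L[ℝ] E} (hT : NullRIS T) {δ : ℝ} (hδ : 0 < δ) :
    ∃ N, ∀ n ≥ N, ∀ x, ‖T x - T (PX L n x)‖ ≤ δ * ‖x‖ := by
  obtain ⟨N, h⟩ := tail hT (δ := δ / 3) (by linarith)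
  refine ⟨N, fun n hn x => ?_⟩
  have h1 := h (x - PX L n x) (by rw [map_sub, PX_PX_le hn, sub_self])
  rw [map_sub] at h1
  have h2 := norm_sub_le x (PX L n x)
  have h3 := PX_norm (L := L) (n := n) x
  refine h1.trans ?_
  nlinarith

lemma compact_of_null [CompleteSpace E] {T : X L →L[ℝ] E} (hT : NullRIS T) : IsCompactOperator T := by
  have hfin : ∀ n, IsCompactOperator (T.comp (PX L n)) := by
    intro n
    let p : X L →L[ℝ] ↥(FF L n) := (PX L n).codRestrict (FF L n) fun x => mem_FF.2 (PX_PX_ge le_rfl x)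
    have : IsCompactOperator (((T.comp (FF L n).subtypeL)).comp p) :=
      (isCompactOperator_of_locallyCompactSpace_rng (T.comp (FF L n).subtypeL)).comp_clm p
    exact this
  refine isCompactOperator_of_tendsto (l := Filter.atTop) (F := fun n : ℕ => T.comp (PX L n)) ?_ (Filter.Eventually.of_forall hfin)
  rw [Metric.tendsto_atTop]
  intro ε hε
  obtain ⟨N, hN⟩ := tail' hT (half_pos hε)
  refine ⟨N, fun n hn => ?_⟩
  rw [dist_comm, dist_eq_norm]
  refine lt_of_le_of_lt (ContinuousLinearMap.opNorm_le_bound _ (half_pos hε).le fun x => ?_) (half_lt_self hε)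
  exact hN n hn x
end AH

namespace AH
open Finset
variable {L L' : Set ℕ} {γ n m p : ℕ} {C : ℝ} {x : ℕ → X L} {s t j : ℕ → ℕ}

lemma Blk.PX_ge {s t : ℕ} {x : X L} (h : Blk L s t x) (hp : t ≤ p) : PX L p x = x :=
  X.ext' fun γ => congrFun (h.Pr_ge' hp) γ
lemma Blk.PX_le {s t : ℕ} {x : X L} (h : Blk L s t x) (hp : p ≤ s) : PX L p x = 0 :=
  X.ext' fun γ => congrFun (h.Pr_le hp) γ

lemma IRIS.norm (h : IRIS L C (fun k => x k) s t j) (k : ℕ) : ‖x k‖ ≤ C :=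
  (X.norm_le (by linarith [h.C1])).2 fun γ => h.nm k γ

variable {E F : Type*} [NormedAddCommGroup E] [NormedSpace ℝ E] [NormedAddCommGroup F] [NormedSpace ℝ F]

def DomX (K : ℝ) (x : ℕ → E) (g : ℕ → F) : Prop :=
  ∀ (I : Finset ℕ) (a : ℕ → ℝ), ‖∑ k ∈ I, a k • g k‖ ≤ K * ‖∑ k ∈ I, a k • x k‖

lemma DomX.sub {K : ℝ} {x : ℕ → E} {g : ℕ → F} (h : DomX K x g) {κ : ℕ → ℕ} (hκ : StrictMono κ) :
    DomX K (fun k => x (κ k)) (fun k => g (κ k)) := by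
  intro I a
  have := h (I.map ⟨κ, hκ.injective⟩) (fun l => a (Function.invFun κ l))
  simp only [sum_map, Function.Embedding.coeFn_mk, Function.leftInverse_invFun hκ.injective _] at this
  exact this

lemma DomX.clm (T : E →L[ℝ] F) (x : ℕ → E) : DomX ‖T‖ x (fun k => T (x k)) := by
  intro I a
  have := T.le_opNorm (∑ k ∈ I, a k • x k)
  simpa [map_sum] using this

lemma DomX.mono {K K' : ℝ} {x : ℕ → E} {g : ℕ → F} (h : DomX K x g) (hK : K ≤ K') : DomX K' x g :=
  fun I a => (h I a).trans (by gcongr)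

lemma DomX.trans {G : Type*} [NormedAddCommGroup G] [NormedSpace ℝ G] {K K' : ℝ} {x : ℕ → E} {g : ℕ → F} {w : ℕ → G} (h : DomX K x g) (h' : DomX K' g w)
    (hK : 0 ≤ K') : DomX (K' * K) x w :=
  fun I a => (h' I a).trans (by rw [mul_assoc]; have := h I a; gcongr)

lemma DomX.toDom {K : ℝ} {g : ℕ → X L'} (h : DomX K x g) (hK : 0 ≤ K) :
    Dom K (fun k => x k) (fun k => g k) := by
  intro p hp B hB γ
  obtain ⟨c, hc⟩ := Finsupp.mem_span_range_iff_exists_finsupp.1 hp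
  have e1 : ∀ γ, p.1 γ = (∑ k ∈ c.support, c k • x k) γ := fun γ => by
    rw [← hc, Finsupp.sum, X.sum_ap, Prod.fst_sum, Finset.sum_apply]; rfl
  have e2 : ∀ γ, p.2 γ = (∑ k ∈ c.support, c k • g k) γ := fun γ => by
    rw [← hc, Finsupp.sum, X.sum_ap, Prod.snd_sum, Finset.sum_apply]; rfl
  rw [e2]
  refine (X.ap_le _ _).trans ((h _ _).trans ?_)
  have hB0 : 0 ≤ B := (abs_nonneg _).trans (hB 0)
  have : ‖∑ k ∈ c.support, c k • x k‖ ≤ B := (X.norm_le hB0).2 fun γ => by rw [← e1]; exact hB γ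
  gcongr

lemma half_sum (I : Finset ℕ) : ∑ k ∈ I, (1 / 2 : ℝ) ^ (k + 1) ≤ 1 := by
  have h : Summable fun k : ℕ => (1 / 2 : ℝ) ^ (k + 1) := by
    simp_rw [pow_succ]; exact summable_geometric_two.mul_right _
  refine (h.sum_le_tsum I fun k _ => by positivity).trans ?_
  simp_rw [pow_succ]; rw [tsum_mul_right, tsum_geometric_two]; norm_num

lemma IRIS.coef (h : IRIS L C (fun k => x k) s t j) {c : ℝ} (hc : 0 < c) (hx : ∀ k, c ≤ ‖x k‖) (I : Finset ℕ)
    (a : ℕ → ℝ) {k : ℕ} (hk : k ∈ I) : |a k| ≤ 4 / c * ‖∑ k ∈ I, a k • x k‖ := by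
  set z := ∑ k ∈ I, a k • x k with hz
  have e : PX L (t k) z - PX L (s k) z = a k • x k := by
    rw [hz, map_sum, map_sum, ← sum_sub_distrib, sum_eq_single_of_mem k hk]
    · rw [map_smul, map_smul, (h.blk k).PX_ge le_rfl, (h.blk k).PX_le le_rfl, smul_zero, sub_zero]
    · intro l _ hl
      rw [map_smul, map_smul]
      rcases lt_or_gt_of_ne hl with h1 | h1
      · have := h.ts h1
        rw [(h.blk l).PX_ge (this.trans (h.st k)), (h.blk l).PX_ge this, sub_self]
      · have := h.ts h1
        rw [(h.blk l).PX_le this, (h.blk l).PX_le ((h.st k).trans this), sub_self]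
  have h1 := norm_sub_le (PX L (t k) z) (PX L (s k) z)
  rw [e, norm_smul, Real.norm_eq_abs] at h1
  have h2 := PX_norm (n := t k) z
  have h3 := PX_norm (n := s k) z
  rw [div_mul_eq_mul_div, le_div_iff₀ hc]
  have := mul_le_mul_of_nonneg_left (hx k) (abs_nonneg (a k))
  linarith

lemma IRIS.pert (h : IRIS L C (fun k => x k) s t j) {c : ℝ} (hc : 0 < c) (hx : ∀ k, c ≤ ‖x k‖) {K : ℝ} {g g' : ℕ → E}
    (hD : DomX K x g) (hg : ∀ k, ‖g' k - g k‖ ≤ (1 / 2) ^ (k + 1)) : DomX (K + 4 / c) x g' := by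
  intro I a
  have e : ∑ k ∈ I, a k • g' k = ∑ k ∈ I, a k • g k + ∑ k ∈ I, a k • (g' k - g k) := by
    rw [← sum_add_distrib]; congr; funext k; rw [← smul_add]; congr 1; abel
  rw [e, add_mul]
  refine (norm_add_le _ _).trans (add_le_add (hD I a) ?_)
  refine (norm_sum_le _ _).trans ?_
  calc ∑ k ∈ I, ‖a k • (g' k - g k)‖ ≤ ∑ k ∈ I, (4 / c * ‖∑ k ∈ I, a k • x k‖) * (1 / 2) ^ (k + 1) := by
        refine sum_le_sum fun k hk => ?_
        rw [norm_smul]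
        exact mul_le_mul (h.coef hc hx I a hk) (hg k) (norm_nonneg _) (by positivity)
    _ = (4 / c * ‖∑ k ∈ I, a k • x k‖) * ∑ k ∈ I, (1 / 2) ^ (k + 1) := by rw [mul_sum]
    _ ≤ (4 / c * ‖∑ k ∈ I, a k • x k‖) * 1 := by gcongr; exact half_sum I
    _ = _ := mul_one _

def Null (g : ℕ → X L) : Prop := ∀ γ, ∀ ε > 0, ∃ N, ∀ k ≥ N, |g k γ| ≤ ε

lemma Null.PX {g : ℕ → X L} (h : Null g) (n : ℕ) {ε : ℝ} (hε : 0 < ε) : ∃ N, ∀ k ≥ N, ‖PX L n (g k)‖ ≤ ε := by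
  choose N hN using fun γ => h γ (ε / 2) (by linarith)
  refine ⟨∑ γ ∈ range n, N γ, fun k hk => ?_⟩
  have := ofPr_norm (L := L) (n := n) (f := g k) (c := ε / 2) (by linarith) fun γ h1 _ =>
    hN γ k ((single_le_sum (f := N) (fun _ _ => Nat.zero_le _) (mem_range.2 h1)).trans hk)
  exact this.trans (by linarith)

lemma IRIS.kj (h : IRIS L C (fun k => x k) s t j) (k : ℕ) : k ≤ j k :=
  StrictMono.le_apply (fun _ _ h1 => (h.jj h1).2)

lemma glide (h : IRIS L C (fun k => x k) s t j) {c : ℝ} (hc : 0 < c) (hx : ∀ k, c ≤ ‖x k‖) {g : ℕ → X L'}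
    (hg : Null g) {K : ℝ} (hD : DomX K x g) {ε : ℝ} (hε : 0 < ε) :
    ∃ κ s' t' : ℕ → ℕ, ∃ y : ℕ → X L', StrictMono κ ∧ IRIS L C (fun k => x (κ k)) s' t' (fun k => j (κ k)) ∧
      (∀ k, Blk L' (s' k) (t' k) (y k)) ∧ DomX (K + 4 / c) (fun k => x (κ k)) y ∧ ∀ k, ‖y k - g (κ k)‖ ≤ ε := by
  obtain ⟨s', t', κ, hP, ks, st, ts⟩ := sel (fun k n T (q : ℕ) => n ≤ q ∧ t q ≤ T ∧
      ‖PX L' T (g q) - PX L' n (g q) - g q‖ ≤ min ε ((1 / 2) ^ (k + 1))) (fun k n => by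
    have hm : 0 < min ε ((1 / 2) ^ (k + 1)) := by positivity
    obtain ⟨N, hN⟩ := hg.PX n (half_pos hm)
    obtain ⟨N2, hN2⟩ := PX_tend (g (max n N)) (half_pos hm)
    refine ⟨max n (max N2 (t (max n N))), max n N, le_max_left _ _, le_max_left _ _, by simp, ?_⟩
    have h1 := hN (max n N) (le_max_right _ _)
    have h2 := hN2 (max n (max N2 (t (max n N)))) (by simp)
    rw [show ∀ a b c : X L', a - b - c = -(c - a) - b from fun a b c => by abel]
    refine (norm_sub_le _ _).trans ?_
    rw [norm_neg]; linarith)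
  have hκ : ∀ k l, k < l → κ k < κ l := fun k l hkl => by
    have := ts k l hkl
    have := (hP k).2.1
    have := (hP l).1
    have := h.st (κ k)
    have := h.ks (κ k)
    omega
  have hm : StrictMono κ := fun k l => hκ k l
  have hI : IRIS L C (fun k => x (κ k)) s' t' (fun k => j (κ k)) :=
    ⟨fun N => ⟨⟨fun k _ => (h.blk (κ k)).mono ((hP k).1.trans (h.ks _)) (hP k).2.1, fun k _ => st k,
      fun k l hkl _ => (ts k l hkl).le⟩, fun k l hkl _ => ⟨?_, (h.jj (hm hkl)).2⟩, fun k _ => h.nm _,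
      fun k _ γ ha hw => h.lo _ ha hw⟩, ks, h.C1⟩
  · refine ⟨κ, s', t', fun k => PX L' (t' k) (g (κ k)) - PX L' (s' k) (g (κ k)), hm, hI, fun k => blk_of ?_ ?_,
      hI.pert hc (fun k => hx _) (hD.sub hm) fun k => (hP k).2.2.trans (min_le_right _ _),
      fun k => (hP k).2.2.trans (min_le_left _ _)⟩
    · rw [map_sub, PX_PX_ge le_rfl, PX_PX_ge (st k)]
    · rw [map_sub, PX_PX_le (st k), PX_PX_le le_rfl, sub_self]
  · have := ts k l hkl
    have := (hP l).1
    have := h.kj (κ l)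
    omega

lemma low_x {K δ : ℝ} {x : ℕ → E} {g : ℕ → F} (hD : DomX K x g) (hK : 0 < K) (hb : ∀ k, δ ≤ ‖g k‖) (k : ℕ) : δ / K ≤ ‖x k‖ := by
  have := hD {k} (fun _ => 1)
  simp only [sum_singleton, one_smul] at this
  rw [div_le_iff₀ hK]; linarith [hb k]

lemma X.exists_ge {x : X L} {δ : ℝ} (hδ : 0 < δ) (h : δ ≤ ‖x‖) : ∃ γ, δ / 2 ≤ |x γ| := by
  obtain ⟨γ, h⟩ := X.exists_big (x := x) (c := δ / 2) (by linarith) (by linarith)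
  exact ⟨γ, h.le⟩

lemma cross_false (h : IRIS L C (fun k => x k) s t j) {g : ℕ → X L'} (hg : Null g) {K δ : ℝ} (hD : DomX K x g) (hδ : 0 < δ)
    (hb : ∀ k, δ ≤ ‖g k‖) (hL : ∀ M, ∃ i ≥ M, i ∈ L' ∧ i ∉ L ∧ Even i) : False := by
  have hD := hD.mono (le_max_left K 1)
  have hK : 0 < max K 1 := by positivity
  have hc : 0 < δ / max K 1 := by positivity
  obtain ⟨κ, s', t', y, -, hI, hy, hDy, hyg⟩ := glide h hc (low_x hD hK hb) hg hD (half_pos hδ)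
  refine op_cross hI hy (δ := δ / 4) (by linarith) (hDy.toDom (by positivity)) (fun k => ?_) hL
  have := X.exists_ge (x := y k) (δ := δ / 2) (by linarith) (by
    have h1 := norm_sub_norm_le (g (κ k)) (y k)
    rw [norm_sub_rev] at h1
    linarith [hb (κ k), hyg k])
  simpa [div_div, show (2 : ℝ) * 2 = 4 by norm_num] using this

lemma same_false (hL : Good L) (h : IRIS L C (fun k => x k) s t j) {g : ℕ → X L} (hg : Null g) {K δ : ℝ} (hD : DomX K x g) (hδ : 0 < δ)
    (hb : ∀ k (l : ℝ), δ ≤ ‖g k - l • x k‖) : False := by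
  have hD := hD.mono (le_max_left K 1)
  have hK : 0 < max K 1 := by positivity
  have hc : 0 < δ / max K 1 := by positivity
  obtain ⟨κ, s', t', y, -, hI, hy, hDy, hyg⟩ := glide h hc (low_x hD hK fun k => by simpa using hb k 0) hg hD (half_pos hδ)
  refine op_same hL hI hy (δ := δ / 4) (by linarith) (fun k l => ?_) (hDy.toDom (by positivity))
  have := X.exists_ge (x := y k - l • x (κ k)) (δ := δ / 2) (by linarith) (by
    have h1 := norm_sub_norm_le (g (κ k) - l • x (κ k)) (y k - l • x (κ k))
    rw [sub_sub_sub_cancel_right, norm_sub_rev (g (κ k)) (y k)] at h1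
    linarith [hb (κ k) l, hyg k])
  simpa [div_div, show (2 : ℝ) * 2 = 4 by norm_num] using this

/-! functionals -/
lemma IRIS.smul (h : IRIS L C (fun k => x k) s t j) {a : ℕ → ℝ} (ha : ∀ k, |a k| ≤ 1) :
    IRIS L C (fun k => a k • x k) s t j := by
  have b : ∀ k γ, |a k * x k γ| ≤ |x k γ| := fun k γ => by
    rw [abs_mul]; nlinarith [ha k, abs_nonneg (x k γ)]
  refine ⟨fun N => ⟨⟨fun k _ => ?_, fun k _ => h.st k, fun k l h1 _ => h.ts h1⟩, fun k l h1 _ => h.jj h1,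
    fun k _ γ => (b k γ).trans (h.nm k γ), fun k _ γ g1 g2 => (b k γ).trans (h.lo k g1 g2)⟩, h.ks, h.C1⟩
  exact blk_of (x := a k • x k) (by rw [map_smul, (h.blk k).PX_ge le_rfl]) (by rw [map_smul, (h.blk k).PX_le le_rfl, smul_zero])

lemma null_fun (f : X L →L[ℝ] ℝ) : NullRIS f := by
  intro C x s t j h δ hδ
  by_contra hc
  push Not at hc
  have h' := h.smul (a := fun k => SignType.sign (f (x k))) (fun k => by
    rcases lt_trichotomy (f (x k)) 0 with h0 | h0 | h0 <;> simp [h0])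
  set z : ℕ → X L := fun k => ((SignType.sign (f (x k)) : ℝ)) • x k with hz
  have hfz : ∀ k, δ ≤ f (z k) := fun k => by
    have := hc k
    rw [Real.norm_eq_abs] at this
    rw [hz]; simp only [map_smul, smul_eq_mul]; rwa [sign_mul_self]
  obtain ⟨J, hJ⟩ := exists_mm (‖f‖ * (10 * C) / δ)
  have hJ := hJ J le_rfl
  have hC := h.C1
  have hm := mm_pos J
  have hn : (0 : ℝ) < nn J := by have := nn_pos J; exact_mod_cast (by omega : 0 < nn J)
  have h1 : ‖∑ k ∈ range (nn J), z k‖ ≤ 10 * C * (nn J / mm J) := by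
    rw [X.norm_le (by positivity)]
    intro γ
    have := ((h'.ris (nn J)).avg (γ := γ) (by linarith) le_rfl (Nat.zero_le _) le_rfl).1
    rw [X.sum_ap]
    rw [S, Nat.Ico_zero_eq_range] at this
    exact this
  have h2 := (le_abs_self _).trans (f.le_opNorm (∑ k ∈ range (nn J), z k))
  have h3 : nn J * δ ≤ f (∑ k ∈ range (nn J), z k) := by
    rw [map_sum]
    have := card_nsmul_le_sum (range (nn J)) (fun k => f (z k)) δ (fun k _ => hfz k)
    simpa using this
  have h4 : ‖f‖ * ‖∑ k ∈ range (nn J), z k‖ ≤ ‖f‖ * (10 * C * (nn J / mm J)) := by gcongr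
  have h5 : nn J * δ ≤ nn J * (‖f‖ * (10 * C) / mm J) := by
    calc nn J * δ ≤ ‖f‖ * (10 * C * (nn J / mm J)) := by linarith
      _ = _ := by ring
  have h6 := le_of_mul_le_mul_left h5 hn
  rw [le_div_iff₀ hm] at h6
  rw [div_lt_iff₀ hδ] at hJ
  linarith

lemma NullRIS.ev {T : X L →L[ℝ] E} (hT : NullRIS T) (h : IRIS L C (fun k => x k) s t j) {δ : ℝ} (hδ : 0 < δ) :
    ∃ N, ∀ k ≥ N, ‖T (x k)‖ < δ := by
  by_contra hc
  push Not at hc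
  obtain ⟨κ, h1, h2⟩ := Filter.extraction_of_frequently_atTop (P := fun k => δ ≤ ‖T (x k)‖)
    (Filter.frequently_atTop.2 fun N => by obtain ⟨k, h1, h2⟩ := hc N; exact ⟨k, h1, h2⟩)
  obtain ⟨k, hk⟩ := hT C (fun k => x (κ k)) _ _ _ (h.sub h1) δ hδ
  linarith [h2 k]

def ev (L : Set ℕ) (γ : ℕ) : X L →L[ℝ] ℝ :=
  LinearMap.mkContinuous ⟨⟨fun x => x γ, fun _ _ => rfl⟩, fun _ _ => rfl⟩ 1 fun x => by
    rw [one_mul]; exact x.ap_le γ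
lemma ev_ap (x : X L) : ev L γ x = x γ := rfl

lemma null_clm (T : X L →L[ℝ] X L') (h : IRIS L C (fun k => x k) s t j) : Null fun k => T (x k) := by
  intro γ ε hε
  obtain ⟨N, hN⟩ := (null_fun ((ev L' γ).comp T)).ev h hε
  exact ⟨N, fun k hk => (hN k hk).le⟩

lemma cross_compact (T : X L →L[ℝ] X L') (hL : ∀ M, ∃ i ≥ M, i ∈ L' ∧ i ∉ L ∧ Even i) : IsCompactOperator T := by
  refine compact_of_null fun C x s t j h δ hδ => ?_
  by_contra hc
  push Not at hc
  exact cross_false h (null_clm T h) (DomX.clm T x) hδ hc hL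
end AH

namespace AH
open Finset
variable {L : Set ℕ} {γ n m p : ℕ} {U : Submodule ℝ (X L)}

lemma exists_vanish (hU : ¬ FiniteDimensional ℝ ↥U) (n : ℕ) : ∃ u ∈ U, u ≠ 0 ∧ PX L n u = 0 := by
  by_contra hc
  push Not at hc
  let p : X L →ₗ[ℝ] ↥(FF L n) := LinearMap.codRestrict (FF L n) (PX L n).toLinearMap
    (fun x => mem_FF.2 (PX_PX_ge le_rfl x))
  have hinj : Function.Injective (p.comp U.subtype) := by
    rw [injective_iff_map_eq_zero]
    intro u hu
    by_contra h0
    refine hc u u.2 (fun h => h0 (Subtype.ext h)) ?_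
    exact congrArg Subtype.val hu
  exact hU (FiniteDimensional.of_injective _ hinj)

lemma exists_block (hU : ¬ FiniteDimensional ℝ ↥U) (n : ℕ) {ε : ℝ} (hε : 0 < ε) :
    ∃ t x, n ≤ t ∧ (Blk L n t (X.fn x) ∧ ‖x‖ = 1 ∧ ∃ u ∈ U, ‖u - x‖ ≤ ε) := by
  obtain ⟨u, hu, h0, h1⟩ := exists_vanish hU n
  have hp : 0 < ‖u‖ := norm_pos_iff.2 h0
  obtain ⟨N, hN⟩ := PX_tend u (ε := min (ε * ‖u‖ / 2) (‖u‖ / 2)) (by positivity)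
  have hN := hN (max n N) (le_max_right _ _)
  set y := PX L (max n N) u with hy
  have g1 := hN.trans (min_le_left _ _)
  have g2 := hN.trans (min_le_right _ _)
  have g3 : ‖u‖ / 2 ≤ ‖y‖ := by linarith [norm_sub_norm_le u y]
  have g4 : 0 < ‖y‖ := by linarith
  refine ⟨max n N, ‖y‖⁻¹ • y, le_max_left _ _, blk_of ?_ ?_, ?_, ‖y‖⁻¹ • u, U.smul_mem _ hu, ?_⟩
  · rw [map_smul, hy, PX_PX_ge le_rfl]
  · rw [map_smul, hy, PX_PX_le (le_max_left _ _), h1, smul_zero]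
  · rw [norm_smul, norm_inv, norm_norm, inv_mul_cancel₀ g4.ne']
  · rw [← smul_sub, norm_smul, norm_inv, norm_norm, inv_mul_le_iff₀ g4]
    nlinarith

structure SQ (U : Submodule ℝ (X L)) (n : ℕ) (ε : ℝ) (x : ℕ → X L) (s t : ℕ → ℕ) : Prop where
  blk : ∀ k, Blk L (s k) (t k) (x k)
  st : ∀ k, s k ≤ t k
  ts : ∀ k l, k < l → t k ≤ s l
  n0 : ∀ k, n ≤ s k
  nm : ∀ k, ‖x k‖ ≤ 1
  nr : ∀ k, ∃ u ∈ U, ‖u - x k‖ ≤ ε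

lemma SQ.sub {ε : ℝ} {x : ℕ → X L} {s t : ℕ → ℕ} (h : SQ U n ε x s t) {κ : ℕ → ℕ} (hκ : StrictMono κ) :
    SQ U n ε (fun k => x (κ k)) (fun k => s (κ k)) (fun k => t (κ k)) :=
  ⟨fun k => h.blk _, fun k => h.st _, fun k l hkl => h.ts _ _ (hκ hkl), fun k => h.n0 _, fun k => h.nm _, fun k => h.nr _⟩

lemma blk_sum {ι : Type*} {I : Finset ι} {x : ι → X L} {s t : ℕ} (h : ∀ k ∈ I, Blk L s t (x k)) :
    Blk L s t (∑ k ∈ I, x k : X L) := by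
  refine blk_of ?_ ?_
  · rw [map_sum]; exact sum_congr rfl fun k hk => (h k hk).PX_ge le_rfl
  · rw [map_sum]; exact sum_eq_zero fun k hk => (h k hk).PX_le le_rfl
lemma blk_smul {x : X L} {s t : ℕ} (a : ℝ) (h : Blk L s t x) : Blk L s t (a • x : X L) :=
  blk_of (by rw [map_smul, h.PX_ge le_rfl]) (by rw [map_smul, h.PX_le le_rfl, smul_zero])

lemma sum_near {N : ℕ} {x : ℕ → X L} {ε : ℝ} (h : ∀ k < N, ∃ u ∈ U, ‖u - x k‖ ≤ ε) :
    ∃ u ∈ U, ‖u - ∑ k ∈ range N, x k‖ ≤ N * ε := by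
  induction N with
  | zero => exact ⟨0, zero_mem _, by simp⟩
  | succ N ih =>
    obtain ⟨u, h1, h2⟩ := ih fun k hk => h k (by omega)
    obtain ⟨v, h3, h4⟩ := h N (by omega)
    refine ⟨u + v, add_mem h1 h3, ?_⟩
    rw [sum_range_succ, add_sub_add_comm]
    refine (norm_add_le _ _).trans ?_
    push_cast; linarith

lemma SQ.avg {ε : ℝ} {x : ℕ → X L} {s t : ℕ → ℕ} (h : SQ U n ε x s t) {N : ℕ} (hN : 1 ≤ N)
    (hs : ∀ k, ‖∑ l ∈ range N, x (k * N + l)‖ ≤ N / 2) :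
    SQ U n (2 * ε) (fun k => (2 / N : ℝ) • ∑ l ∈ range N, x (k * N + l)) (fun k => s (k * N))
      (fun k => t (k * N + (N - 1))) := by
  have hN0 : (0 : ℝ) < N := by exact_mod_cast hN
  have ms : ∀ a b, a ≤ b → s a ≤ s b := fun a b hab => by
    rcases hab.eq_or_lt with rfl | h1
    · exact le_rfl
    · exact (h.st a).trans (h.ts a b h1)
  have mt : ∀ a b, a ≤ b → t a ≤ t b := fun a b hab => by
    rcases hab.eq_or_lt with rfl | h1
    · exact le_rfl
    · exact (h.ts a b h1).trans (h.st b)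
  refine ⟨fun k => blk_smul _ (blk_sum fun l hl => ?_), fun k => (h.st _).trans (mt _ _ (by omega)), fun k l hkl => h.ts _ _ ?_,
    fun k => h.n0 _, fun k => ?_, fun k => ?_⟩
  · have := mem_range.1 hl
    exact (h.blk _).mono (ms _ _ (by omega)) (mt _ _ (by omega))
  · have : (k + 1) * N ≤ l * N := Nat.mul_le_mul_right _ hkl
    rw [add_mul, one_mul] at this; omega
  · rw [norm_smul, Real.norm_eq_abs, abs_of_pos (by positivity), div_mul_eq_mul_div, div_le_one hN0]
    linarith [hs k]
  · obtain ⟨u, h1, h2⟩ := sum_near (U := U) (N := N) (x := fun l => x (k * N + l)) (ε := ε) fun l _ => h.nr _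
    refine ⟨(2 / N : ℝ) • u, U.smul_mem _ h1, ?_⟩
    rw [← smul_sub, norm_smul, Real.norm_eq_abs, abs_of_pos (by positivity), div_mul_eq_mul_div, div_le_iff₀ hN0]
    linarith

lemma sum_range_mul' {M : Type*} [AddCommMonoid M] (f : ℕ → M) (a N : ℕ) :
    ∑ k ∈ range (a * N), f k = ∑ k ∈ range a, ∑ l ∈ range N, f (k * N + l) := by
  induction a with
  | zero => simp
  | succ a ih => rw [add_mul, one_mul, sum_range_add, ih, sum_range_succ]

lemma james (hL : Good L) (hU : ¬ FiniteDimensional ℝ ↥U) {N : ℕ} (hN : 1 ≤ N) (n : ℕ) {ε : ℝ} (hε : 0 < ε) :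
    ∃ x s t, SQ U n ε x s t ∧ (N / 2 : ℝ) ≤ ‖∑ k ∈ range N, x k‖ := by
  by_contra hcon
  push Not at hcon
  have hN0 : (0 : ℝ) < N := by exact_mod_cast hN
  have key : ∀ h x s t, SQ U n (ε / 2 ^ h) x s t → ‖∑ l ∈ range (N ^ h), x l‖ ≤ (N / 2) ^ h := by
    intro h
    induction h with
    | zero => intro x s t hx; simpa using hx.nm 0
    | succ h ih =>
      intro x s t hx
      have hle : SQ U n ε x s t := ⟨hx.blk, hx.st, hx.ts, hx.n0, hx.nm, fun k => by
        obtain ⟨u, h1, h2⟩ := hx.nr k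
        exact ⟨u, h1, h2.trans (div_le_self hε.le (one_le_pow₀ (by norm_num)))⟩⟩
      have hx' := hx.avg hN fun k => (hcon _ _ _ (hle.sub (κ := fun l => k * N + l) (fun a b hab => by dsimp only; omega))).le
      rw [show 2 * (ε / 2 ^ (h + 1)) = ε / 2 ^ h by field_simp; ring] at hx'
      have := ih _ _ _ hx'
      rw [← smul_sum, ← sum_range_mul', norm_smul, Real.norm_eq_abs, abs_of_pos (by positivity)] at this
      rw [pow_succ, pow_succ]
      calc _ = (2 / N * ‖∑ l ∈ range (N ^ h * N), x l‖) * (N / 2) := by field_simp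
        _ ≤ _ := by gcongr
  obtain ⟨J, hJN, hJ, hJe, -⟩ := hL.ev 0 (N + 1)
  have hDD : N ≤ DD J := by
    have := nn_DD (show N < J by omega)
    have := nn_mono.le_apply (x := N)
    omega
  set H := ee J + 3 with hH
  have hM : N ^ H ≤ nn J := james_nn hDD
  obtain ⟨s, t, x, hP, ks, st, ts⟩ := sel _ (fun (k : ℕ) (m : ℕ) => by
    obtain ⟨t, x, h1, h2⟩ := exists_block hU (max n m) (ε := ε / 2 ^ H) (by positivity)
    exact (⟨t, (max n m, x), (le_max_right _ _).trans h1, le_max_left _ _, le_max_right _ _, h1, h2⟩ :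
      ∃ t, ∃ x : ℕ × X L, m ≤ t ∧ (n ≤ x.1 ∧ m ≤ x.1 ∧ x.1 ≤ t ∧ Blk L x.1 t (X.fn x.2) ∧ ‖x.2‖ = 1 ∧ ∃ u ∈ U, ‖u - x.2‖ ≤ ε / 2 ^ H)))
  have hs' : ∀ k, s k ≤ (x k).1 := fun k => (hP k).2.1
  have hx : SQ U n (ε / 2 ^ H) (fun k => (x k).2) (fun k => (x k).1) t :=
    ⟨fun k => (hP k).2.2.2.1, fun k => (hP k).2.2.1, fun k l hkl => (ts k l hkl).le.trans (hs' l), fun k => (hP k).1,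
      fun k => (hP k).2.2.2.2.1.le, fun k => (hP k).2.2.2.2.2⟩
  choose d hd hdx using fun k => one_pt (L := L) (hx.blk k) (δ := 3 / 4) (by norm_num) (by
    obtain ⟨γ, hγ⟩ := X.exists_big (x := (x k).2) (c := 3 / 4) (by norm_num) (by rw [(hP k).2.2.2.2.1]; norm_num)
    exact ⟨γ, hγ.le⟩)
  obtain ⟨κ, p, h1, h2, h3, h4, h5⟩ := build hJ hJe (fun k => (x k).1) t (fun k => (hP k).2.2.1)
    (fun k => (ks k).trans (hs' k)) d hd 0 (N ^ H) hM
  have hpos : 1 ≤ N ^ H := Nat.one_le_pow _ _ hN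
  have hp : p ≠ 0 := by
    rcases h3 with h3 | h3
    · omega
    · exact h3.1
  have h6 := h5 (fun k => (x k).2) (fun q _ => hx.blk _) hp
  have h7 := key H _ _ _ (hx.sub h1)
  have h8 := (le_abs_self _).trans ((X.ap_le (∑ l ∈ range (N ^ H), (x (κ l)).2) (p - 1)).trans h7)
  rw [X.sum_ap, h6] at h8
  have h9 : (N ^ H : ℕ) * (3 / 16 : ℝ) ≤ ∑ q ∈ range (N ^ H), b2 (d (κ q)) (x (κ q)).2 := by
    have := card_nsmul_le_sum (range (N ^ H)) (fun q => b2 (d (κ q)) (x (κ q)).2) (3 / 16 : ℝ) (fun q _ => by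
      have := hdx (κ q); norm_num at this ⊢; exact this)
    simpa using this
  have hm := mm_pos J
  have h10 : (mm J)⁻¹ * ((N ^ H : ℕ) * (3 / 16 : ℝ)) ≤ (N / 2) ^ H := le_trans (by gcongr) h8
  rw [inv_mul_le_iff₀ hm, div_pow, Nat.cast_pow] at h10
  have e : (2 : ℝ) ^ H = mm J * 8 := by rw [hH, pow_add, mm]; norm_num
  rw [e] at h10
  have : (0 : ℝ) < (N : ℝ) ^ H := by positivity
  have e2 : mm J * ((N : ℝ) ^ H / (mm J * 8)) = (N : ℝ) ^ H / 8 := by field_simp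
  rw [e2] at h10
  linarith

lemma lemR (hL : Good L) (U : ℕ → Submodule ℝ (X L)) (hU : ∀ k, ¬ FiniteDimensional ℝ ↥(U k)) (ε : ℕ → ℝ)
    (hε : ∀ k, 0 < ε k) : ∃ (x : ℕ → X L) (s t : ℕ → ℕ), IRIS L 3 (fun k => x k) s t s ∧ (∀ k, t k < s (k + 1)) ∧
      ∀ k, 1 / 2 ≤ ‖x k‖ ∧ ∃ u ∈ U k, ‖u - x k‖ ≤ ε k := by
  obtain ⟨s, t, x, hP, ks, st, ts⟩ := sel (fun k n t (x : X L) => Blk L n t x ∧ ‖x‖ ≤ 1 ∧ (1 / 2 ≤ ‖x‖ ∧ ∃ u ∈ U k, ‖u - x‖ ≤ ε k)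
      ∧ ∀ γ, Act L γ → W γ < n → |x γ| ≤ 3 / mm (W γ)) (fun k n => by
    obtain ⟨N, hN, hNi⟩ : ∃ N : ℕ, 1 ≤ N ∧ ∀ i < n, nn i * mm i ≤ N := by
      refine ⟨∑ i ∈ range n, ⌈nn i * mm i⌉₊ + 1, by omega, fun i hi => (Nat.le_ceil _).trans ?_⟩
      exact_mod_cast (single_le_sum (f := fun i => ⌈nn i * mm i⌉₊) (fun _ _ => Nat.zero_le _) (mem_range.2 hi)).trans (Nat.le_succ _)
    obtain ⟨x, s, t, hx, hb⟩ := james hL (hU k) hN n (hε k)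
    have hN0 : (0 : ℝ) < N := by exact_mod_cast hN
    have ms : s 0 ≤ t (N - 1) := by
      rcases Nat.eq_zero_or_pos (N - 1) with h1 | h1
      · rw [h1]; exact hx.st 0
      · exact ((hx.st 0).trans (hx.ts _ _ h1)).trans (hx.st _)
    have hS : ∀ a b η, a ≤ b → |S (fun k => x k) a b η| ≤ (b : ℝ) - a := fun a b η hab => by
      have := S_triv (x := fun k => x k) (γ := η) (c := 1) (fun k _ _ => ((x k).ap_le η).trans (hx.nm k)) hab
      linarith
    have ap : ∀ γ, ((1 / N : ℝ) • ∑ l ∈ range N, x l) γ = (1 / N) * S (fun k => x k) 0 N γ := fun γ => by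
      rw [X.smul_ap, X.sum_ap, S, Nat.Ico_zero_eq_range]
    refine ⟨t (N - 1), (1 / N : ℝ) • ∑ l ∈ range N, x l, (hx.n0 0).trans ms, blk_smul _ (blk_sum fun l hl => ?_), ?_, ⟨?_, ?_⟩, ?_⟩
    · have := mem_range.1 hl
      refine (hx.blk l).mono (hx.n0 l) ?_
      rcases (show l ≤ N - 1 by omega).eq_or_lt with h1 | h1
      · rw [h1]
      · exact (hx.ts _ _ h1).trans (hx.st _)
    · rw [X.norm_le (by norm_num)]
      intro γ
      rw [ap, abs_mul, abs_of_pos (by positivity), div_mul_eq_mul_div, div_le_one hN0, one_mul]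
      simpa using hS 0 N γ (Nat.zero_le _)
    · rw [norm_smul, Real.norm_eq_abs, abs_of_pos (by positivity), div_mul_eq_mul_div, le_div_iff₀ hN0]
      linarith
    · obtain ⟨u, h1, h2⟩ := sum_near (U := U k) (N := N) (x := x) (ε := ε k) fun l _ => hx.nr _
      refine ⟨(1 / N : ℝ) • u, (U k).smul_mem _ h1, ?_⟩
      rw [← smul_sub, norm_smul, Real.norm_eq_abs, abs_of_pos (by positivity), div_mul_eq_mul_div, div_le_iff₀ hN0]
      linarith
    · intro γ ha hw
      have hm := mm_pos (W γ)
      have hbs : BS L (fun k => x k) s t N := ⟨fun k _ => hx.blk k, fun k _ => hx.st k, fun k l h _ => hx.ts k l h⟩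
      have := hbs.chain (A := 0) (B := N) (i := W γ) le_rfl (α := 1) (c := 0) (e := 1) (by norm_num) le_rfl (by norm_num)
        (fun a b η _ hab _ => by simpa using hS a b η hab)
        (fun k γ' _ _ _ _ => ((x k).ap_le γ').trans ((hx.nm k).trans (by have := div_pos one_pos (mm_pos (W γ)); linarith)))
        γ 0 N ha rfl le_rfl (Nat.zero_le _) le_rfl
      rw [ap, abs_mul, abs_of_pos (by positivity), div_mul_eq_mul_div, one_mul, div_le_iff₀ hN0]
      refine this.trans ?_
      have hag : (AG γ : ℝ) ≤ nn (W γ) := by exact_mod_cast ha.ag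
      have h4 : (nn (W γ) : ℝ) ≤ N / mm (W γ) := by rw [le_div_iff₀ hm]; exact hNi _ hw
      have e : (3 : ℝ) / mm (W γ) * N = 3 * (N / mm (W γ)) := by ring
      rw [e]
      simp only [Nat.cast_zero, sub_zero, one_mul, mul_zero, add_zero, mul_one]
      linarith)
  refine ⟨x, s, t, IRIS.of (by norm_num) (fun k => (hP k).1) ks st ts (fun k γ => ?_) (fun k => (hP k).2.2.2), fun k => ts _ _ (by omega), fun k => (hP k).2.2.1⟩
  exact ((x k).ap_le γ).trans ((hP k).2.1.trans (by norm_num))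
end AH

namespace AH
open Finset
variable {L : Set ℕ} {C : ℝ} {s t j : ℕ → ℕ} {x : ℕ → X L}

lemma clA (hL : Good L) (T : X L →L[ℝ] X L) (h : IRIS L C (fun k => x k) s t j) {δ : ℝ} (hδ : 0 < δ) :
    ∃ N, ∀ k ≥ N, ∃ l : ℝ, ‖T (x k) - l • x k‖ < δ := by
  by_contra hc
  push Not at hc
  obtain ⟨κ, h1, h2⟩ := Filter.extraction_of_frequently_atTop (P := fun k => ∀ l : ℝ, δ ≤ ‖T (x k) - l • x k‖)
    (Filter.frequently_atTop.2 fun N => by obtain ⟨k, h1, h2⟩ := hc N; exact ⟨k, h1, h2⟩)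
  have h' := h.sub h1
  exact same_false (x := fun k => x (κ k)) hL h' (null_clm T h') (DomX.clm T _) hδ h2

lemma clB (hL : Good L) (T : X L →L[ℝ] X L) (h : IRIS L C (fun k => x k) s t j) (hx : ∀ k, 1 / 2 ≤ ‖x k‖) :
    ∃ l : ℝ, ∀ η > 0, ∀ N, ∃ a ≥ N, ‖T (x a) - l • x a‖ ≤ η := by
  obtain ⟨κ, hκ, h1⟩ := Filter.extraction_forall_of_eventually
    (P := fun n k => ∃ l : ℝ, ‖T (x k) - l • x k‖ < 1 / ((n : ℝ) + 1)) fun n => by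
      obtain ⟨N, hN⟩ := clA hL T h (δ := 1 / ((n : ℝ) + 1)) (by positivity)
      exact Filter.eventually_atTop.2 ⟨N, hN⟩
  choose l hl using h1
  have hb : ∀ k, l k ∈ Metric.closedBall (0 : ℝ) (2 * (‖T‖ * C + 1)) := fun k => by
    have a1 := hl k
    have a2 := norm_sub_norm_le (l k • x (κ k)) (T (x (κ k)))
    rw [norm_sub_rev, norm_smul] at a2
    have a3 := (T.le_opNorm (x (κ k))).trans (mul_le_mul_of_nonneg_left (h.norm (κ k)) (norm_nonneg _))
    have a4 : 1 / ((k : ℝ) + 1) ≤ 1 := by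
      rw [div_le_one (by positivity)]; linarith [(Nat.cast_nonneg k : (0 : ℝ) ≤ k)]
    have a5 : ‖l k‖ * (1 / 2) ≤ ‖l k‖ * ‖x (κ k)‖ := mul_le_mul_of_nonneg_left (hx _) (norm_nonneg _)
    rw [mem_closedBall_zero_iff]; linarith
  obtain ⟨l0, -, φ, hφ, ht⟩ := tendsto_subseq_of_bounded Metric.isBounded_closedBall hb
  have hC := h.C1
  refine ⟨l0, fun η hη N => ?_⟩
  have e1 := (Metric.tendsto_atTop.1 ht) (η / (2 * C)) (by positivity)
  obtain ⟨n1, hn1⟩ := e1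
  obtain ⟨n2, hn2⟩ := exists_nat_one_div_lt (half_pos hη)
  set n := max n1 (max n2 N)
  have i1 : n ≤ φ n := hφ.le_apply
  have i2 : φ n ≤ κ (φ n) := hκ.le_apply
  have i3 : n1 ≤ n := by simp [n]
  have i4 : n2 ≤ n := by simp [n]
  have i5 : N ≤ n := by simp [n]
  refine ⟨κ (φ n), by omega, ?_⟩
  have b1 := hn1 n i3
  rw [Real.dist_eq, Function.comp] at b1
  have b2 := hl (φ n)
  have b3 : 1 / (((φ n : ℕ) : ℝ) + 1) ≤ 1 / ((n2 : ℝ) + 1) := by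
    have : (n2 : ℝ) ≤ φ n := by exact_mod_cast i4.trans i1
    gcongr
  have b4 := h.norm (κ (φ n))
  have e : T (x (κ (φ n))) - l0 • x (κ (φ n)) = (T (x (κ (φ n))) - l (φ n) • x (κ (φ n))) + (l (φ n) - l0) • x (κ (φ n)) := by
    rw [sub_smul]; abel
  have b5 : ‖(l (φ n) - l0) • x (κ (φ n))‖ ≤ η / (2 * C) * C := by
    rw [norm_smul, Real.norm_eq_abs]; gcongr
  have b6 : η / (2 * C) * C = η / 2 := by field_simp
  rw [e]
  refine (norm_add_le _ _).trans ?_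
  linarith

lemma blk_add {x y : X L} {s t : ℕ} (h : Blk L s t x) (h' : Blk L s t y) : Blk L s t (x + y : X L) :=
  blk_of (by rw [map_add, h.PX_ge le_rfl, h'.PX_ge le_rfl]) (by rw [map_add, h.PX_le le_rfl, h'.PX_le le_rfl, add_zero])

lemma spc (hL : Good L) : ScalarPlusCompact (X L) := by
  intro T
  obtain ⟨i, -, hi, he, -⟩ := hL.ev 0 0
  have hX := X_infdim hi he
  obtain ⟨x, s, t, h, -, hx⟩ := lemR hL (fun _ => ⊤) (fun k hf => hX (by
    exact (LinearEquiv.finiteDimensional (Submodule.topEquiv (R := ℝ) (M := X L))))) (fun _ => 1) (fun _ => one_pos)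
  have hx := fun k => (hx k).1
  obtain ⟨l, hl⟩ := clB hL T h hx
  set S : X L →L[ℝ] X L := T - l • ContinuousLinearMap.id ℝ (X L) with hS
  have hSx : ∀ v, S v = T v - l • v := fun v => by simp [hS]
  simp only [← hSx] at hl
  refine ⟨l, S, compact_of_null ?_, by simp [hS]⟩
  intro C' y s' t' j' h' δ hδ
  by_contra hc
  push Not at hc
  have hC' := h'.C1
  set η := δ / (14 * (3 + C')) with hη
  have hη0 : 0 < η := by positivity
  obtain ⟨N, hN⟩ := clA hL S h' hη0
  obtain ⟨s2, t2, ab, hP, ks, st, ts⟩ := sel (fun k n T (p : ℕ × ℕ) => n ≤ p.1 ∧ t p.1 ≤ p.2 ∧ n ≤ p.2 ∧ t p.1 ≤ T ∧ t' p.2 ≤ T ∧ N ≤ p.2 ∧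
      ‖S (x p.1)‖ ≤ η) (fun k n => by
    obtain ⟨a, ha, ha'⟩ := hl η hη0 n
    refine ⟨max n (max (t a) (t' (max (max n N) (t a)))), (a, max (max n N) (t a)), le_max_left _ _, ha, ?_⟩
    simp [ha'])
  have hw : IRIS L (3 + C') (fun k => (x (ab k).1 + y (ab k).2 : X L)) s2 t2 s2 := by
    refine IRIS.of (by linarith) (fun k => ?_) ks st ts (fun k γ => ?_) (fun k γ ha hγ => ?_)
    · obtain ⟨p1, p2, p3, p4, p5, p6, p7⟩ := hP k
      exact blk_add ((h.blk _).mono (p1.trans (h.ks _)) p4) ((h'.blk _).mono (p3.trans (h'.ks _)) p5)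
    · rw [X.add_ap]; exact (abs_add_le _ _).trans (add_le_add (h.nm _ _) (h'.nm _ _))
    · obtain ⟨p1, p2, p3, p4, p5, p6, p7⟩ := hP k
      rw [X.add_ap, add_div]
      exact (abs_add_le _ _).trans (add_le_add (h.lo _ ha (by have := h.kj (ab k).1; omega))
        (h'.lo _ ha (by have := h'.kj (ab k).2; omega)))
  obtain ⟨M, hM⟩ := clA hL S (x := fun k => x (ab k).1 + y (ab k).2) hw hη0
  obtain ⟨μ, hμ⟩ := hM M le_rfl
  obtain ⟨p1, p2, p3, p4, p5, p6, p7⟩ := hP M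
  obtain ⟨ν, hν⟩ := hN _ p6
  have hd := hc (ab M).2
  set a := (ab M).1
  set b := (ab M).2
  have q1 : ‖ν • y b - μ • x a - μ • y b‖ ≤ 3 * η := by
    have e : ν • y b - μ • x a - μ • y b = (S (x a + y b) - μ • (x a + y b)) - (S (y b) - ν • y b) - S (x a) := by
      rw [map_add, smul_add]; abel
    rw [e]
    refine (norm_sub_le _ _).trans ?_
    have := norm_sub_le (S (x a + y b) - μ • (x a + y b)) (S (y b) - ν • y b)
    linarith
  have q2 : ‖μ • x a‖ ≤ 6 * η := by
    have := PX_norm (L := L) (n := t a) (ν • y b - μ • x a - μ • y b)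
    rw [map_sub, map_sub, map_smul, map_smul, map_smul, (h'.blk b).PX_le (p2.trans (h'.ks _)), (h.blk a).PX_ge le_rfl] at this
    simp only [smul_zero, zero_sub, sub_zero, norm_neg] at this
    linarith
  have q3 : ‖μ‖ ≤ 12 * η := by
    rw [norm_smul] at q2
    have := mul_le_mul_of_nonneg_left (hx a) (norm_nonneg μ)
    linarith
  have q4 : ‖S (y b)‖ ≤ 2 * η + 12 * η * (3 + C') := by
    have e : S (y b) = (S (x a + y b) - μ • (x a + y b)) - S (x a) + μ • (x a + y b) := by
      rw [map_add]; abel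
    have q5 : ‖μ • (x a + y b)‖ ≤ 12 * η * (3 + C') := by
      rw [norm_smul]
      have := (norm_add_le (x a) (y b)).trans (add_le_add (h.norm a) (h'.norm b))
      gcongr
    rw [e]
    refine (norm_add_le _ _).trans ?_
    have := norm_sub_le (S (x a + y b) - μ • (x a + y b)) (S (x a))
    linarith
  have q6 : η * (14 * (3 + C')) = δ := by rw [hη]; field_simp
  nlinarith
end AH

namespace AH
open Finset
variable {L L' : Set ℕ} {C : ℝ} {s t j : ℕ → ℕ} {x : ℕ → X L}

lemma DomX.refl {E : Type*} [NormedAddCommGroup E] [NormedSpace ℝ E] (x : ℕ → E) : DomX 1 x x := fun I a => by rw [one_mul]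

lemma half_small {ε : ℝ} (hε : 0 < ε) : ∃ N, ∀ k ≥ N, (1 / 2 : ℝ) ^ k ≤ ε := by
  obtain ⟨N, hN⟩ := exists_pow_lt_of_lt_one hε (by norm_num : (1 / 2 : ℝ) < 1)
  exact ⟨N, fun k hk => (pow_le_pow_of_le_one (by norm_num) (by norm_num) hk).trans hN.le⟩

lemma hi_X (hL : Good L) : HereditarilyIndecomposable (X L) := by
  intro Z U V hZ _ hU hV hUi hVi hUV hsup
  have : CompleteSpace U := hU.completeSpace_coe
  have : CompleteSpace V := hV.completeSpace_coe
  let f : (U × V) →L[ℝ] X L := U.subtypeL.coprod V.subtypeL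
  have hf : ∀ p, f p = p.1 + p.2 := fun p => rfl
  have hinj : Function.Injective f := by
    rw [injective_iff_map_eq_zero]
    rintro ⟨u, v⟩ h
    rw [hf] at h
    have h1 : (u : X L) = -v := eq_neg_of_add_eq_zero_left h
    have h2 : (u : X L) ∈ U ⊓ V := ⟨u.2, by rw [h1]; exact V.neg_mem v.2⟩
    rw [hUV, Submodule.mem_bot] at h2
    have h3 : (v : X L) = 0 := by rw [h2] at h1; simpa using h1.symm
    exact Prod.ext (Subtype.ext h2) (Subtype.ext h3)
  have hr : IsClosed (Set.range f) := by
    convert hZ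
    ext z
    rw [SetLike.mem_coe, ← hsup, Submodule.mem_sup]
    constructor
    · rintro ⟨p, rfl⟩; exact ⟨p.1, p.1.2, p.2, p.2.2, rfl⟩
    · rintro ⟨u, hu, v, hv, rfl⟩; exact ⟨(⟨u, hu⟩, ⟨v, hv⟩), rfl⟩
  obtain ⟨K, hK⟩ := f.antilipschitz_of_injective_of_isClosed_range hinj hr
  have hK : ∀ p : U × V, ‖p‖ ≤ K * ‖(p.1 : X L) + p.2‖ := fun p => by
    have := hK.le_mul_dist p 0
    rwa [dist_zero_right, map_zero, dist_zero_right] at this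
  obtain ⟨x, s, t, h, hts, hx⟩ := lemR hL (fun k => if Even k then U else V) (fun k => by
    by_cases hk : Even k
    · rwa [if_pos hk]
    · rwa [if_neg hk]) (fun k => (1 / 2) ^ (k + 5)) (fun k => by positivity)
  have hx1 := fun k => (hx k).1
  have hu : ∀ k, ∃ u ∈ U, ‖u - x (2 * k)‖ ≤ (1 / 2) ^ (2 * k + 5) := fun k => by simpa using (hx (2 * k)).2
  have hv : ∀ k, ∃ u ∈ V, ‖u - x (2 * k + 1)‖ ≤ (1 / 2) ^ (2 * k + 1 + 5) := fun k => by simpa using (hx (2 * k + 1)).2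
  choose u hu hux using hu
  choose v hv hvx using hv
  have hp1 : ∀ k : ℕ, (1 / 2 : ℝ) ^ (2 * k + 5) ≤ (1 / 2) ^ (k + 5) := fun k =>
    pow_le_pow_of_le_one (by norm_num) (by norm_num) (by omega)
  have hp2 : ∀ k : ℕ, (1 / 2 : ℝ) ^ (2 * k + 1 + 5) ≤ (1 / 2) ^ (k + 5) := fun k =>
    pow_le_pow_of_le_one (by norm_num) (by norm_num) (by omega)
  have hp3 : ∀ k : ℕ, (1 / 2 : ℝ) ^ (k + 5) ≤ 1 / 32 := fun k => by
    have : (1 / 2 : ℝ) ^ (k + 5) ≤ (1 / 2) ^ 5 := pow_le_pow_of_le_one (by norm_num) (by norm_num) (by omega)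
    norm_num at this ⊢; exact this
  have hw : IRIS L (3 + 3) (fun k => (x (2 * k) + x (2 * k + 1) : X L)) (fun k => s (2 * k)) (fun k => t (2 * k + 1)) (fun k => s (2 * k)) := by
    have hss : ∀ k, s (2 * k) ≤ s (2 * k + 1) := fun k => (h.st _).trans (h.ts (by omega))
    refine IRIS.of (by norm_num) (fun k => ?_) (fun k => ?_) (fun k => ?_) (fun k l hkl => ?_) (fun k γ => ?_) (fun k γ ha hγ => ?_)
    · exact blk_add ((h.blk _).mono le_rfl ((h.ts (by omega)).trans (h.st _))) ((h.blk _).mono (hss k) le_rfl)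
    · have := h.ks (2 * k); omega
    · exact (hss k).trans (h.st _)
    · exact (h.jj (by omega)).1
    · rw [X.add_ap]; exact (abs_add_le _ _).trans (add_le_add (h.nm _ _) (h.nm _ _))
    · rw [X.add_ap, add_div]
      exact (abs_add_le _ _).trans (add_le_add (h.lo _ ha hγ) (h.lo _ ha (hγ.trans_le (hss k))))
  have hpr : ∀ k (a b : ℝ), ‖a • x (2 * k)‖ ≤ 2 * ‖a • x (2 * k) + b • x (2 * k + 1)‖ := fun k a b => by
    have := PX_norm (L := L) (n := t (2 * k)) (a • x (2 * k) + b • x (2 * k + 1))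
    rwa [map_add, map_smul, map_smul, (h.blk _).PX_ge le_rfl, (h.blk (2 * k + 1)).PX_le (h.ts (by omega)), smul_zero, add_zero] at this
  have hwl : ∀ k, 1 / 4 ≤ ‖x (2 * k) + x (2 * k + 1)‖ := fun k => by
    have := hpr k 1 1
    simp only [one_smul] at this
    linarith [hx1 (2 * k)]
  have hD1 := hw.pert (x := fun k => x (2 * k) + x (2 * k + 1)) (g' := fun k => u k + v k) (by norm_num : (0 : ℝ) < 1 / 4) hwl
    (DomX.refl _) (fun k => by
      rw [add_sub_add_comm]
      refine (norm_add_le _ _).trans ?_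
      have e : (1 / 2 : ℝ) ^ (k + 1) = 16 * (1 / 2) ^ (k + 5) := by rw [pow_add _ k 5, pow_add]; ring
      have : (0 : ℝ) < (1 / 2) ^ (k + 5) := by positivity
      linarith [hux k, hvx k, hp1 k, hp2 k])
  have hD2 : DomX (K : ℝ) (fun k => u k + v k) u := fun I a => by
    have := hK (⟨∑ k ∈ I, a k • u k, U.sum_mem fun k _ => U.smul_mem _ (hu k)⟩, ⟨∑ k ∈ I, a k • v k, V.sum_mem fun k _ => V.smul_mem _ (hv k)⟩)
    simp only [smul_add, sum_add_distrib]
    exact (norm_fst_le _).trans this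
  have hD := hD1.trans hD2 K.2
  refine same_false hL hw (g := u) (x := fun k => x (2 * k) + x (2 * k + 1)) (δ := 1 / 20) ?_ hD (by norm_num) ?_
  · intro γ ε hε
    obtain ⟨N, hN⟩ := half_small hε
    refine ⟨max N (γ + 1), fun k hk => ?_⟩
    have h1 := (h.blk (2 * k)).2 γ (by have := h.ks (2 * k); have := le_max_right N (γ + 1); omega)
    have h2 := (u k - x (2 * k)).ap_le γ
    rw [X.sub_ap, h1, sub_zero] at h2
    exact h2.trans ((hux k).trans (hN _ (by have := le_max_left N (γ + 1); omega)))
  · intro k l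
    have a0 : ‖x (2 * k) - l • (x (2 * k) + x (2 * k + 1))‖ ≤ ‖u k - l • (x (2 * k) + x (2 * k + 1))‖ + 1 / 32 := by
      have := norm_sub_norm_le (x (2 * k) - l • (x (2 * k) + x (2 * k + 1))) (u k - l • (x (2 * k) + x (2 * k + 1)))
      rw [sub_sub_sub_cancel_right, norm_sub_rev _ (u k)] at this
      linarith [hux k, hp1 k, hp3 k]
    have e : x (2 * k) - l • (x (2 * k) + x (2 * k + 1)) = (1 - l) • x (2 * k) + (-l) • x (2 * k + 1) := by
      rw [smul_add, sub_smul, one_smul, neg_smul]; abel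
    have a1 := hpr k (1 - l) (-l)
    rw [← e] at a1
    have a2 : ‖(-l) • x (2 * k + 1)‖ ≤ ‖x (2 * k) - l • (x (2 * k) + x (2 * k + 1))‖ + ‖(1 - l) • x (2 * k)‖ := by
      rw [e]
      have := norm_sub_le ((1 - l) • x (2 * k) + (-l) • x (2 * k + 1)) ((1 - l) • x (2 * k))
      rwa [add_sub_cancel_left] at this
    set Q := ‖x (2 * k) - l • (x (2 * k) + x (2 * k + 1))‖
    rw [norm_smul, Real.norm_eq_abs] at a1 a2
    rw [norm_smul, Real.norm_eq_abs, abs_neg] at a2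
    have a3 := mul_le_mul_of_nonneg_left (hx1 (2 * k)) (abs_nonneg (1 - l))
    have a4 := mul_le_mul_of_nonneg_left (hx1 (2 * k + 1)) (abs_nonneg l)
    have a5 := abs_add_le (1 - l) l
    rw [sub_add_cancel, abs_one] at a5
    linarith

lemma incomp (hL : Good L) (hLL : ∀ M, ∃ i ≥ M, i ∈ L' ∧ i ∉ L ∧ Even i) (W : Submodule ℝ (X L)) (hW : ¬ FiniteDimensional ℝ W)
    (W' : Submodule ℝ (X L')) (T : W ≃L[ℝ] W') : False := by
  obtain ⟨x, s, t, h, hts, hx⟩ := lemR hL (fun k => W) (fun k => hW) (fun k => (1 / 2) ^ (k + 2)) (fun k => by positivity)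
  have hx1 := fun k => (hx k).1
  have hx2 : ∀ k, ∃ w : W, ‖(w : X L) - x k‖ ≤ (1 / 2) ^ (k + 2) := fun k => by
    obtain ⟨u, hu, hu'⟩ := (hx k).2
    exact ⟨⟨u, hu⟩, hu'⟩
  choose w hw using hx2
  have hp : ∀ k : ℕ, (1 / 2 : ℝ) ^ (k + 2) ≤ 1 / 4 := fun k => by
    have : (1 / 2 : ℝ) ^ (k + 2) ≤ (1 / 2) ^ 2 := pow_le_pow_of_le_one (by norm_num) (by norm_num) (by omega)
    norm_num at this ⊢; exact this
  have hD1 := h.pert (g' := fun k => (w k : X L)) (by norm_num : (0 : ℝ) < 1 / 2) hx1 (DomX.refl _) (fun k =>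
    (hw k).trans (pow_le_pow_of_le_one (by norm_num) (by norm_num) (by omega)))
  have hD2 : DomX 1 (fun k => (w k : X L)) w := fun I a => by
    rw [one_mul]; refine le_of_eq ?_
    rw [← Submodule.norm_coe]; congr 1; simp
  let T' : W →L[ℝ] X L' := W'.subtypeL.comp (T : W →L[ℝ] W')
  have hD := (hD1.trans hD2 zero_le_one).trans (DomX.clm T' w) (norm_nonneg _)
  have hT : 0 < ‖(T.symm : W' →L[ℝ] W)‖ + 1 := by positivity
  refine cross_false h ?_ hD (δ := 1 / 4 / (‖(T.symm : W' →L[ℝ] W)‖ + 1)) (by positivity) (fun k => ?_) hLL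
  · intro γ ε hε
    obtain ⟨F, hF, -⟩ := exists_extension_norm_eq W ((ev L' γ).comp T')
    obtain ⟨N, hN⟩ := (null_fun F).ev h (half_pos hε)
    obtain ⟨N2, hN2⟩ := half_small (ε := ε / (2 * (‖F‖ + 1))) (by positivity)
    refine ⟨max N N2, fun k hk => ?_⟩
    have e : T' (w k) γ = F (x k) + F (w k - x k) := by
      rw [← map_add, add_sub_cancel, hF]; rfl
    have b1 := hN k ((le_max_left _ _).trans hk)
    have b2 := F.le_opNorm (w k - x k)
    have b3 := (hw k).trans (hN2 (k + 2) (by have := le_max_right N N2; omega))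
    have b4 : ‖F‖ * ‖(w k : X L) - x k‖ ≤ (‖F‖ + 1) * (ε / (2 * (‖F‖ + 1))) := by gcongr; linarith
    have b5 : (‖F‖ + 1) * (ε / (2 * (‖F‖ + 1))) = ε / 2 := by field_simp
    rw [e]
    refine (abs_add_le _ _).trans ?_
    rw [Real.norm_eq_abs] at b1 b2
    linarith
  · rw [div_le_iff₀ hT]
    have b1 := (T.symm : W' →L[ℝ] W).le_opNorm (T (w k))
    have b2 : ((T.symm : W' →L[ℝ] W)) (T (w k)) = w k := T.symm_apply_apply _
    rw [b2] at b1
    have b3 : ‖T' (w k)‖ = ‖T (w k)‖ := rfl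
    have b4 := norm_sub_norm_le (x k) (w k)
    rw [norm_sub_rev] at b4
    have b5 : ‖(w k : X L)‖ = ‖w k‖ := rfl
    rw [b3]
    nlinarith [hw k, hp k, hx1 k, norm_nonneg (T (w k))]
end AH

namespace AH
open Finset
variable {L : Set ℕ} {γ n m p : ℕ} {U : Submodule ℝ (X L)}

lemma unif (V : Submodule ℝ (X L)) [FiniteDimensional ℝ V] {ε : ℝ} (hε : 0 < ε) :
    ∃ N, ∀ n ≥ N, ∀ v ∈ V, ‖v - PX L n v‖ ≤ ε * ‖v‖ := by
  let b := Module.finBasis ℝ V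
  let c : Fin (Module.finrank ℝ V) → (V →L[ℝ] ℝ) := fun i => LinearMap.toContinuousLinearMap (b.coord i)
  set K := ∑ i, ‖c i‖
  have hK : 0 ≤ K := sum_nonneg fun _ _ => ContinuousLinearMap.opNorm_nonneg _
  have h1 : ∀ i, ∃ N, ∀ n ≥ N, ‖(b i : X L) - PX L n (b i)‖ ≤ ε / (K + 1) := fun i => PX_tend _ (by positivity)
  choose N hN using h1
  refine ⟨∑ i, N i, fun n hn v hv => ?_⟩
  have e : v = ∑ i, c i ⟨v, hv⟩ • (b i : X L) := by
    have := congrArg (Subtype.val) (b.sum_repr ⟨v, hv⟩)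
    simp only [Submodule.coe_sum, Submodule.coe_smul] at this
    exact this.symm
  have e2 : v - PX L n v = ∑ i, c i ⟨v, hv⟩ • ((b i : X L) - PX L n (b i)) := by
    conv_lhs => rw [e]
    simp only [map_sum, map_smul, smul_sub, sum_sub_distrib]
  rw [e2]
  refine (norm_sum_le _ _).trans ?_
  have h2 : ∀ i ∈ univ, ‖c i ⟨v, hv⟩ • ((b i : X L) - PX L n (b i))‖ ≤ ‖c i‖ * (‖v‖ * (ε / (K + 1))) := fun i _ => by
    rw [norm_smul, ← mul_assoc]
    have h3 : ‖c i ⟨v, hv⟩‖ ≤ ‖c i‖ * ‖v‖ := (c i).le_opNorm ⟨v, hv⟩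
    have h4 := hN i n ((single_le_sum (f := N) (fun _ _ => Nat.zero_le _) (mem_univ i)).trans hn)
    gcongr
  refine (sum_le_sum h2).trans ?_
  rw [← sum_mul]
  have h5 : K * (‖v‖ * (ε / (K + 1))) = (K / (K + 1)) * (ε * ‖v‖) := by field_simp
  have h6 : K / (K + 1) ≤ 1 := by rw [div_le_one (by positivity)]; linarith
  rw [h5]
  exact mul_le_of_le_one_left (by positivity) h6

structure VN (U : Submodule ℝ (X L)) where
  V : Submodule ℝ (X L)
  n : ℕ
  le : V ≤ U
  fd : FiniteDimensional ℝ V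

lemma vn_step (hU : ¬ FiniteDimensional ℝ U) (k : ℕ) (a : VN U) : ∃ b : VN U, a.V < b.V ∧ a.n ≤ b.n ∧
    (∀ z ∈ b.V, ∃ v ∈ a.V, PX L a.n (z - v) = 0) ∧
    ∃ γ, b.n = γ + 1 ∧ k ≤ γ ∧ nd γ = nd k ∧ ∀ v ∈ b.V, ‖v - PX L γ v‖ ≤ (1 / 2) ^ (k + 3) * ‖v‖ := by
  have := a.fd
  obtain ⟨N0, hN0⟩ := unif a.V (ε := 1 / 2) (by norm_num)
  obtain ⟨u, hu, hu0, hu1⟩ := exists_vanish hU (max a.n N0)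
  let V' := a.V ⊔ Submodule.span ℝ {u}
  have fd' : FiniteDimensional ℝ V' := by infer_instance
  obtain ⟨N, hN⟩ := unif V' (ε := (1 / 2) ^ (k + 3)) (by positivity)
  obtain ⟨γ, hγ, hnd⟩ := exists_nd (nd k) (max (max k a.n) N)
  have i1 : k ≤ γ := ((le_max_left _ _).trans (le_max_left _ _)).trans hγ
  have i2 : a.n ≤ γ := ((le_max_right _ _).trans (le_max_left _ _)).trans hγ
  have i3 : N ≤ γ := (le_max_right _ _).trans hγ
  have huV : u ∉ a.V := fun h => by
    have h1 := hN0 (max a.n N0) (le_max_right _ _) u h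
    rw [hu1, sub_zero] at h1
    have := norm_pos_iff.2 hu0
    linarith
  refine ⟨⟨V', γ + 1, sup_le a.le ((Submodule.span_singleton_le_iff_mem _ _).2 hu), fd'⟩, ?_, by show a.n ≤ γ + 1; omega, ?_, γ, rfl, i1, hnd, hN γ i3⟩
  · refine lt_of_le_of_ne le_sup_left fun h => huV ?_
    rw [h]; exact Submodule.mem_sup_right (Submodule.mem_span_singleton_self u)
  · intro z hz
    obtain ⟨v, hv, w, hw, rfl⟩ := Submodule.mem_sup.1 hz
    obtain ⟨c, rfl⟩ := Submodule.mem_span_singleton.1 hw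
    refine ⟨v, hv, ?_⟩
    have : PX L a.n u = 0 := by
      rw [← PX_PX_le (le_max_left a.n N0), hu1, map_zero]
    rw [add_sub_cancel_left, map_smul, this, smul_zero]

lemma exists_Z (hc : IsClosed (U : Set (X L))) (hU : ¬ FiniteDimensional ℝ U) : ∃ Z ≤ U, IsClosed (Z : Set (X L)) ∧ ¬ FiniteDimensional ℝ Z ∧
    ∃ γ : ℕ → ℕ, ∀ k, k ≤ γ k ∧ nd (γ k) = nd k ∧ ∀ z ∈ Z, |z (γ k) - PX L (γ k) z (γ k)| ≤ (1 / 2) ^ k * ‖z‖ := by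
  choose F hF using vn_step hU
  let a : ℕ → VN U := fun k => Nat.rec ⟨⊥, 0, bot_le, inferInstance⟩ (fun k b => F k b) k
  have ha : ∀ k, a (k + 1) = F k (a k) := fun k => rfl
  have h1 : ∀ k, (a k).V < (a (k + 1)).V := fun k => (hF k (a k)).1
  have h2 : ∀ k, (a k).n ≤ (a (k + 1)).n := fun k => (hF k (a k)).2.1
  have h3 : ∀ k, ∀ z ∈ (a (k + 1)).V, ∃ v ∈ (a k).V, PX L (a k).n (z - v) = 0 := fun k => (hF k (a k)).2.2.1
  have h4 : ∀ k, ∃ γ, (a (k + 1)).n = γ + 1 ∧ k ≤ γ ∧ nd γ = nd k ∧ ∀ v ∈ (a (k + 1)).V, ‖v - PX L γ v‖ ≤ (1 / 2) ^ (k + 3) * ‖v‖ :=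
    fun k => (hF k (a k)).2.2.2
  clear_value a
  clear ha
  choose γ g1 g2 g3 g4 using h4
  have hm : Monotone fun k => (a k).V := monotone_nat_of_le_succ fun k => (h1 k).le
  have hn : Monotone fun k => (a k).n := monotone_nat_of_le_succ h2
  have h5 : ∀ k d, ∀ z ∈ (a (k + d)).V, ∃ v ∈ (a k).V, PX L (a k).n (z - v) = 0 := by
    intro k d
    induction d with
    | zero => intro z hz; exact ⟨z, hz, by simp⟩
    | succ d ih =>
      intro z hz
      obtain ⟨v, hv, e⟩ := h3 (k + d) z hz
      obtain ⟨v', hv', e'⟩ := ih v hv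
      refine ⟨v', hv', ?_⟩
      have : z - v' = (z - v) + (v - v') := by abel
      rw [this, map_add, e', add_zero, ← PX_PX_le (hn (Nat.le_add_right k d)), e, map_zero]
  have hdir : Directed (· ≤ ·) fun k => (a k).V := hm.directed_le
  have hZ0 : (⨆ k, (a k).V) ≤ U := iSup_le fun k => (a k).le
  refine ⟨(⨆ k, (a k).V).topologicalClosure, Submodule.topologicalClosure_minimal _ hZ0 hc, Submodule.isClosed_topologicalClosure _, ?_, γ, fun k => ⟨g2 k, g3 k, ?_⟩⟩
  · intro hfd
    have hr : ∀ k, k ≤ Module.finrank ℝ (a k).V := by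
      intro k
      induction k with
      | zero => exact Nat.zero_le _
      | succ k ih =>
        have := (a (k + 1)).fd
        have := Submodule.finrank_lt_finrank_of_lt (h1 k)
        omega
    have h6 := hr (Module.finrank ℝ (⨆ k, (a k).V).topologicalClosure + 1)
    have h7 := Submodule.finrank_mono (((le_iSup (fun k => (a k).V) (Module.finrank ℝ (⨆ k, (a k).V).topologicalClosure + 1))).trans
      (Submodule.le_topologicalClosure _))
    omega
  · have hcl : IsClosed {z : X L | |z (γ k) - PX L (γ k) z (γ k)| ≤ (1 / 2) ^ k * ‖z‖} := by
      have c1 : Continuous fun z : X L => z (γ k) := (ev L (γ k)).continuous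
      have c2 : Continuous fun z : X L => PX L (γ k) z (γ k) := ((ev L (γ k)).comp (PX L (γ k))).continuous
      exact isClosed_le (c1.sub c2).abs (continuous_const.mul continuous_norm)
    refine fun z hz => closure_minimal (fun z hz => ?_) hcl hz
    obtain ⟨l, hl⟩ := (Submodule.mem_iSup_of_directed _ hdir).1 hz
    have hl' : z ∈ (a (k + 1 + l)).V := hm (by omega : l ≤ k + 1 + l) hl
    obtain ⟨v, hv, e⟩ := h5 (k + 1) l z hl'
    have e1 : z (γ k) = v (γ k) := by
      have := PX_eq_zero_iff.1 e (γ k) (by rw [g1]; omega)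
      rwa [X.sub_ap, sub_eq_zero] at this
    have e2 : PX L (γ k) z = PX L (γ k) v := by
      rw [← sub_eq_zero, ← map_sub, ← PX_PX_le (by rw [g1]; omega : γ k ≤ (a (k + 1)).n), e, map_zero]
    have b1 := g4 k v hv
    have b2 : (1 / 2 : ℝ) ^ (k + 3) = 1 / 8 * (1 / 2) ^ k := by rw [pow_add]; ring
    have b3 : (1 / 2 : ℝ) ^ k ≤ 1 := pow_le_one₀ (by norm_num) (by norm_num)
    have b4 := PX_norm (L := L) (n := γ k) z
    rw [e2] at b4
    have b5 := norm_sub_norm_le v (PX L (γ k) v)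
    have b6 : ‖v‖ ≤ 4 * ‖z‖ := by
      rw [b2] at b1
      nlinarith [norm_nonneg v]
    have b7 := (v - PX L (γ k) v).ap_le (γ k)
    rw [X.sub_ap] at b7
    show |z (γ k) - PX L (γ k) z (γ k)| ≤ (1 / 2) ^ k * ‖z‖
    rw [e1, e2]
    refine (b7.trans b1).trans ?_
    rw [b2]
    have b8 : (0 : ℝ) < (1 / 2) ^ k := by positivity
    nlinarith [norm_nonneg z]
end AH

namespace AH
open Finset
variable {L : Set ℕ} {γ n m p : ℕ}

def PL (L : Set ℕ) (n : ℕ) : (ℕ → ℝ) →ₗ[ℝ] (ℕ → ℝ) where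
  toFun u := Pr L n u
  map_add' u v := by
    have := Pr_lin (L := L) n 1 1 u v
    simp only [one_mul] at this; exact this
  map_smul' a u := by
    have := Pr_lin (L := L) n a 0 u 0
    simp only [zero_mul, add_zero] at this; exact this

def bs (L : Set ℕ) (n η : ℕ) : X L := ofPr L n (Pi.single η 1)

lemma Pr_sum (u : ℕ → ℝ) (γ : ℕ) : Pr L n u γ = ∑ η ∈ range n, u η * bs L n η γ := by
  have h1 : Pr L n u = PL L n (∑ η ∈ range n, u η • Pi.single η (1 : ℝ)) := by
    refine Pr_congr fun γ h _ => ?_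
    rw [Finset.sum_apply, sum_eq_single γ]
    · simp
    · intro b _ hb; simp [Pi.single_apply, hb.symm]
    · intro h'; exact absurd (mem_range.2 h) h'
  rw [h1, map_sum, Finset.sum_apply]
  refine sum_congr rfl fun η _ => ?_
  rw [map_smul]; rfl

lemma PX_sum (x : X L) : PX L n x = ∑ η ∈ range n, x η • bs L n η := by
  refine X.ext' fun γ => ?_
  rw [X.sum_ap, PX_ap, Pr_sum]; rfl

lemma PX_fun (f : X L →L[ℝ] ℝ) : f.comp (PX L n) = ∑ η ∈ range n, f (bs L n η) • ev L η := by
  refine ContinuousLinearMap.ext fun x => ?_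
  rw [ContinuousLinearMap.comp_apply, PX_sum, map_sum, ContinuousLinearMap.sum_apply]
  refine sum_congr rfl fun η _ => ?_
  rw [map_smul, ContinuousLinearMap.smul_apply, ev_ap, smul_eq_mul, smul_eq_mul, mul_comm]

section
variable {r : (X L →L[ℝ] ℝ) →ₗ[ℝ] ℝ} {M : ℝ} {Z : Submodule ℝ (X L)}

lemma r_PX (f : X L →L[ℝ] ℝ) : r (f.comp (PX L n)) = ∑ η ∈ range n, r (ev L η) * f (bs L n η) := by
  rw [PX_fun, map_sum]
  refine sum_congr rfl fun η _ => ?_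
  rw [map_smul, smul_eq_mul, mul_comm]

lemma r_Pr : r ((ev L γ).comp (PX L n)) = Pr L n (fun η => r (ev L η)) γ := by
  rw [r_PX, Pr_sum]; rfl

lemma mem_of_fun {G : X L} (hZ : IsClosed (Z : Set (X L))) (h : ∀ f : X L →L[ℝ] ℝ, (∀ z ∈ Z, f z = 0) → f G = 0) : G ∈ Z := by
  by_contra hG
  obtain ⟨f, u, h1, h2⟩ := geometric_hahn_banach_point_closed Z.convex hZ hG
  have h0 := h2 0 Z.zero_mem
  rw [map_zero] at h0
  have := h f fun z hz => by
    by_contra hne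
    have := h2 ((u / f z) • z) (Z.smul_mem _ hz)
    rw [map_smul, smul_eq_mul, div_mul_cancel₀ _ hne] at this
    exact lt_irrefl _ this
  linarith

/-- the key chain argument -/
lemma g_conv (hL : Good L) (hM : 0 ≤ M) (hr : ∀ f : X L →L[ℝ] ℝ, ∀ c ≥ 0, (∀ z ∈ Z, |f z| ≤ c * ‖z‖) → |r f| ≤ M * c)
    {ν : ℕ → ℕ} (hν : ∀ k, k ≤ ν k ∧ nd (ν k) = nd k ∧ ∀ z ∈ Z, |z (ν k) - PX L (ν k) z (ν k)| ≤ (1 / 2) ^ k * ‖z‖) :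
    ∀ ε > 0, ∃ N, ∀ n ≥ N, ∀ γ, |r (ev L γ) - Pr L n (fun η => r (ev L η)) γ| ≤ ε := by
  set g : ℕ → ℝ := fun η => r (ev L η) with hg
  have hgb : ∀ γ, |g γ| ≤ M := fun γ => by
    have := hr (ev L γ) 1 zero_le_one fun z _ => by rw [one_mul]; exact z.ap_le γ
    rwa [mul_one] at this
  have hgn : ∀ γ, ¬ Act L γ → g γ = 0 := fun γ h => by
    have : ev L γ = 0 := ContinuousLinearMap.ext fun x => x.nact h
    simp only [hg, this, map_zero]
  by_contra hc
  push Not at hc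
  obtain ⟨ε, hε, hc⟩ := hc
  set δ := ε / 3 with hδ'
  have hδ : 0 < δ := by positivity
  have hbad : ∀ p, ∃ η, p ≤ η ∧ Act L η ∧ δ < |g η - Pr L p g η| := by
    intro p
    by_contra hp
    push Not at hp
    have hall : ∀ η, |g η - Pr L p g η| ≤ δ := fun η => by
      by_cases ha : Act L η
      · by_cases hη : η < p
        · rw [Pr_lt ha hη, sub_self, abs_zero]; exact hδ.le
        · exact hp η (by omega) ha
      · rw [hgn η ha, Pr_nact ha, sub_self, abs_zero]; exact hδ.le
    obtain ⟨n, hn, γ, hγ⟩ := hc p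
    have e : Pr L n g = fun η => Pr L n (fun η => g η - Pr L p g η) η + Pr L p g η := by
      have h1 := Pr_lin (L := L) n 1 1 (fun η => g η - Pr L p g η) (Pr L p g)
      simp only [one_mul, sub_add_cancel, Pr_Pr_ge hn] at h1
      exact h1
    have b1 := Pr_bound (L := L) (n := n) (u := fun η => g η - Pr L p g η) (c := δ) (fun η _ _ => hall η) hδ.le γ
    have b2 := hall γ
    rw [e] at hγ
    have e3 : g γ - (Pr L n (fun η => g η - Pr L p g η) γ + Pr L p g γ) = (g γ - Pr L p g γ) - Pr L n (fun η => g η - Pr L p g η) γ := by ring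
    dsimp only at hγ
    rw [e3] at hγ
    have := abs_sub (g γ - Pr L p g γ) (Pr L n (fun η => g η - Pr L p g η) γ)
    linarith
  obtain ⟨N, hN⟩ := exists_mm (4 * M / δ)
  obtain ⟨i, hi, hiL, he, -⟩ := hL.ev 0 N
  have hmi := hN i hi
  have hm := mm_pos i
  -- one step
  have hstep : ∀ p a : ℕ, (p ≠ 0 → Act L (p - 1) ∧ W (p - 1) = i ∧ AG (p - 1) < a + 1) → a + 1 ≤ nn i →
      ∃ ξ, Act L ξ ∧ W ξ = i ∧ AG ξ = a + 1 ∧ (if p = 0 then 0 else g (p - 1)) + δ / (4 * mm i) ≤ g ξ := by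
    intro p a hp ha
    obtain ⟨η, h1, h2, h3⟩ := hbad p
    obtain ⟨σ, hσ, hσ'⟩ : ∃ σ : ℚ, |σ| ≤ 1 ∧ δ < σ * (g η - Pr L p g η) := by
      rcases abs_cases (g η - Pr L p g η) with ⟨e, _⟩ | ⟨e, _⟩
      · exact ⟨1, by simp, by rw [e] at h3; simpa using h3⟩
      · exact ⟨-1, by simp, by rw [e] at h3; simpa using h3⟩
    obtain ⟨N1, hN1⟩ := half_small (ε := δ / (4 * mm i * (M + 1))) (by positivity)
    obtain ⟨k, hk, hnd⟩ := exists_nd (i, a + 1, p, η, 0, σ, 0) (max N1 (i + p + η + 1))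
    obtain ⟨v1, v2, v3⟩ := hν k
    have hk1 := (le_max_left _ _).trans hk
    have hk2 := (le_max_right _ _).trans hk
    set ξ := ν k with hξ
    have hnd' : nd ξ = (i, a + 1, p, η, 0, σ, 0) := v2.trans hnd
    have hA : Act L ξ := act_of_nd hnd' hiL (by omega) ha hσ (by simp) (fun _ => ⟨h1, h2⟩) (by simp) hp
      (fun h => absurd he (Nat.not_even_iff_odd.2 h)) (by omega)
    have w1 : W ξ = i := by simp [W, hnd']
    have w2 : AG ξ = a + 1 := by simp [AG, hnd']
    have w3 : Pp ξ = p := by simp [Pp, hnd']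
    have w4 : E1 ξ = η := by simp [E1, hnd']
    have w6 : R1 ξ = σ := by simp [R1, hnd']
    have w7 : R0 ξ = 0 := by simp [R0, hnd']
    refine ⟨ξ, hA, w1, w2, ?_⟩
    have hrec : ∀ u : ℕ → ℝ, Pr L ξ u ξ = (if p = 0 then 0 else u (p - 1)) + (mm i)⁻¹ * (σ / 2 * (u η - Pr L p u η)) := by
      intro u
      rw [Pr_ge hA le_rfl, w3, if_neg (by omega), pv, w3, bb, w4, w6, w7, w1, Pr_lt h2 (by omega)]
      by_cases hp0 : p = 0
      · rw [if_pos hp0, if_pos hp0]; ring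
      · rw [if_neg hp0, if_neg hp0, Pr_lt (hp hp0).1 (by omega)]; ring
    have hrr : r (ev L ξ - (ev L ξ).comp (PX L ξ)) = g ξ - Pr L ξ g ξ := by rw [map_sub, r_Pr]
    have hb := hr (ev L ξ - (ev L ξ).comp (PX L ξ)) ((1 / 2) ^ k) (by positivity) v3
    rw [hrr, hrec] at hb
    have hb1 := (abs_le.1 hb).1
    have hb2 : M * (1 / 2) ^ k ≤ M * (δ / (4 * mm i * (M + 1))) := mul_le_mul_of_nonneg_left (hN1 k hk1) hM
    have hb3 : M * (δ / (4 * mm i * (M + 1))) ≤ δ / (4 * mm i) := by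
      have : M * (δ / (4 * mm i * (M + 1))) = M / (M + 1) * (δ / (4 * mm i)) := by field_simp
      rw [this]
      exact mul_le_of_le_one_left (by positivity) (by rw [div_le_one (by positivity)]; linarith)
    have hb4 : δ / (4 * mm i) + δ / (4 * mm i) ≤ (mm i)⁻¹ * (σ / 2 * (g η - Pr L p g η)) := by
      have : δ / (4 * mm i) + δ / (4 * mm i) = (mm i)⁻¹ * (δ / 2) := by field_simp; norm_num
      rw [this]
      gcongr
      linarith
    linarith
  have hch : ∀ a, a + 1 ≤ nn i → ∃ ξ, Act L ξ ∧ W ξ = i ∧ AG ξ = a + 1 ∧ (a + 1 : ℝ) * (δ / (4 * mm i)) ≤ g ξ := by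
    intro a
    induction a with
    | zero =>
      intro h
      obtain ⟨ξ, c1, c2, c3, c4⟩ := hstep 0 0 (by simp) h
      refine ⟨ξ, c1, c2, c3, ?_⟩
      simpa using c4
    | succ a ih =>
      intro h
      obtain ⟨ξ, c1, c2, c3, c4⟩ := ih (by omega)
      obtain ⟨ξ', d1, d2, d3, d4⟩ := hstep (ξ + 1) (a + 1) (fun _ => ⟨c1, c2, by simp [c3]⟩) h
      refine ⟨ξ', d1, d2, d3, ?_⟩
      simp only [Nat.add_eq_zero_iff, one_ne_zero, and_false, if_false, Nat.add_sub_cancel] at d4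
      push_cast
      linarith
  have hnn := nn_pos i
  obtain ⟨ξ, -, -, -, c4⟩ := hch (nn i - 1) (by omega)
  have e : ((nn i - 1 : ℕ) : ℝ) + 1 = nn i := by exact_mod_cast (by omega : nn i - 1 + 1 = nn i)
  rw [e] at c4
  have c5 := (le_abs_self _).trans (hgb ξ)
  have c6 := mm_sq_nn i
  have c7 : mm i ^ 2 * (δ / (4 * mm i)) ≤ nn i * (δ / (4 * mm i)) := by gcongr
  have c8 : mm i ^ 2 * (δ / (4 * mm i)) = mm i * δ / 4 := by field_simp
  rw [div_lt_iff₀ hδ] at hmi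
  linarith
end

lemma refl_sat (hL : Good L) : ReflexivelySaturated (X L) := by
  intro U hUc hU
  obtain ⟨Z, hZU, hZc, hZ, ν, hν⟩ := exists_Z hUc hU
  refine ⟨Z, hZU, hZc, hZ, ?_⟩
  intro φ
  let r : (X L →L[ℝ] ℝ) →ₗ[ℝ] ℝ :=
    { toFun := fun f => φ (f.comp Z.subtypeL)
      map_add' := fun f g => by rw [ContinuousLinearMap.add_comp, map_add]
      map_smul' := fun a f => by rw [ContinuousLinearMap.smul_comp, map_smul]; rfl }
  have hrr : ∀ f, r f = φ (f.comp Z.subtypeL) := fun f => rfl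
  have hM : 0 ≤ ‖φ‖ := ContinuousLinearMap.opNorm_nonneg _
  have hr : ∀ f : X L →L[ℝ] ℝ, ∀ c ≥ 0, (∀ z ∈ Z, |f z| ≤ c * ‖z‖) → |r f| ≤ ‖φ‖ * c := fun f c hc h => by
    refine (φ.le_opNorm (f.comp Z.subtypeL)).trans (mul_le_mul_of_nonneg_left ?_ hM)
    exact ContinuousLinearMap.opNorm_le_bound _ hc fun z => h z z.2
  have hconv := g_conv hL hM hr hν
  have hgb : ∀ γ, |r (ev L γ)| ≤ ‖φ‖ := fun γ => by
    have := hr (ev L γ) 1 zero_le_one fun z _ => by rw [one_mul]; exact z.ap_le γ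
    rwa [mul_one] at this
  let G : X L := X.mk (fun η => r (ev L η)) ⟨_, hgb⟩ hconv
  have hG : ∀ η, G η = r (ev L η) := fun η => rfl
  have hfG : ∀ f : X L →L[ℝ] ℝ, r f = f G := by
    intro f
    have hle : ∀ δ > 0, |r f - f G| ≤ δ * (‖φ‖ + ‖G‖) := by
      intro δ hδ
      obtain ⟨n, hn⟩ := tail' (null_fun f) hδ
      have hn := hn n le_rfl
      have e1 : r (f.comp (PX L n)) = f (PX L n G) := by
        rw [r_PX, PX_sum, map_sum]
        exact sum_congr rfl fun η _ => by rw [map_smul, smul_eq_mul, hG]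
      have b1 := hr (f - f.comp (PX L n)) δ hδ.le fun z _ => hn z
      have b2 := hn G
      rw [map_sub, e1] at b1
      have e2 : r f - f G = (r f - f (PX L n G)) - (f G - f (PX L n G)) := by ring
      rw [e2]
      refine (abs_sub _ _).trans ?_
      rw [Real.norm_eq_abs] at b2
      linarith
    by_contra hne
    have hpos : 0 < |r f - f G| := abs_pos.2 (sub_ne_zero.2 hne)
    have hq : 0 < ‖φ‖ + ‖G‖ + 1 := by positivity
    have := hle (|r f - f G| / (‖φ‖ + ‖G‖ + 1)) (by positivity)
    rw [div_mul_eq_mul_div, le_div_iff₀ hq] at this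
    nlinarith
  have hGZ : G ∈ Z := mem_of_fun hZc fun f hf => by
    rw [← hfG, hrr]
    have : f.comp Z.subtypeL = 0 := ContinuousLinearMap.ext fun z => hf z z.2
    rw [this, map_zero]
  refine ⟨⟨G, hGZ⟩, ContinuousLinearMap.ext fun h => ?_⟩
  obtain ⟨f, hf, -⟩ := exists_extension_norm_eq Z h
  have e : f.comp Z.subtypeL = h := ContinuousLinearMap.ext fun z => hf z
  have := hfG f
  rw [hrr, e] at this
  rw [this, NormedSpace.dual_def]
  exact (hf ⟨G, hGZ⟩).symm
end AH

namespace AH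

lemma omega1_inj : Nonempty ({ξ : Ordinal.{0} // ξ < (Cardinal.aleph 1).ord} ↪ (ℕ → Bool)) := by
  rw [← Cardinal.lift_mk_le']
  have h1 : Cardinal.mk {ξ : Ordinal.{0} // ξ < (Cardinal.aleph 1).ord} = Cardinal.lift.{1} (Cardinal.aleph.{0} 1) := by
    have := Cardinal.mk_Iio_ordinal (Cardinal.aleph.{0} 1).ord
    rw [Cardinal.card_ord] at this
    exact this
  have h2 : Cardinal.mk (ℕ → Bool) = Cardinal.continuum := by simp
  rw [h1, h2, Cardinal.lift_lift]
  simpa using Cardinal.aleph_one_le_continuum.{1}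

def LL (f : ℕ → Bool) : Set ℕ := {j | ∃ k n, j / 2 = Nat.pair k (Nat.pair n (Encodable.encode ((List.range n).map f)))}

lemma LL_good (f : ℕ → Bool) : Good (LL f) := by
  constructor
  · intro k M
    set c := Encodable.encode ((List.range M).map f) with hc
    have h1 := Nat.right_le_pair k (Nat.pair M c)
    have h2 := Nat.left_le_pair M c
    refine ⟨2 * Nat.pair k (Nat.pair M c), by omega, ⟨k, M, by simp [hc]⟩, ⟨_, two_mul _⟩, by simp [kap]⟩
  · intro M
    set c := Encodable.encode ((List.range M).map f) with hc
    have h1 := Nat.right_le_pair 0 (Nat.pair M c)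
    have h2 := Nat.left_le_pair M c
    exact ⟨2 * Nat.pair 0 (Nat.pair M c) + 1, by omega, ⟨0, M, by rw [← hc]; omega⟩, ⟨_, rfl⟩⟩

lemma LL_diff {f g : ℕ → Bool} (h : f ≠ g) (M : ℕ) : ∃ i ≥ M, i ∈ LL g ∧ i ∉ LL f ∧ Even i := by
  obtain ⟨d, hd⟩ := Function.ne_iff.1 h
  set n := max M (d + 1) with hn
  set c := Encodable.encode ((List.range n).map g) with hc
  have h1 := Nat.right_le_pair 0 (Nat.pair n c)
  have h2 := Nat.left_le_pair n c
  have h3 : M ≤ n := le_max_left _ _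
  have h4 : d + 1 ≤ n := le_max_right _ _
  refine ⟨2 * Nat.pair 0 (Nat.pair n c), by omega, ⟨0, n, by rw [← hc]; omega⟩, ?_, ⟨_, two_mul _⟩⟩
  rintro ⟨k, m, e⟩
  rw [Nat.mul_div_cancel_left _ (by norm_num), Nat.pair_eq_pair, Nat.pair_eq_pair] at e
  obtain ⟨-, rfl, e⟩ := e
  rw [hc, Encodable.encode_inj, List.map_inj_left] at e
  exact hd (e d (List.mem_range.2 h4)).symm

def Yf (f : ℕ → Bool) : BanachPkg := ⟨X (LL f)⟩

theorem main :
    ∃ (B : Type) (_ : NormedAddCommGroup B) (_ : NormedSpace ℝ B) (_ : CompleteSpace B)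
      (Y : {ξ : Ordinal.{0} // ξ < (Cardinal.aleph 1).ord} → BanachPkg),
      (¬FiniteDimensional ℝ B ∧ TopologicalSpace.SeparableSpace B ∧ IsLinftySpace B) ∧
      (∀ ξ, ¬FiniteDimensional ℝ (Y ξ).carrier ∧
        TopologicalSpace.SeparableSpace (Y ξ).carrier ∧
        IsLinftySpace (Y ξ).carrier ∧
        HereditarilyIndecomposable (Y ξ).carrier ∧
        ReflexivelySaturated (Y ξ).carrier ∧
        ScalarPlusCompact (Y ξ).carrier) ∧
      (∀ ξ, ∃ Q : B →L[ℝ] (Y ξ).carrier, Function.Surjective Q) ∧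
      (∀ ξ ζ, ξ ≠ ζ →
        ∀ W : Submodule ℝ (Y ξ).carrier, IsClosed (W : Set (Y ξ).carrier) →
          ¬FiniteDimensional ℝ ↥W →
            ∀ W' : Submodule ℝ (Y ζ).carrier, IsClosed (W' : Set (Y ζ).carrier) →
              ¬Nonempty (↥W ≃L[ℝ] ↥W')) ∧
      (∀ ξ ζ, ξ ≠ ζ → ∀ T : (Y ξ).carrier →L[ℝ] (Y ζ).carrier, IsCompactOperator T) := by
  obtain ⟨ι⟩ := omega1_inj
  refine ⟨X Set.univ, inferInstance, inferInstance, inferInstance, fun ξ => Yf (ι ξ),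
    ⟨X_infdim (i := 0) (Set.mem_univ _) (by simp), X_sep, X_linfty⟩, fun ξ => ?_, fun ξ => ⟨QX _, QX_surj _⟩,
    fun ξ ζ h W _ hW W' _ hT => ?_, fun ξ ζ h T => cross_compact (L := LL (ι ξ)) (L' := LL (ι ζ)) T (LL_diff (ι.injective.ne h))⟩
  · have hG := LL_good (ι ξ)
    obtain ⟨i, -, hi, he, -⟩ := hG.ev 0 0
    exact ⟨X_infdim hi he, X_sep, X_linfty, hi_X hG, refl_sat hG, spc hG⟩
  · obtain ⟨T⟩ := hT
    exact incomp (L := LL (ι ξ)) (L' := LL (ι ζ)) (LL_good _) (LL_diff (ι.injective.ne h)) W hW W' T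
end AH

/-- **Statement 15.** There exist a separable infinite-dimensional `L∞`-space `B` and a
family `(Y_ξ)_{ξ<ω₁}` of infinite-dimensional separable Banach spaces, each of which is a
hereditarily indecomposable, reflexively saturated `L∞`-space with the scalar-plus-compact
property and a quotient of `B`, such that distinct members are totally incomparable and
every bounded operator between distinct members is compact. -/
theorem exists_omega1_family_of_quotients :
    ∃ (B : Type) (_ : NormedAddCommGroup B) (_ : NormedSpace ℝ B) (_ : CompleteSpace B)
      (Y : {ξ : Ordinal.{0} // ξ < (Cardinal.aleph 1).ord} → BanachPkg),
      (¬FiniteDimensional ℝ B ∧ TopologicalSpace.SeparableSpace B ∧ IsLinftySpace B) ∧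
      (∀ ξ, ¬FiniteDimensional ℝ (Y ξ).carrier ∧
        TopologicalSpace.SeparableSpace (Y ξ).carrier ∧
        IsLinftySpace (Y ξ).carrier ∧
        HereditarilyIndecomposable (Y ξ).carrier ∧
        ReflexivelySaturated (Y ξ).carrier ∧
        ScalarPlusCompact (Y ξ).carrier) ∧
      (∀ ξ, ∃ Q : B →L[ℝ] (Y ξ).carrier, Function.Surjective Q) ∧
      (∀ ξ ζ, ξ ≠ ζ →
        ∀ W : Submodule ℝ (Y ξ).carrier, IsClosed (W : Set (Y ξ).carrier) →
          ¬FiniteDimensional ℝ ↥W →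
            ∀ W' : Submodule ℝ (Y ζ).carrier, IsClosed (W' : Set (Y ζ).carrier) →
              ¬Nonempty (↥W ≃L[ℝ] ↥W')) ∧
      (∀ ξ ζ, ξ ≠ ζ → ∀ T : (Y ξ).carrier →L[ℝ] (Y ζ).carrier, IsCompactOperator T) := by
  exact AH.main
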